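/- arXiv:1411.3695 — 2 statements merged into one kernel-verified Lean document; each statement's English description precedes it below -/
import Mathlib

section
/- Let r ≥ d ≥ 1 be integers. Then the graded Betti numbers of the Stanley-Reisner ring of the r-th edgewise subdivision of the (d-1)-simplex satisfy: (i) for 1 ≤ j ≤ d/2, β_{i,i+j}(K[Δ_{d-1}^{⟨r⟩}]) = 0 for 0 ≤ i ≤ j-1 and β_{i,i+j}(K[Δ_{d-1}^{⟨r⟩}]) ≠ 0 for j ≤ i ≤ pdim(K[Δ_{d-1}^{⟨r⟩}]); (ii) for d/2 < j ≤ d-2, β_{i,i+j}(K[Δ_{d-1}^{⟨r⟩}]) = 0 for 0 ≤ i ≤ j-1 and β_{i,i+j}(K[Δ_{d-1}^{⟨r⟩}]) ≠ 0 for m_j(d) ≤ i ≤ pdim(K[Δ_{d-1}^{⟨r⟩}]); (iii) for j = d-1, β_{i,i+j}(K[Δ_{d-1}^{⟨r⟩}]) ≠ 0 for 2^d - 1 - d ≤ i ≤ pdim(K[Δ_{d-1}^{⟨r⟩}]). Here pdim(K[Δ_{d-1}^{⟨r⟩}]) = #Ω_{r,d} - d = C(r+d-1, d-1) - d. -/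
open Finset BigOperators

noncomputable section
open scoped Classical

/-- A finite abstract simplicial complex on (a finite subset of) `ℕ`,
given as its finite set of faces. -/
abbrev SC := Finset (Finset ℕ)

/-- `Δ` is a simplicial complex: it is closed under taking subsets of faces. -/
def IsComplex {α : Type*} [DecidableEq α] (Δ : Finset (Finset α)) : Prop :=
  ∀ s ∈ Δ, ∀ t ⊆ s, t ∈ Δ

/-- The vertex set (ground set) of a complex: the union of all of its faces. -/
def vertexSet {α : Type*} [DecidableEq α] (Δ : Finset (Finset α)) : Finset α :=
  Δ.sup id

/-- The number of vertices of a complex. -/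
def nverts {α : Type*} [DecidableEq α] (Δ : Finset (Finset α)) : ℕ :=
  (vertexSet Δ).card

/-- The full `(d-1)`-simplex `Δ_{d-1}`: all subsets of a `d`-element vertex set. -/
def simplexC (d : ℕ) : SC := (Finset.range d).powerset

/-- The boundary complex of the simplex on `k` vertices (a `(k-2)`-sphere):
all proper subsets of a `k`-element vertex set. -/
def boundaryC (k : ℕ) : SC := ((Finset.range k).powerset).erase (Finset.range k)

/-- Encoding of finite subsets of `ℕ` as natural numbers (injective). -/
def enc : Finset ℕ → ℕ := Encodable.encode

/-- `C` is a chain of sets under inclusion. -/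
def IsChainF (C : Finset (Finset ℕ)) : Prop := ∀ s ∈ C, ∀ t ∈ C, s ⊆ t ∨ t ⊆ s

/-- The barycentric subdivision `sd(Δ)`: its vertices are (encodings of) the
nonempty faces of `Δ`, and its faces are the chains of nonempty faces of `Δ`. -/
def sd (Δ : SC) : SC :=
  ((Δ.erase ∅).powerset.filter IsChainF).image (fun C => C.image enc)

/-- The induced subcomplex `Δ_W` on a vertex subset `W`. -/
def inducedSC {α : Type*} [DecidableEq α] (Δ : Finset (Finset α)) (W : Finset α) :
    Finset (Finset α) := Δ.filter (fun s => s ⊆ W)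

/-- `fvec Δ k` is the number of faces of `Δ` of cardinality `k`
(i.e. of dimension `k-1`); so `f_{i}^Δ = fvec Δ (i+1)`. -/
def fvec (Δ : SC) (k : ℕ) : ℕ := (Δ.filter (fun s => s.card = k)).card

/-- A minimal non-face of a complex. -/
def IsMinNonFace {α : Type*} [DecidableEq α] (Δ : Finset (Finset α)) (N : Finset α) : Prop :=
  N ⊆ vertexSet Δ ∧ N ∉ Δ ∧ ∀ M ⊂ N, M ∈ Δ

/-- `t_1(K[Δ])`: the largest cardinality of a minimal non-face of `Δ`, equivalently the
largest degree of a minimal generator of the Stanley-Reisner ideal `I_Δ`. -/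
def t1 {α : Type*} [DecidableEq α] (Δ : Finset (Finset α)) : ℕ :=
  ((vertexSet Δ).powerset.filter (fun N => IsMinNonFace Δ N)).sup Finset.card

/-- A complex is flag if all its minimal non-faces have cardinality `2`. -/
def IsFlag {α : Type*} [DecidableEq α] (Δ : Finset (Finset α)) : Prop :=
  ∀ N : Finset α, IsMinNonFace Δ N → N.card = 2

/-- A complex is a full simplex if it consists of all subsets of its vertex set. -/
def IsFullSimplex {α : Type*} [DecidableEq α] (Δ : Finset (Finset α)) : Prop :=
  Δ = (vertexSet Δ).powerset

/-- Abstract isomorphism of simplicial complexes (possibly on different ground sets):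
there is a map of vertices, injective on the vertex set, carrying the faces of the first
complex exactly onto the faces of the second. -/
def ComplexIso {α β : Type*} [DecidableEq α] [DecidableEq β]
    (Δ : Finset (Finset α)) (Γ : Finset (Finset β)) : Prop :=
  ∃ φ : α → β, Set.InjOn φ ↑(vertexSet Δ) ∧ Γ = Δ.image (fun s => s.image φ)

variable (K : Type*) [Field K]

/-- The boundary of (the indicator chain of) a single face, with the usual signs coming
from the ordering of the vertices. -/
def bdryFace (s : Finset ℕ) : Finset ℕ →₀ K :=
  ∑ v ∈ s, ((-1 : K) ^ ((s.filter (fun w => w < v)).card)) • Finsupp.single (s.erase v) (1 : K)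

/-- The simplicial boundary operator on the (augmented/reduced) chain space. -/
def bdry : (Finset ℕ →₀ K) →ₗ[K] (Finset ℕ →₀ K) :=
  Finsupp.lsum K fun s => LinearMap.toSpanSingleton K (Finset ℕ →₀ K) (bdryFace K s)

/-- The span of the faces of `Δ` of cardinality `n` (empty for `n < 0`):
the space of `(n-1)`-dimensional reduced chains of `Δ`. -/
def facesSpan (Δ : SC) (n : ℤ) : Submodule K (Finset ℕ →₀ K) :=
  Submodule.span K ((fun s => Finsupp.single s (1 : K)) '' {s | s ∈ Δ ∧ (s.card : ℤ) = n})

/-- Reduced `(n-1)`-cycles of `Δ`. -/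
def cyclesOn (Δ : SC) (n : ℤ) : Submodule K (Finset ℕ →₀ K) :=
  facesSpan K Δ n ⊓ LinearMap.ker (bdry K)

/-- Reduced `(n-1)`-boundaries of `Δ`. -/
def boundariesOn (Δ : SC) (n : ℤ) : Submodule K (Finset ℕ →₀ K) :=
  Submodule.map (bdry K) (facesSpan K Δ (n + 1))

/-- `redHdim K Δ n = dim_K H̃_{n-1}(Δ; K)`, the dimension of reduced simplicial homology
of `Δ` in the degree whose chains are the faces of cardinality `n`. -/
def redHdim (Δ : SC) (n : ℤ) : ℕ :=
  Module.finrank K ↥(cyclesOn K Δ n) -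
    Module.finrank K ↥(boundariesOn K Δ n ⊓ cyclesOn K Δ n)

/-- The graded Betti number `β_{i,j}(K[Δ]) = dim_K Tor_i^S(K[Δ], K)_j` of the
Stanley-Reisner ring of `Δ`, expressed (via Hochster's formula) through reduced homology of
induced subcomplexes: `β_{i,j} = Σ_{W ⊆ Ω, #W = j} dim_K H̃_{j-i-1}(Δ_W; K)`. -/
def bettiSR (Δ : SC) (i j : ℕ) : ℕ :=
  ∑ W ∈ (vertexSet Δ).powerset.filter (fun W => W.card = j),
    redHdim K (inducedSC Δ W) ((j : ℤ) - i)

/-- The projective dimension of `K[Δ]` over the polynomial ring: the largest homological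
degree with a nonzero Betti number. -/
def pdimSR (Δ : SC) : ℕ :=
  ((Finset.range (nverts Δ + 1)).filter
    (fun i => ∃ j ∈ Finset.range (2 * nverts Δ + 1), bettiSR K Δ i j ≠ 0)).sup id

/-- The depth of `K[Δ]` (via the Auslander–Buchsbaum formula). -/
def depthSR (Δ : SC) : ℕ := nverts Δ - pdimSR K Δ

/-- The Castelnuovo–Mumford regularity of `K[Δ]`:
the largest `j - i` with `β_{i,j}(K[Δ]) ≠ 0`. -/
def regSR (Δ : SC) : ℕ :=
  ((Finset.range (nverts Δ + 1) ×ˢ Finset.range (2 * nverts Δ + 1))).sup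
    (fun p => if bettiSR K Δ p.1 p.2 ≠ 0 then p.2 - p.1 else 0)

/-- The number of homological degrees `i` with `β_{i,i+j}(K[Δ]) ≠ 0`. -/
def strandCount (Δ : SC) (j : ℕ) : ℕ :=
  ((Finset.range (nverts Δ + 1)).filter (fun i => bettiSR K Δ i (i + j) ≠ 0)).card

/-- The numbers `m_j(d)`: `m_j(d) = j` if `j ≤ d/2`, and
`m_j(d) = 2^{a+2}(c+d-j) - 2d + j` if `j ≥ d/2`, where `2j-d = a(d-j)+c`, `0 ≤ c < d-j`. -/
def mj (d j : ℕ) : ℕ :=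
  if 2 * j ≤ d then j
  else 2 ^ ((2 * j - d) / (d - j) + 2) * ((2 * j - d) % (d - j) + (d - j)) + j - 2 * d

/-- `N(d)`: the number of vertices of `sd^3(Δ_{d-1})` not lying on the boundary
of `sd^3(Δ_{d-1})`. -/
def Nd (d : ℕ) : ℕ :=
  ((vertexSet (sd^[3] (simplexC d))) \ (vertexSet (sd^[3] (boundaryC d)))).card

/-- The induced subcomplex `σ̃` of `Δ` spanned by the support of a chain `σ`:
all faces of `Δ` contained in some face of the support of `σ`. -/
def cycleCplx (Δ : SC) (σ : Finset ℕ →₀ K) : SC :=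
  Δ.filter (fun F => ∃ G ∈ σ.support, F ⊆ G)

/-- `σ` is a minimal homology `(d-1)`-cycle of the `(d-1)`-dimensional complex `Δ`:
a nonzero `(d-1)`-cycle such that no nonzero `(d-1)`-cycle `σ'` satisfies
`f_i^{σ̃} > f_i^{σ̃'}` and `f_j^{σ̃} = f_j^{σ̃'}` for all `i < j ≤ d-1`, for some `i`. -/
def IsMinimalCycle (Δ : SC) (d : ℕ) (σ : Finset ℕ →₀ K) : Prop :=
  σ ≠ 0 ∧ σ ∈ cyclesOn K Δ (d : ℤ) ∧
    ∀ σ' : Finset ℕ →₀ K, σ' ≠ 0 → σ' ∈ cyclesOn K Δ (d : ℤ) →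
      ¬ ∃ i ≤ d - 1, fvec (cycleCplx K Δ σ') (i + 1) < fvec (cycleCplx K Δ σ) (i + 1) ∧
          ∀ j, i < j → j ≤ d - 1 →
            fvec (cycleCplx K Δ σ) (j + 1) = fvec (cycleCplx K Δ σ') (j + 1)

/-- The support of a lattice point, as a set of natural numbers. -/
def tupSupp {n : ℕ} (a : Fin n → ℕ) : Finset ℕ :=
  (Finset.univ.filter (fun l : Fin n => a l ≠ 0)).image Fin.val

/-- The `k`-th component of `𝔦(a) = Σ_l a_l u_l`, where `u_l = e_l + ⋯ + e_n`;
so `𝔦(a)_k = Σ_{l ≤ k} a_l`. -/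
def iComp {n : ℕ} (a : Fin n → ℤ) (k : Fin n) : ℤ :=
  ∑ l ∈ Finset.univ.filter (fun l : Fin n => l ≤ k), a l

/-- The compatibility condition on pairs of vertices in the edgewise subdivision:
`𝔦(a-b) ∈ {0,1}^n` or `𝔦(b-a) ∈ {0,1}^n`. -/
def edgeOK {n : ℕ} (a b : Fin n → ℕ) : Prop :=
  (∀ k, iComp (fun l => (a l : ℤ) - (b l : ℤ)) k ∈ ({0, 1} : Set ℤ)) ∨
  (∀ k, iComp (fun l => (b l : ℤ) - (a l : ℤ)) k ∈ ({0, 1} : Set ℤ))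

/-- The `r`-th edgewise subdivision of a complex `Δ` on vertex set `[n]`, as a complex on
the ground set `Ω_{r,n}` of lattice points (tuples). -/
def edgewiseT (n r : ℕ) (Δ : SC) : Finset (Finset (Fin n → ℕ)) :=
  (Finset.Nat.antidiagonalTuple n r).powerset.filter
    (fun F => F.sup tupSupp ∈ Δ ∧ ∀ a ∈ F, ∀ b ∈ F, edgeOK a b)

/-- Encoding of lattice points as natural numbers (injective). -/
def encTup {n : ℕ} (a : Fin n → ℕ) : ℕ := Encodable.encode (List.ofFn a)

/-- The `r`-th edgewise subdivision `Δ^{⟨r⟩}`, re-encoded as a complex on `ℕ`. -/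
def edgewise (n r : ℕ) (Δ : SC) : SC :=
  (edgewiseT n r Δ).image (fun F => F.image encTup)

end

noncomputable section
open Finset BigOperators
open scoped Classical
namespace EW

variable (K : Type*) [Field K]

/-- sign -/
def eps (v : ℕ) (s : Finset ℕ) : K := (-1 : K) ^ ((s.filter (fun w => w < v)).card)

lemma eps_sq (v : ℕ) (s : Finset ℕ) : eps K v s * eps K v s = 1 := by
  unfold eps
  rw [← pow_add, ← two_mul, pow_mul]; simp

lemma eps_ne (v : ℕ) (s : Finset ℕ) : eps K v s ≠ 0 := by
  intro h
  have := eps_sq K v s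
  rw [h] at this; simp at this

lemma eps_erase_self (v : ℕ) (s : Finset ℕ) : eps K v (s.erase v) = eps K v s := by
  unfold eps
  congr 2
  ext x; simp only [mem_filter, mem_erase]
  constructor
  · rintro ⟨⟨_, h⟩, h2⟩; exact ⟨h, h2⟩
  · rintro ⟨h, h2⟩; exact ⟨⟨by omega, h⟩, h2⟩

lemma eps_insert_self (v : ℕ) (s : Finset ℕ) : eps K v (insert v s) = eps K v s := by
  unfold eps
  congr 2
  ext x; simp only [mem_filter, mem_insert]
  constructor
  · rintro ⟨h | h, h2⟩
    · omega
    · exact ⟨h, h2⟩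
  · rintro ⟨h, h2⟩; exact ⟨Or.inr h, h2⟩

lemma eps_insert_lt {v w : ℕ} {s : Finset ℕ} (hv : v ∉ s) (h : v < w) :
    eps K w (insert v s) = - eps K w s := by
  unfold eps
  rw [filter_insert, if_pos h, card_insert_of_notMem (by simp [hv]), pow_succ]
  ring

lemma eps_insert_ge {v w : ℕ} {s : Finset ℕ} (h : w ≤ v) :
    eps K w (insert v s) = eps K w s := by
  unfold eps
  rw [filter_insert, if_neg (by omega)]

/-- the key sign identity -/
lemma eps_swap {v w : ℕ} {s : Finset ℕ} (hv : v ∉ s) (hw : w ∉ s) (h : v ≠ w) :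
    eps K v s * eps K w (insert v s) = - (eps K w s * eps K v (insert w s)) := by
  rcases lt_or_gt_of_ne h with h | h
  · rw [eps_insert_lt K hv h, eps_insert_ge K h.le]; ring
  · rw [eps_insert_lt K hw h, eps_insert_ge K h.le]; ring

/-- creation operator -/
def E (v : ℕ) : Module.End K (Finset ℕ →₀ K) :=
  Finsupp.lsum K fun s => LinearMap.toSpanSingleton K (Finset ℕ →₀ K)
    (if v ∈ s then 0 else eps K v s • Finsupp.single (insert v s) 1)

lemma E_single (v : ℕ) (s : Finset ℕ) : E K v (Finsupp.single s 1) =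
    if v ∈ s then 0 else eps K v s • Finsupp.single (insert v s) 1 := by
  simp [E]

lemma E_single_mem {v : ℕ} {s : Finset ℕ} (h : v ∈ s) : E K v (Finsupp.single s 1) = 0 := by
  rw [E_single, if_pos h]

lemma E_single_not {v : ℕ} {s : Finset ℕ} (h : v ∉ s) : E K v (Finsupp.single s 1) =
    eps K v s • Finsupp.single (insert v s) 1 := by
  rw [E_single, if_neg h]

lemma single_insert {v : ℕ} {s : Finset ℕ} (h : v ∉ s) :
    (Finsupp.single (insert v s) 1 : Finset ℕ →₀ K) = eps K v s • E K v (Finsupp.single s 1) := by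
  rw [E_single_not K h, smul_smul, eps_sq, one_smul]

lemma single_erase {v : ℕ} {s : Finset ℕ} (h : v ∈ s) :
    (Finsupp.single s 1 : Finset ℕ →₀ K) =
      eps K v s • E K v (Finsupp.single (s.erase v) 1) := by
  conv_lhs => rw [← insert_erase h]
  rw [single_insert K (notMem_erase v s), eps_erase_self]

lemma hom_ext {N : Type*} [AddCommGroup N] [Module K N] {f g : (Finset ℕ →₀ K) →ₗ[K] N}
    (h : ∀ s, f (Finsupp.single s 1) = g (Finsupp.single s 1)) : f = g := by
  apply Finsupp.lhom_ext'
  intro s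
  apply LinearMap.ext_ring
  simpa using h s

lemma E_E (v w : ℕ) : E K v * E K w = - (E K w * E K v) := by
  apply hom_ext
  intro s
  simp only [Module.End.mul_apply, LinearMap.neg_apply]
  by_cases hvw : v = w
  · subst hvw
    by_cases hv : v ∈ s
    · simp [E_single_mem K hv]
    · rw [E_single_not K hv, map_smul, E_single_mem K (mem_insert_self v s)]; simp
  by_cases hv : v ∈ s
  · by_cases hw : w ∈ s
    · simp [E_single_mem K hv, E_single_mem K hw]
    · rw [E_single_mem K hv, E_single_not K hw, map_smul, E_single_mem K (mem_insert_of_mem hv)]; simp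
  · by_cases hw : w ∈ s
    · rw [E_single_mem K hw, E_single_not K hv, map_smul, E_single_mem K (mem_insert_of_mem hw)]; simp
    · have h1 : v ∉ insert w s := by simp [hvw, hv]
      have h2 : w ∉ insert v s := by simp [Ne.symm hvw, hw]
      rw [E_single_not K hw, E_single_not K hv, map_smul, map_smul, E_single_not K h1,
        E_single_not K h2, smul_smul, smul_smul, Finset.insert_comm, eps_swap K hw hv (Ne.symm hvw),
        neg_smul]

lemma E_sq (v : ℕ) : E K v * E K v = 0 := by
  apply hom_ext
  intro s
  simp only [Module.End.mul_apply]
  by_cases hv : v ∈ s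
  · simp [E_single_mem K hv]
  · rw [E_single_not K hv, map_smul, E_single_mem K (mem_insert_self v s)]; simp

lemma bdry_single (s : Finset ℕ) : bdry K (Finsupp.single s 1) =
    ∑ v ∈ s, eps K v s • Finsupp.single (s.erase v) (1 : K) := by
  simp [bdry, bdryFace, eps]

lemma bdry_empty : bdry K (Finsupp.single ∅ 1) = 0 := by
  simp [bdry_single]

lemma bdry_E (v : ℕ) (x : Finset ℕ →₀ K) : bdry K (E K v x) = x - E K v (bdry K x) := by
  have : (bdry K) ∘ₗ (E K v) = LinearMap.id - (E K v) ∘ₗ (bdry K) := by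
    apply hom_ext
    intro s
    simp only [LinearMap.comp_apply, LinearMap.sub_apply, LinearMap.id_apply]
    by_cases hv : v ∈ s
    · rw [E_single_mem K hv, map_zero, bdry_single, map_sum, ← add_sum_erase s _ hv,
        map_smul, ← single_erase K hv, sum_eq_zero]
      · simp
      · intro w hw
        rw [map_smul, E_single_mem K, smul_zero]
        simp only [mem_erase] at hw ⊢
        exact ⟨hw.1.symm, hv⟩
    · rw [E_single_not K hv, map_smul, bdry_single, sum_insert hv, smul_add, smul_smul,
        eps_insert_self, eps_sq, one_smul, erase_insert hv, bdry_single, map_sum, sub_eq_add_neg,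
        smul_sum, ← sum_neg_distrib]
      congr 1
      apply sum_congr rfl
      intro w hw
      have hvw : v ≠ w := by rintro rfl; exact hv hw
      rw [map_smul, E_single_not K (s := s.erase w) (by simp [hv]), smul_smul, smul_smul,
        erase_insert_of_ne hvw, ← neg_smul]
      congr 1
      obtain ⟨t, ht, rfl⟩ : ∃ t, w ∉ t ∧ s = insert w t :=
        ⟨s.erase w, notMem_erase w s, (insert_erase hw).symm⟩
      rw [erase_insert ht, eps_insert_self]
      have hvt : v ∉ t := fun h => hv (mem_insert_of_mem h)
      have := eps_swap K hvt ht hvw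
      rw [Finset.insert_comm v w t, eps_insert_self]
      have e1 := eps_sq K v t
      have e2 := eps_sq K w t
      linear_combination eps K v t * eps K v (insert w t) * this
        - eps K v (insert w t) * eps K w (insert v t) * e1 -
        (eps K w t * eps K v t) * eps_sq K v (insert w t)
  exact LinearMap.congr_fun this x
end EW

end

noncomputable section
open Finset BigOperators
open scoped Classical
namespace EW

variable (K : Type*) [Field K]

lemma bdry_bdry (x : Finset ℕ →₀ K) : bdry K (bdry K x) = 0 := by
  have : (bdry K) ∘ₗ (bdry K) = 0 := by
    apply hom_ext
    intro s
    induction s using Finset.induction_on with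
    | empty => simp [bdry_empty]
    | insert v s hv ih =>
      simp only [LinearMap.comp_apply, LinearMap.zero_apply] at ih ⊢
      rw [single_insert K hv, map_smul, map_smul, bdry_E, map_sub, bdry_E, ih]
      simp
  exact LinearMap.congr_fun this x


/-- ordered monomial -/
def M (g : ℕ → Module.End K (Finset ℕ →₀ K)) (s : Finset ℕ) : Module.End K (Finset ℕ →₀ K) :=
  ((s.sort (· ≤ ·)).map g).prod

lemma M_empty (g : ℕ → Module.End K (Finset ℕ →₀ K)) : M K g ∅ = 1 := by simp [M]

lemma M_insert_min (g : ℕ → Module.End K (Finset ℕ →₀ K)) {v : ℕ} {s : Finset ℕ}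
    (h : ∀ w ∈ s, v < w) : M K g (insert v s) = g v * M K g s := by
  unfold M
  rw [Finset.sort_insert (r := (· ≤ ·)) (fun w hw => (h w hw).le)
    (fun hv => lt_irrefl _ (h v hv))]
  simp

variable {K} in
lemma M_mul_not {g : ℕ → Module.End K (Finset ℕ →₀ K)} (hg : ∀ v w, g v * g w = -(g w * g v))
    {v : ℕ} {s : Finset ℕ} (hv : v ∉ s) : g v * M K g s = eps K v s • M K g (insert v s) := by
  induction s using Finset.induction_on_min with
  | empty => rw [M_insert_min K g (by simp)]; simp [eps]
  | insert a s ha ih =>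
    simp only [mem_insert, not_or] at hv
    rcases lt_or_gt_of_ne hv.1 with h | h
    · rw [M_insert_min K g (v := v) (s := insert a s)]
      · have : eps K v (insert a s) = 1 := by
          unfold eps
          rw [filter_false_of_mem]
          · simp
          · intro w hw
            rcases mem_insert.1 hw with rfl | hw
            · omega
            · have := ha w hw; omega
        rw [this, one_smul]
      · intro w hw
        rcases mem_insert.1 hw with rfl | hw
        · omega
        · have := ha w hw; omega
    · have nm : ∀ x y : Module.End K (Finset ℕ →₀ K), -x * y = -(x * y) :=
        fun x y => LinearMap.ext fun z => by simp only [Module.End.mul_apply, LinearMap.neg_apply]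
      have has : a ∉ s := fun h => lt_irrefl _ (ha a h)
      rw [M_insert_min K g ha, ← mul_assoc, hg, nm, mul_assoc, ih hv.2, eps_insert_lt K has h,
        Finset.insert_comm, M_insert_min K g (v := a) (s := insert v s)]
      · rw [mul_smul_comm]
        apply LinearMap.ext
        intro z
        simp only [LinearMap.neg_apply, LinearMap.smul_apply, neg_smul]
      · intro w hw
        rcases mem_insert.1 hw with rfl | hw
        · exact h
        · exact ha w hw

variable {K} in
lemma M_insert {g : ℕ → Module.End K (Finset ℕ →₀ K)} (hg : ∀ v w, g v * g w = -(g w * g v))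
    {v : ℕ} {s : Finset ℕ} (hv : v ∉ s) : M K g (insert v s) = eps K v s • (g v * M K g s) := by
  rw [M_mul_not hg hv, smul_smul, eps_sq, one_smul]

variable {K} in
lemma M_mul_mem {g : ℕ → Module.End K (Finset ℕ →₀ K)} (hg : ∀ v w, g v * g w = -(g w * g v))
    (hg2 : ∀ v, g v * g v = 0)
    {v : ℕ} {s : Finset ℕ} (hv : v ∈ s) : g v * M K g s = 0 := by
  rw [← insert_erase hv, M_insert hg (notMem_erase v s), mul_smul_comm, ← mul_assoc, hg2]
  simp

/-- pushforward -/
def push (f : ℕ → ℕ) : Module.End K (Finset ℕ →₀ K) :=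
  Finsupp.lsum K fun s => LinearMap.toSpanSingleton K (Finset ℕ →₀ K)
    (M K (fun v => E K (f v)) s (Finsupp.single ∅ 1))

lemma push_single (f : ℕ → ℕ) (s : Finset ℕ) : push K f (Finsupp.single s 1) =
    M K (fun v => E K (f v)) s (Finsupp.single ∅ 1) := by
  simp [push]

lemma push_empty (f : ℕ → ℕ) : push K f (Finsupp.single ∅ 1) = Finsupp.single ∅ 1 := by
  simp [push_single, M_empty]

lemma push_E (f : ℕ → ℕ) (v : ℕ) : push K f * E K v = E K (f v) * push K f := by
  apply hom_ext
  intro s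
  simp only [Module.End.mul_apply]
  by_cases hv : v ∈ s
  · rw [E_single_mem K hv, push_single, ← Module.End.mul_apply, map_zero]
    have := M_mul_mem (K := K) (g := fun v => E K (f v)) (fun _ _ => E_E K _ _)
      (fun _ => E_sq K _) hv
    rw [this]; rfl
  · rw [E_single_not K hv, map_smul, push_single, push_single, ← Module.End.mul_apply]
    have := M_mul_not (K := K) (g := fun v => E K (f v)) (fun _ _ => E_E K _ _) hv
    rw [this]; rfl

lemma push_E_apply (f : ℕ → ℕ) (v : ℕ) (x : Finset ℕ →₀ K) :
    push K f (E K v x) = E K (f v) (push K f x) :=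
  LinearMap.congr_fun (push_E K f v) x

lemma bdry_push (f : ℕ → ℕ) (x : Finset ℕ →₀ K) :
    bdry K (push K f x) = push K f (bdry K x) := by
  have : (bdry K) ∘ₗ (push K f) = (push K f) ∘ₗ (bdry K) := by
    apply hom_ext
    intro s
    induction s using Finset.induction_on with
    | empty => simp [bdry_empty, push_empty]
    | insert v s hv ih =>
      simp only [LinearMap.comp_apply] at ih ⊢
      rw [single_insert K hv]
      simp only [map_smul, push_E_apply, bdry_E, ih, map_sub]
  exact LinearMap.congr_fun this x

lemma push_noninj (f : ℕ → ℕ) {s : Finset ℕ} {u v : ℕ} (hu : u ∈ s) (hv : v ∈ s) (huv : u ≠ v)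
    (h : f u = f v) : push K f (Finsupp.single s 1) = 0 := by
  rw [single_erase K hu, map_smul, push_E_apply,
    single_erase K (s := s.erase u) (v := v) (by simp [hv, huv.symm]), map_smul, push_E_apply,
    map_smul, ← Module.End.mul_apply, h, E_sq]
  simp

/-- subdivision operators -/
def sd' (w : Finset ℕ → ℕ) (S : Finset ℕ) : Module.End K (Finset ℕ →₀ K) :=
  if S = ∅ then 1 else
    E K (w S) * ∑ s ∈ S.attach, eps K s S • sd' w (S.erase s)
termination_by S.card
decreasing_by exact card_erase_lt_of_mem s.2

/-- boundary of the subdivision -/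
def sdA (w : Finset ℕ → ℕ) (S : Finset ℕ) : Module.End K (Finset ℕ →₀ K) :=
  ∑ s ∈ S, eps K s S • sd' K w (S.erase s)

lemma sd'_empty (w : Finset ℕ → ℕ) : sd' K w ∅ = 1 := by
  unfold sd'; simp

lemma sd'_ne (w : Finset ℕ → ℕ) {S : Finset ℕ} (h : S ≠ ∅) :
    sd' K w S = E K (w S) * sdA K w S := by
  rw [sd', if_neg h, sdA]
  congr 1
  exact sum_attach S (fun s => eps K s S • sd' K w (S.erase s))

/-- linear extension -/
def SD (w : Finset ℕ → ℕ) : (Finset ℕ →₀ K) →ₗ[K] Module.End K (Finset ℕ →₀ K) :=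
  Finsupp.lsum K fun s => LinearMap.toSpanSingleton K _ (sd' K w s)

lemma SD_single (w : Finset ℕ → ℕ) (S : Finset ℕ) : SD K w (Finsupp.single S 1) = sd' K w S := by
  simp [SD]

lemma SD_bdry (w : Finset ℕ → ℕ) (S : Finset ℕ) :
    SD K w (bdry K (Finsupp.single S 1)) = sdA K w S := by
  simp only [bdry_single, map_sum, map_smul, SD_single, sdA]

lemma sdA_sdA (w : Finset ℕ → ℕ) (S : Finset ℕ) :
    ∑ s ∈ S, eps K s S • sdA K w (S.erase s) = 0 := by
  have h : SD K w (bdry K (bdry K (Finsupp.single S 1))) = 0 := by rw [bdry_bdry, map_zero]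
  rw [bdry_single] at h
  simpa only [map_sum, map_smul, SD_bdry] using h

lemma bdry_sd_aux (w : Finset ℕ → ℕ) (S : Finset ℕ)
    (ih : ∀ s ∈ S, ∀ x, bdry K (sd' K w (S.erase s) x) = sdA K w (S.erase s) x +
      (-1 : K) ^ (S.card - 1) • sd' K w (S.erase s) (bdry K x)) (x : Finset ℕ →₀ K) :
    bdry K (sdA K w S x) = (-1 : K) ^ (S.card - 1) • sdA K w S (bdry K x) := by
  have h := LinearMap.congr_fun (sdA_sdA K w S) x
  simp only [LinearMap.sum_apply, LinearMap.smul_apply, LinearMap.zero_apply] at h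
  simp only [sdA, LinearMap.sum_apply, LinearMap.smul_apply, map_sum, map_smul]
  rw [smul_sum, ← zero_add (∑ s ∈ S, (-1 : K) ^ (S.card - 1) • _), ← h, ← sum_add_distrib]
  apply sum_congr rfl
  intro s hs
  rw [ih s hs, smul_add, smul_comm]

lemma bdry_sd' (w : Finset ℕ → ℕ) (n : ℕ) : ∀ (S : Finset ℕ), S.card = n →
    ∀ (x : Finset ℕ →₀ K),
    bdry K (sd' K w S x) = sdA K w S x + (-1 : K) ^ S.card • sd' K w S (bdry K x) := by
  induction n with
  | zero =>
    intro S hS x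
    rw [card_eq_zero] at hS
    subst hS
    simp [sd'_empty, sdA]
  | succ n ih =>
    intro S hS x
    have hne : S ≠ ∅ := by rintro rfl; simp at hS
    rw [sd'_ne K w hne, Module.End.mul_apply, bdry_E, bdry_sd_aux K w S]
    · rw [Module.End.mul_apply, hS, map_smul, sub_eq_add_neg, ← neg_smul]
      congr 2
      rw [pow_succ]; simp
    · intro s hs x
      have hc : (S.erase s).card = S.card - 1 := card_erase_of_mem hs
      rw [ih (S.erase s) (by omega) x, hc]

lemma bdry_sdA (w : Finset ℕ → ℕ) (S : Finset ℕ) (x : Finset ℕ →₀ K) :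
    bdry K (sdA K w S x) = (-1 : K) ^ (S.card - 1) • sdA K w S (bdry K x) := by
  apply bdry_sd_aux
  intro s hs x
  have hc : (S.erase s).card = S.card - 1 := card_erase_of_mem hs
  rw [bdry_sd' K w _ (S.erase s) rfl x, hc]

lemma sd'_eq_M (w : Finset ℕ → ℕ) (n : ℕ) : ∀ (S : Finset ℕ), S.card = n →
    (∀ T ⊆ S, T ≠ ∅ → w T ∈ T) → sd' K w S = M K (E K) S := by
  induction n with
  | zero =>
    intro S hS _
    rw [card_eq_zero] at hS
    subst hS
    rw [sd'_empty, M_empty]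
  | succ n ih =>
    intro S hS hw
    have hne : S ≠ ∅ := by rintro rfl; simp at hS
    have hy := hw S subset_rfl hne
    rw [sd'_ne K w hne, sdA, mul_sum, sum_eq_single_of_mem (w S) hy]
    · rw [ih _ (by rw [card_erase_of_mem hy]; omega) (fun T hT => hw T (hT.trans (erase_subset _ _))),
        mul_smul_comm, M_mul_not (E_E K) (notMem_erase _ _), smul_smul, insert_erase hy,
        eps_erase_self, eps_sq, one_smul]
    · intro s hs hsw
      rw [ih _ (by rw [card_erase_of_mem hs]; omega) (fun T hT => hw T (hT.trans (erase_subset _ _))),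
        mul_smul_comm, M_mul_mem (E_E K) (E_sq K) (by simp [hy, hsw.symm]), smul_zero]

lemma E_sdA (w : Finset ℕ → ℕ) (S : Finset ℕ) (hw : ∀ T ⊆ S, T ≠ S → T ≠ ∅ → w T ∈ T) (y : ℕ)
    (hy : y ∈ S) : E K y * sdA K w S = M K (E K) S := by
  rw [sdA, mul_sum, sum_eq_single_of_mem y hy]
  · rw [sd'_eq_M K w _ _ rfl, mul_smul_comm, M_mul_not (E_E K) (notMem_erase _ _), smul_smul,
      insert_erase hy, eps_erase_self, eps_sq, one_smul]
    intro T hT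
    apply hw T (hT.trans (erase_subset _ _))
    rintro rfl
    exact notMem_erase _ _ (hT hy)
  · intro s hs hsw
    rw [sd'_eq_M K w _ _ rfl, mul_smul_comm, M_mul_mem (E_E K) (E_sq K) (by simp [hy, hsw.symm]),
      smul_zero]
    intro T hT
    apply hw T (hT.trans (erase_subset _ _))
    rintro rfl
    exact notMem_erase _ _ (hT hs)

lemma push_sd' (f : ℕ → ℕ) (w : Finset ℕ → ℕ) (n : ℕ) : ∀ (S : Finset ℕ), S.card = n →
    push K f * sd' K w S = sd' K (f ∘ w) S * push K f := by
  induction n with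
  | zero =>
    intro S hS
    rw [card_eq_zero] at hS
    subst hS
    simp [sd'_empty]
  | succ n ih =>
    intro S hS
    have hne : S ≠ ∅ := by rintro rfl; simp at hS
    rw [sd'_ne K w hne, sd'_ne K _ hne, ← mul_assoc, push_E, mul_assoc, mul_assoc]
    congr 1
    rw [sdA, sdA, mul_sum, sum_mul]
    apply sum_congr rfl
    intro s hs
    rw [mul_smul_comm, ih _ (by rw [card_erase_of_mem hs]; omega), smul_mul_assoc]

lemma push_sdA (f : ℕ → ℕ) (w : Finset ℕ → ℕ) (S : Finset ℕ) :
    push K f * sdA K w S = sdA K (f ∘ w) S * push K f := by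
  rw [sdA, sdA, mul_sum, sum_mul]
  apply sum_congr rfl
  intro s hs
  rw [mul_smul_comm, push_sd' K f w _ _ rfl, smul_mul_assoc]

/-- the product cycle -/
def sig (w : ℕ → Finset ℕ → ℕ) (B : ℕ → Finset ℕ) : ℕ → (Finset ℕ →₀ K)
  | 0 => Finsupp.single ∅ 1
  | t + 1 => sdA K (w t) (B t) (sig w B t)

lemma bdry_sig (w : ℕ → Finset ℕ → ℕ) (B : ℕ → Finset ℕ) (t : ℕ) :
    bdry K (sig K w B t) = 0 := by
  induction t with
  | zero => exact bdry_empty K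
  | succ t ih => rw [sig, bdry_sdA, ih]; simp

lemma push_sig (f : ℕ → ℕ) (w : ℕ → Finset ℕ → ℕ) (B : ℕ → Finset ℕ) (t : ℕ) :
    push K f (sig K w B t) = sig K (fun t => f ∘ w t) B t := by
  induction t with
  | zero => exact push_empty K f
  | succ t ih =>
    rw [sig, sig, ← ih, ← Module.End.mul_apply, push_sdA, Module.End.mul_apply]

lemma list_E_comm (b : ℕ) (l : List ℕ) (x : Finset ℕ →₀ K) :
    (l.map (E K)).prod (E K b x) = (-1 : K) ^ l.length • E K b ((l.map (E K)).prod x) := by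
  induction l with
  | nil => simp
  | cons a l ih =>
    simp only [List.map_cons, List.prod_cons, Module.End.mul_apply, ih, map_smul, List.length_cons]
    rw [← Module.End.mul_apply (E K a), E_E]
    simp [pow_succ]

lemma list_E_empty (l : List ℕ) (h : l.Nodup) :
    ∃ c : K, c ≠ 0 ∧ (l.map (E K)).prod (Finsupp.single ∅ 1) = c • Finsupp.single l.toFinset 1 := by
  induction l with
  | nil => exact ⟨1, one_ne_zero, by simp⟩
  | cons a l ih =>
    rw [List.nodup_cons] at h
    obtain ⟨c, hc, e⟩ := ih h.2
    refine ⟨c * eps K a l.toFinset, mul_ne_zero hc (eps_ne K _ _), ?_⟩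
    simp only [List.map_cons, List.prod_cons, Module.End.mul_apply, e, map_smul]
    rw [E_single_not K (by simpa using h.1), smul_smul, List.toFinset_cons]

lemma list_sig_ne (w : ℕ → Finset ℕ → ℕ) (B : ℕ → Finset ℕ) (t : ℕ)
    (hB : ∀ s < t, (B s).Nonempty) (hd : ∀ s < t, ∀ s' < t, s ≠ s' → Disjoint (B s) (B s'))
    (hw : ∀ s < t, ∀ T ⊆ B s, T ≠ B s → T ≠ ∅ → w s T ∈ T) :
    ∀ l : List ℕ, l.Nodup → (∀ s < t, ∀ x ∈ B s, x ∉ l) →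
    (l.map (E K)).prod (sig K w B t) ≠ 0 := by
  induction t with
  | zero =>
    intro l hl _
    obtain ⟨c, hc, e⟩ := list_E_empty K l hl
    rw [sig, e]
    simp [hc]
  | succ t ih =>
    intro l hl hdis
    obtain ⟨b, hb⟩ := hB t (by omega)
    have := ih (fun s hs => hB s (by omega)) (fun s hs s' hs' => hd s (by omega) s' (by omega))
      (fun s hs => hw s (by omega)) (l ++ (B t).sort (· ≤ ·))
      (by
        refine List.Nodup.append hl (sort_nodup _ _) ?_
        intro x hx hx'
        exact hdis t (by omega) x (by simpa using hx') hx)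
      (by
        intro s hs x hx hx'
        rw [List.mem_append] at hx'
        rcases hx' with h | h
        · exact hdis s (by omega) x hx h
        · exact disjoint_left.1 (hd s (by omega) t (by omega) (by omega)) hx (by simpa using h))
    intro h0
    apply this
    rw [List.map_append, List.prod_append, Module.End.mul_apply]
    change (l.map (E K)).prod (M K (E K) (B t) (sig K w B t)) = 0
    rw [← E_sdA K (w t) (B t) (hw t (by omega)) b hb, Module.End.mul_apply, list_E_comm]
    change _ • (E K b) ((l.map (E K)).prod (sig K w B (t+1))) = 0
    rw [h0]; simp

lemma sig_ne (w : ℕ → Finset ℕ → ℕ) (B : ℕ → Finset ℕ) (t : ℕ)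
    (hB : ∀ s < t, (B s).Nonempty) (hd : ∀ s < t, ∀ s' < t, s ≠ s' → Disjoint (B s) (B s'))
    (hw : ∀ s < t, ∀ T ⊆ B s, T ≠ B s → T ≠ ∅ → w s T ∈ T) : sig K w B t ≠ 0 := by
  simpa using list_sig_ne K w B t hB hd hw [] (by simp) (by simp)

end EW

end

noncomputable section
open Finset BigOperators
open scoped Classical
namespace EW

variable (K : Type*) [Field K]

/-- clique complex -/
def cl (R : ℕ → ℕ → Prop) (W : Finset ℕ) : SC :=
  W.powerset.filter (fun s => ∀ a ∈ s, ∀ b ∈ s, R a b)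

lemma mem_cl {R : ℕ → ℕ → Prop} {W s : Finset ℕ} :
    s ∈ cl R W ↔ s ⊆ W ∧ ∀ a ∈ s, ∀ b ∈ s, R a b := by
  simp [cl]

lemma facesSpan_eq (Δ : SC) (n : ℤ) :
    facesSpan K Δ n = Finsupp.supported K K {s | s ∈ Δ ∧ (s.card : ℤ) = n} := by
  rw [facesSpan, Finsupp.supported_eq_span_single]

lemma single_mem {Δ : SC} {n : ℤ} {s : Finset ℕ} (h : s ∈ Δ) (hn : (s.card : ℤ) = n) :
    (Finsupp.single s 1 : Finset ℕ →₀ K) ∈ facesSpan K Δ n :=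
  Submodule.subset_span ⟨s, ⟨h, hn⟩, rfl⟩

lemma facesSpan_le {Δ : SC} {n : ℤ} {p : Submodule K (Finset ℕ →₀ K)}
    (h : ∀ s ∈ Δ, (s.card : ℤ) = n → Finsupp.single s 1 ∈ p) : facesSpan K Δ n ≤ p := by
  rw [facesSpan, Submodule.span_le]
  rintro _ ⟨s, ⟨h1, h2⟩, rfl⟩
  exact h s h1 h2

lemma facesSpan_mono {Δ Δ' : SC} (h : Δ ⊆ Δ') (n : ℤ) : facesSpan K Δ n ≤ facesSpan K Δ' n :=
  facesSpan_le K fun _ hs hn => single_mem K (h hs) hn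

lemma cl_mono (R : ℕ → ℕ → Prop) {V W : Finset ℕ} (h : V ⊆ W) : cl R V ⊆ cl R W := by
  intro s; rw [mem_cl, mem_cl]; exact fun hs => ⟨hs.1.trans h, hs.2⟩

lemma E_mem {Δ Δ' : SC} {n : ℤ} {v : ℕ} (h : ∀ s ∈ Δ, v ∉ s → insert v s ∈ Δ')
    {x : Finset ℕ →₀ K} (hx : x ∈ facesSpan K Δ n) : E K v x ∈ facesSpan K Δ' (n + 1) := by
  have : facesSpan K Δ n ≤ (facesSpan K Δ' (n + 1)).comap (E K v) := by
    apply facesSpan_le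
    intro s hs hn
    rw [Submodule.mem_comap]
    by_cases hv : v ∈ s
    · rw [E_single_mem K hv]; exact zero_mem _
    · rw [E_single_not K hv]
      apply Submodule.smul_mem
      apply single_mem K (h s hs hv)
      rw [card_insert_of_notMem hv]; push_cast; omega
  exact this hx

lemma bdry_mem {R : ℕ → ℕ → Prop} {V : Finset ℕ} {n : ℤ}
    {x : Finset ℕ →₀ K} (hx : x ∈ facesSpan K (cl R V) n) :
    bdry K x ∈ facesSpan K (cl R V) (n - 1) := by
  have : facesSpan K (cl R V) n ≤ (facesSpan K (cl R V) (n - 1)).comap (bdry K) := by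
    apply facesSpan_le
    intro s hs hn
    rw [Submodule.mem_comap, bdry_single]
    apply Submodule.sum_mem
    intro v hv
    apply Submodule.smul_mem
    rw [mem_cl] at hs
    apply single_mem K
    · rw [mem_cl]
      exact ⟨(erase_subset _ _).trans hs.1, fun a ha b hb =>
        hs.2 a (mem_of_mem_erase ha) b (mem_of_mem_erase hb)⟩
    · rw [card_erase_of_mem hv]
      have : 0 < s.card := card_pos.2 ⟨v, hv⟩
      omega
  exact this hx

/-- vanishing of reduced homology -/
def Acyc (Δ : SC) (n : ℤ) : Prop :=
  ∀ z ∈ facesSpan K Δ n, bdry K z = 0 → ∃ u ∈ facesSpan K Δ (n + 1), bdry K u = z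

lemma acyc_neg {Δ : SC} {n : ℤ} (h : ∀ s ∈ Δ, (s.card : ℤ) ≠ n) : Acyc K Δ n := by
  intro z hz _
  have : facesSpan K Δ n ≤ ⊥ := facesSpan_le K fun s hs hn => absurd hn (h s hs)
  have hz0 : z = 0 := by simpa using this hz
  exact ⟨0, zero_mem _, by simp [hz0]⟩

lemma acyc_cone {R : ℕ → ℕ → Prop} {V : Finset ℕ} {v : ℕ} (hv : v ∈ V)
    (h : ∀ u ∈ V, R v u ∧ R u v) (n : ℤ) : Acyc K (cl R V) n := by
  intro z hz h0
  refine ⟨E K v z, ?_, by rw [bdry_E, h0]; simp⟩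
  apply E_mem K _ hz
  intro s hs _
  rw [mem_cl] at hs ⊢
  refine ⟨insert_subset hv hs.1, ?_⟩
  intro a ha b hb
  rw [mem_insert] at ha hb
  have hself := (h _ hv).1
  rcases ha with ha | ha
  · rcases hb with hb | hb
    · rw [ha, hb]; exact hself
    · rw [ha]; exact (h b (hs.1 hb)).1
  · rcases hb with hb | hb
    · rw [hb]; exact (h a (hs.1 ha)).2
    · exact hs.2 a ha b hb

lemma acyc_mv {R : ℕ → ℕ → Prop} {V V1 V2 : Finset ℕ} {n : ℤ}
    (h : ∀ s ∈ cl R V, s ⊆ V1 ∨ s ⊆ V2) (hV1 : V1 ⊆ V) (hV2 : V2 ⊆ V)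
    (h1 : Acyc K (cl R V1) n) (h2 : Acyc K (cl R V2) n)
    (h3 : Acyc K (cl R (V1 ∩ V2)) (n - 1)) : Acyc K (cl R V) n := by
  intro z hz h0
  have hle : facesSpan K (cl R V) n ≤ facesSpan K (cl R V1) n ⊔ facesSpan K (cl R V2) n := by
    apply facesSpan_le
    intro s hs hn
    have hs' := (mem_cl.1 hs).2
    rcases h s hs with h | h
    · exact Submodule.mem_sup_left (single_mem K (mem_cl.2 ⟨h, hs'⟩) hn)
    · exact Submodule.mem_sup_right (single_mem K (mem_cl.2 ⟨h, hs'⟩) hn)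
  obtain ⟨z1, hz1, z2, hz2, rfl⟩ := Submodule.mem_sup.1 (hle hz)
  have hb : bdry K z1 = - bdry K z2 := by
    rw [map_add] at h0; exact eq_neg_of_add_eq_zero_left h0
  have hb1 := bdry_mem K hz1
  have hb2 := bdry_mem K hz2
  have hb3 : bdry K z1 ∈ facesSpan K (cl R (V1 ∩ V2)) (n - 1) := by
    have hb2' : bdry K z1 ∈ facesSpan K (cl R V2) (n - 1) := by
      rw [hb]; exact Submodule.neg_mem _ hb2
    rw [facesSpan_eq, Finsupp.mem_supported] at *
    intro s hs
    have a1 := hb1 hs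
    have a2 := hb2' hs
    simp only [Set.mem_ofPred_eq, mem_cl] at a1 a2 ⊢
    exact ⟨⟨subset_inter a1.1.1 a2.1.1, a1.1.2⟩, a1.2⟩
  obtain ⟨u, hu, hue⟩ := h3 _ hb3 (bdry_bdry K z1)
  rw [sub_add_cancel] at hu
  obtain ⟨u1, hu1, e1⟩ := h1 (z1 - u)
    (Submodule.sub_mem _ hz1 (facesSpan_mono K (cl_mono R inter_subset_left) n hu))
    (by rw [map_sub, hue, sub_self])
  obtain ⟨u2, hu2, e2⟩ := h2 (z2 + u)
    (Submodule.add_mem _ hz2 (facesSpan_mono K (cl_mono R inter_subset_right) n hu))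
    (by rw [map_add, hue, hb]; simp)
  refine ⟨u1 + u2, Submodule.add_mem _ (facesSpan_mono K (cl_mono R hV1) _ hu1)
    (facesSpan_mono K (cl_mono R hV2) _ hu2), ?_⟩
  rw [map_add, e1, e2]; abel

lemma acyc_flag {R : ℕ → ℕ → Prop} (hr : ∀ a, R a a) (hs : ∀ a b, R a b → R b a) (N : ℕ) :
    ∀ (W : Finset ℕ) (n : ℕ), W.card ≤ N → W.card + 1 ≤ 2 * n → Acyc K (cl R W) n := by
  induction N with
  | zero =>
    intro W n hW hn
    have hW : W = ∅ := by simpa using hW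
    subst hW
    apply acyc_neg
    intro s hs
    have : s = ∅ := by simpa using (mem_cl.1 hs).1
    subst this
    simp; simp at hn; omega
  | succ N ih =>
    intro W n hW hn
    rcases W.eq_empty_or_nonempty with rfl | ⟨v, hv⟩
    · exact ih ∅ n (by simp) hn
    by_cases hc : ∀ u ∈ W, R v u
    · exact acyc_cone K hv (fun u hu => ⟨hc u hu, hs _ _ (hc u hu)⟩) n
    push Not at hc
    obtain ⟨u, hu, hvu⟩ := hc
    have hcard : ((W.erase v) ∩ W.filter (R v)).card + 2 ≤ W.card := by
      have h1 : (W.erase v) ∩ W.filter (R v) ⊆ (W.erase v).erase u := by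
        intro x hx
        simp only [mem_inter, mem_filter, mem_erase] at hx ⊢
        refine ⟨?_, hx.1⟩
        rintro rfl; exact hvu hx.2.2
      have h2 := card_le_card h1
      have huv : u ≠ v := by rintro rfl; exact hvu (hr _)
      have hu' : u ∈ W.erase v := by simp [hu, huv]
      have h3 := card_erase_add_one hu'
      have h4 := card_erase_add_one hv
      omega
    apply acyc_mv K (V1 := W.erase v) (V2 := W.filter (R v)) _ (erase_subset _ _)
      (filter_subset _ _)
    · apply ih
      · have := card_erase_add_one hv; omega
      · have := card_erase_add_one hv; omega
    · apply acyc_cone K (v := v)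
      · simp [hv, hr]
      · intro x hx
        have := (mem_filter.1 hx).2
        exact ⟨this, hs _ _ this⟩
    · have := ih ((W.erase v) ∩ W.filter (R v)) (n - 1) (by omega) (by omega)
      rwa [Nat.cast_sub (by omega), Nat.cast_one] at this
    · intro s hs
      rw [mem_cl] at hs
      by_cases hvs : v ∈ s
      · right; intro x hx; exact mem_filter.2 ⟨hs.1 hx, hs.2 v hvs x hx⟩
      · left; intro x hx
        rw [mem_erase]
        refine ⟨?_, hs.1 hx⟩
        rintro rfl; exact hvs hx

/-- depth-type vanishing -/
def Vanish (R : ℕ → ℕ → Prop) (V : Finset ℕ) (n : ℤ) : Prop :=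
  ∀ U : Finset ℕ, ∀ j : ℤ, (U.card : ℤ) + j < n → Acyc K (cl R (V \ U)) j

lemma vanish_clique {R : ℕ → ℕ → Prop} {V : Finset ℕ} {n : ℤ}
    (h : ∀ a ∈ V, ∀ b ∈ V, R a b) (hn : n ≤ V.card) : Vanish K R V n := by
  intro U j hj
  rcases (V \ U).eq_empty_or_nonempty with h0 | ⟨v, hv⟩
  · rw [sdiff_eq_empty_iff_subset] at h0
    have := card_le_card h0
    apply acyc_neg
    intro s _ _
    omega
  · apply acyc_cone K hv
    intro u hu
    rw [mem_sdiff] at hu hv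
    exact ⟨h _ hv.1 _ hu.1, h _ hu.1 _ hv.1⟩

lemma vanish_mv {R : ℕ → ℕ → Prop} {V V1 V2 : Finset ℕ} {n : ℤ}
    (h : ∀ s ∈ cl R V, s ⊆ V1 ∨ s ⊆ V2) (hV1 : V1 ⊆ V) (hV2 : V2 ⊆ V)
    (h1 : Vanish K R V1 n) (h2 : Vanish K R V2 n)
    (h3 : Vanish K R (V1 ∩ V2) (n - 1)) : Vanish K R V n := by
  intro U j hj
  apply acyc_mv K (V1 := V1 \ U) (V2 := V2 \ U) _ (sdiff_subset_sdiff hV1 subset_rfl)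
    (sdiff_subset_sdiff hV2 subset_rfl) (h1 U j hj) (h2 U j hj)
  · have : (V1 \ U) ∩ (V2 \ U) = (V1 ∩ V2) \ U := by
      ext x; simp only [mem_inter, mem_sdiff]; tauto
    rw [this]
    exact h3 U (j - 1) (by omega)
  · intro s hs
    rw [mem_cl] at hs
    have hsU : ∀ x ∈ s, x ∉ U := fun x hx => (mem_sdiff.1 (hs.1 hx)).2
    rcases h s (mem_cl.2 ⟨hs.1.trans sdiff_subset, hs.2⟩) with h | h
    · left; intro x hx; exact mem_sdiff.2 ⟨h hx, hsU x hx⟩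
    · right; intro x hx; exact mem_sdiff.2 ⟨h hx, hsU x hx⟩

lemma redH_zero {Δ : SC} {n : ℤ} (h : Acyc K Δ n) : redHdim K Δ n = 0 := by
  have : boundariesOn K Δ n ⊓ cyclesOn K Δ n = cyclesOn K Δ n := by
    rw [inf_eq_right]
    intro z hz
    obtain ⟨u, hu, rfl⟩ := h z hz.1 hz.2
    exact ⟨u, hu, rfl⟩
  rw [redHdim, this, Nat.sub_self]

lemma redH_ne {Δ : SC} {n : ℤ} {z : Finset ℕ →₀ K} (hz : z ∈ facesSpan K Δ n)
    (h0 : bdry K z = 0) (h : ∀ u ∈ facesSpan K Δ (n + 1), bdry K u ≠ z) :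
    redHdim K Δ n ≠ 0 := by
  have hfin : FiniteDimensional K (facesSpan K Δ n) := by
    apply FiniteDimensional.span_of_finite
    apply Set.Finite.image
    apply Set.Finite.subset (Δ.finite_toSet)
    intro s hs; exact hs.1
  have hfin2 : FiniteDimensional K (cyclesOn K Δ n) :=
    Submodule.finiteDimensional_of_le (inf_le_left : cyclesOn K Δ n ≤ _)
  have hlt : boundariesOn K Δ n ⊓ cyclesOn K Δ n < cyclesOn K Δ n := by
    refine lt_of_le_of_ne inf_le_right ?_
    intro e
    have hzc : z ∈ cyclesOn K Δ n := ⟨hz, h0⟩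
    rw [← e] at hzc
    obtain ⟨u, hu, e'⟩ := hzc.1
    exact h u hu e'
  have := Submodule.finrank_lt_finrank_of_lt hlt
  rw [redHdim]; omega

end EW

end

noncomputable section
open Finset BigOperators
open scoped Classical
namespace EW

variable (K : Type*) [Field K]

/-- tightened constraint system -/
def tgt {ι : Type*} (c : ι → ι → ℤ) (k l : ι) (e : ℤ) (i j : ι) : ℤ :=
  min (c i j) (c i k + e + c l j)

/-- tight constraint system -/
def Tight {ι : Type*} (c : ι → ι → ℤ) : Prop :=
  (∀ i, c i i = 0) ∧ ∀ i j k, c i k ≤ c i j + c j k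

lemma tight_tgt {ι : Type*} {c : ι → ι → ℤ} (hc : Tight c) (k l : ι) (e : ℤ)
    (he : 0 ≤ e + c l k) : Tight (tgt c k l e) := by
  constructor
  · intro i
    have h1 := hc.1 i
    have h2 := hc.2 l i k
    simp only [tgt]
    omega
  · intro i j m
    have h1 := hc.2 i j m
    have h2 := hc.2 l j m
    have h3 := hc.2 i j k
    have h4 := hc.2 l j k
    simp only [tgt]
    omega

lemma tgt_le {ι : Type*} (c : ι → ι → ℤ) (k l : ι) (e : ℤ) (i j : ι) :
    tgt c k l e i j ≤ c i j := min_le_left _ _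

lemma tgt_kl {ι : Type*} {c : ι → ι → ℤ} (hc : Tight c) (k l : ι) (e : ℤ) :
    tgt c k l e k l = min (c k l) e := by
  simp [tgt, hc.1]

lemma tgt_sep {ι : Type*} {c : ι → ι → ℤ} (hc : Tight c) (k l : ι) (e : ℤ)
    (he : 0 < e + c l k) (i j : ι) (hij : 0 < c i j + c j i) :
    0 < tgt c k l e i j + tgt c k l e j i := by
  have h1 := hc.2 l i k
  have h2 := hc.2 l j k
  have h3 := hc.2 l i j
  have h4 := hc.2 l j i
  have h5 := hc.2 i j k
  have h6 := hc.2 j i k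
  simp only [tgt]
  omega

lemma tgt_sep3 {ι : Type*} {c : ι → ι → ℤ} (hc : Tight c) (k l : ι) (e : ℤ)
    (he : e = c k l - 1) (h2 : 2 ≤ c k l + c l k) (i j : ι) (hij : 0 < c i j + c j i)
    (hi : c i k + c k i ≠ 0) (hj : c j k + c k j ≠ 0) :
    0 < tgt (tgt c k l e) l k (-e) i j + tgt (tgt c k l e) l k (-e) j i := by
  have g : ∀ i, c i k + c k i ≠ 0 → 0 < c i k + c k i := by
    intro i hi
    have := hc.2 i k i
    have := hc.1 i
    omega
  have hi := g i hi
  have hj := g j hj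
  have t1 := tight_tgt hc k l e (by omega)
  have s1 := tgt_sep hc k l e (by omega) i j hij
  have e1 := tgt_kl hc k l e
  have a : ∀ i, 0 < c i k + c k i → tgt c k l e k i + tgt c k l e i l ≥ e ∧
     (tgt c k l e k i + tgt c k l e i l = e → c i l + c l i = 0) := by
    intro i hi
    have q1 := hc.2 k i l
    have q2 := hc.2 l i k
    have q3 := hc.2 l i l
    have := hc.1 k
    have := hc.1 l
    simp only [tgt]
    omega
  have b : ∀ i j, 0 < c i k + c k i → 0 < c i j + c j i →
      0 < tgt c k l e i j + tgt c k l e j i →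
      e < tgt c k l e k i + tgt c k l e i j + tgt c k l e j l := by
    intro i j hi hij s1
    have q1 := hc.2 k i l
    have q2 := hc.2 l i k
    have q4 := hc.2 i j l
    have q5 := hc.2 j l i
    have q6 := hc.2 j k i
    have q7 := hc.2 l j k
    have q8 := hc.2 l j l
    have := hc.1 k
    have := hc.1 l
    simp only [tgt] at *
    omega
  obtain ⟨a1, a2⟩ := a i hi
  obtain ⟨a3, a4⟩ := a j hj
  have b1 := b i j hi hij s1
  have b2 := b j i hj (by omega) (by omega)
  have q9 := hc.2 i l j
  have q10 := hc.2 j l i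
  unfold tgt at a1 a2 a3 a4 b1 b2 s1 ⊢
  omega

end EW

end

noncomputable section
open Finset BigOperators
open scoped Classical
namespace EW

variable (K : Type*) [Field K]

/-- polytope vertex subset -/
def Vc {ι : Type*} (V : Finset ℕ) (P : ℕ → ι → ℤ) (c : ι → ι → ℤ) : Finset ℕ :=
  V.filter (fun v => ∀ k l, P v k - P v l ≤ c k l)

lemma Vc_sub {ι : Type*} (V : Finset ℕ) (P : ℕ → ι → ℤ) (c : ι → ι → ℤ) : Vc V P c ⊆ V :=
  filter_subset _ _

lemma Vc_tgt {ι : Type*} (V : Finset ℕ) (P : ℕ → ι → ℤ) {c : ι → ι → ℤ} (hc : Tight c)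
    (k l : ι) (e : ℤ) :
    Vc V P (tgt c k l e) = (Vc V P c).filter (fun v => P v k - P v l ≤ e) := by
  ext v
  simp only [Vc, mem_filter, and_assoc]
  refine and_congr_right fun _ => ⟨fun h => ⟨fun i j => (h i j).trans (tgt_le _ _ _ _ _ _), ?_⟩, ?_⟩
  · have := h k l
    rw [tgt_kl hc] at this
    omega
  · rintro ⟨h, h'⟩ i j
    have h1 := h i j
    have h2 := h i k
    have h3 := h l j
    simp only [tgt]
    omega

lemma vanish_main {ι : Type*} [Fintype ι] (V : Finset ℕ) (P : ℕ → ι → ℤ) (c0 : ι → ι → ℤ)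
    (R : ℕ → ℕ → Prop)
    (hR : ∀ u ∈ V, ∀ v ∈ V, R u v ↔ ∀ k l, (P u k - P u l) - (P v k - P v l) ≤ 1)
    (hex : ∀ p : ι → ℤ, (∀ k l, p k - p l ≤ c0 k l) → ∃ v ∈ V, ∀ k l, P v k - P v l = p k - p l)
    (N : ℕ) : ∀ (c : ι → ι → ℤ), Tight c → (∀ i j, c i j ≤ c0 i j) →
      (∑ i, ∑ j, c i j) ≤ N → ∀ I : Finset ι, (∀ i ∈ I, ∀ j ∈ I, i ≠ j → 0 < c i j + c j i) →
      ∀ n : ℤ, n ≤ I.card → Vanish K R (Vc V P c) n := by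
  induction N using Nat.strong_induction_on with
  | _ N ih =>
  intro c hc hc0 hN I hI n hn
  by_cases hb : ∀ k l, c k l + c l k ≤ 1
  · apply vanish_clique
    · intro u hu v hv
      simp only [Vc, mem_filter] at hu hv
      rw [hR u hu.1 v hv.1]
      intro k l
      have h1 := hu.2 k l
      have h2 := hv.2 l k
      have h3 := hb k l
      omega
    · refine hn.trans ?_
      have hx : ∀ i : ι, ∃ v ∈ V, ∀ k l, P v k - P v l = c k i - c l i := by
        intro i
        apply hex (fun k => c k i)
        intro k l
        have := hc.2 k l i
        have := hc0 k l
        omega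
      choose f hf hf2 using hx
      norm_cast
      apply card_le_card_of_injOn f
      · intro i _
        simp only [Vc, coe_filter]
        refine ⟨hf i, fun k l => ?_⟩
        rw [hf2]
        have := hc.2 k l i
        omega
      · intro i hi j hj hij
        by_contra hne
        have h1 := hI i hi j hj hne
        have h2 := hf2 i i j
        have h3 := hf2 j i j
        rw [hij] at h2
        have := hc.1 i
        have := hc.1 j
        omega
  · push Not at hb
    obtain ⟨k, l, hkl⟩ := hb
    have hpos : ∀ c : ι → ι → ℤ, Tight c → 0 ≤ ∑ i, ∑ j, c i j := by
      intro c hc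
      have : (∑ i, ∑ j, c i j) + (∑ i, ∑ j, c i j) = ∑ i, ∑ j, (c i j + c j i) := by
        conv_lhs => rw [add_comm]; lhs; rw [sum_comm]
        rw [← sum_add_distrib]
        refine sum_congr rfl fun i _ => ?_
        rw [← sum_add_distrib]
        exact sum_congr rfl fun j _ => add_comm _ _
      have h2 : 0 ≤ ∑ i, ∑ j, (c i j + c j i) := by
        refine sum_nonneg fun i _ => sum_nonneg fun j _ => ?_
        have := hc.2 i j i
        have := hc.1 i
        omega
      omega
    have hlt : ∀ c c' : ι → ι → ℤ, (∀ i j, c' i j ≤ c i j) → (∃ i j, c' i j < c i j) →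
        ∑ i, ∑ j, c' i j < ∑ i, ∑ j, c i j := by
      rintro c c' h ⟨i, j, hij⟩
      refine sum_lt_sum (fun i _ => sum_le_sum fun j _ => h i j) ⟨i, mem_univ _, ?_⟩
      exact sum_lt_sum (fun j _ => h i j) ⟨j, mem_univ _, hij⟩
    have key : ∀ c' : ι → ι → ℤ, Tight c' → (∀ i j, c' i j ≤ c i j) → (∃ i j, c' i j < c i j) →
        ∀ I : Finset ι, (∀ i ∈ I, ∀ j ∈ I, i ≠ j → 0 < c' i j + c' j i) →
      ∀ n : ℤ, n ≤ I.card → Vanish K R (Vc V P c') n := by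
      intro c' t' h1 h2
      have h3 := hlt c c' h1 h2
      have h4 := hpos c' t'
      exact ih ((∑ i, ∑ j, c' i j).toNat) (by omega) c' t' (fun i j => (h1 i j).trans (hc0 i j))
        (by omega)
    set e := c k l - 1 with he
    have t1 := tight_tgt hc k l e (by omega)
    have t2 := tight_tgt hc l k (-e) (by omega)
    have ekl := tgt_kl hc k l e
    have t3 := tight_tgt t1 l k (-e) (by omega)
    have v1 := Vc_tgt V P hc k l e
    have v2 := Vc_tgt V P hc l k (-e)
    have v3 := Vc_tgt V P t1 l k (-e)
    have hl1 : tgt c k l e k l < c k l := by omega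
    apply vanish_mv K (V1 := Vc V P (tgt c k l e)) (V2 := Vc V P (tgt c l k (-e)))
    · intro s hs
      rw [mem_cl] at hs
      by_contra hcon
      rw [not_or, not_subset, not_subset, v1, v2] at hcon
      obtain ⟨⟨u, hu, hu'⟩, ⟨v, hv, hv'⟩⟩ := hcon
      have a1 := hs.1 hu
      have a2 := hs.1 hv
      simp only [mem_filter, a1, a2, true_and, not_le] at hu' hv'
      have a3 := (hR u (Vc_sub _ _ _ a1) v (Vc_sub _ _ _ a2)).1 (hs.2 u hu v hv) k l
      omega
    · rw [v1]; exact filter_subset _ _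
    · rw [v2]; exact filter_subset _ _
    · apply key _ t1 (tgt_le _ _ _ _) ⟨k, l, hl1⟩ I _ n hn
      intro i hi j hj hij
      exact tgt_sep hc k l e (by omega) i j (hI i hi j hj hij)
    · have := tgt_kl hc l k (-e)
      apply key _ t2 (tgt_le _ _ _ _) ⟨l, k, by omega⟩ I _ n hn
      intro i hi j hj hij
      exact tgt_sep hc l k (-e) (by omega) i j (hI i hi j hj hij)
    · have hv : Vc V P (tgt c k l e) ∩ Vc V P (tgt c l k (-e)) =
          Vc V P (tgt (tgt c k l e) l k (-e)) := by
        rw [v3, v2, v1]; ext v; simp only [mem_inter, mem_filter]; tauto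
      rw [hv]
      apply key _ t3 (fun i j => (tgt_le _ _ _ _ _ _).trans (tgt_le _ _ _ _ _ _))
        ⟨k, l, (tgt_le _ _ _ _ _ _).trans_lt hl1⟩ (I.filter (fun i => c i k + c k i ≠ 0))
      · intro i hi j hj hij
        rw [mem_filter] at hi hj
        exact tgt_sep3 hc k l e he (by omega) i j (hI i hi.1 j hj.1 hij) hi.2 hj.2
      · have h1 := card_filter_add_card_filter_not (s := I) (fun i => c i k + c k i ≠ 0)
        have h2 : (I.filter (fun i => ¬ (c i k + c k i ≠ 0))).card ≤ 1 := by
          rw [card_le_one]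
          intro a ha b hb
          rw [mem_filter, not_not] at ha hb
          by_contra hab
          have h1 := hI a ha.1 b hb.1 hab
          have h2 := hc.2 a k b
          have h3 := hc.2 b k a
          omega
        omega

end EW

end

noncomputable section
open Finset BigOperators
open scoped Classical
namespace EW

lemma encTup_inj (d : ℕ) : Function.Injective (encTup (n := d)) := by
  intro a b h
  exact List.ofFn_injective (Encodable.encode_injective h)

/-- the vertex set -/
def VV (d r : ℕ) : Finset ℕ := (Finset.Nat.antidiagonalTuple d r).image encTup

/-- decoding -/
def dec (d : ℕ) (v : ℕ) : Fin d → ℕ := Function.invFun encTup v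

lemma dec_enc {d : ℕ} (a : Fin d → ℕ) : dec d (encTup a) = a :=
  Function.leftInverse_invFun (encTup_inj d) a

/-- partial sums -/
def P (d : ℕ) (v k : ℕ) : ℤ := ∑ l ∈ range (k + 1), if h : l < d then (dec d v ⟨l, h⟩ : ℤ) else 0

/-- adjacency -/
def RR (d : ℕ) (u v : ℕ) : Prop := edgeOK (dec d u) (dec d v)

lemma enc_dec {d r v : ℕ} (hv : v ∈ VV d r) : encTup (dec d v) = v := by
  obtain ⟨a, _, rfl⟩ := mem_image.1 hv
  rw [dec_enc]

lemma dec_mem {d r v : ℕ} (hv : v ∈ VV d r) : dec d v ∈ Finset.Nat.antidiagonalTuple d r := by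
  obtain ⟨a, ha, rfl⟩ := mem_image.1 hv
  rwa [dec_enc]

lemma RR_refl (d u : ℕ) : RR d u u := by
  left; intro k; simp [iComp]

lemma RR_symm (d u v : ℕ) (h : RR d u v) : RR d v u := Or.symm h

lemma tupSupp_sub {d : ℕ} (a : Fin d → ℕ) : tupSupp a ⊆ range d := by
  intro x hx
  simp only [tupSupp, mem_image] at hx
  obtain ⟨y, _, rfl⟩ := hx
  simp

lemma mem_edgewise {d r : ℕ} {s : Finset ℕ} :
    s ∈ edgewise d r (simplexC d) ↔ s ⊆ VV d r ∧ ∀ a ∈ s, ∀ b ∈ s, RR d a b := by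
  simp only [edgewise, edgewiseT, mem_image, mem_filter, mem_powerset]
  constructor
  · rintro ⟨F, ⟨h1, -, h2⟩, rfl⟩
    refine ⟨image_subset_image h1, ?_⟩
    intro a ha b hb
    obtain ⟨a, ha1, rfl⟩ := mem_image.1 ha
    obtain ⟨b, hb1, rfl⟩ := mem_image.1 hb
    rw [RR, dec_enc, dec_enc]
    exact h2 a ha1 b hb1
  · rintro ⟨h1, h2⟩
    refine ⟨s.image (dec d), ⟨?_, ?_, ?_⟩, ?_⟩
    · intro a ha
      obtain ⟨v, hv, rfl⟩ := mem_image.1 ha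
      exact dec_mem (h1 hv)
    · rw [simplexC, mem_powerset]
      exact Finset.sup_le fun a _ => tupSupp_sub a
    · intro a ha b hb
      obtain ⟨a, ha1, rfl⟩ := mem_image.1 ha
      obtain ⟨b, hb1, rfl⟩ := mem_image.1 hb
      exact h2 a ha1 b hb1
    · rw [image_image]
      ext x
      simp only [mem_image, Function.comp_apply]
      constructor
      · rintro ⟨y, hy, rfl⟩; rwa [enc_dec (h1 hy)]
      · intro hx; exact ⟨x, hx, enc_dec (h1 hx)⟩

lemma vertexSet_edgewise (d r : ℕ) : vertexSet (edgewise d r (simplexC d)) = VV d r := by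
  ext v
  simp only [vertexSet, mem_sup, id]
  constructor
  · rintro ⟨s, hs, hv⟩; exact (mem_edgewise.1 hs).1 hv
  · intro hv
    refine ⟨{v}, mem_edgewise.2 ⟨by simpa using hv, ?_⟩, by simp⟩
    intro a ha b hb
    rw [mem_singleton.1 ha, mem_singleton.1 hb]
    exact RR_refl _ _

lemma induced_eq {d r : ℕ} {W : Finset ℕ} (hW : W ⊆ VV d r) :
    inducedSC (edgewise d r (simplexC d)) W = cl (RR d) W := by
  ext s
  simp only [inducedSC, mem_filter, mem_edgewise, mem_cl]
  constructor
  · rintro ⟨⟨_, h⟩, h'⟩; exact ⟨h', h⟩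
  · rintro ⟨h', h⟩; exact ⟨⟨h'.trans hW, h⟩, h'⟩

lemma P_succ (d v k : ℕ) (hk : k + 1 < d) : P d v (k + 1) = P d v k + dec d v ⟨k + 1, hk⟩ := by
  rw [P, sum_range_succ, P, dif_pos hk]

lemma P_zero (d v : ℕ) (hd : 0 < d) : P d v 0 = dec d v ⟨0, hd⟩ := by
  simp [P, hd]

lemma P_mono (d v : ℕ) {k l : ℕ} (h : k ≤ l) : P d v k ≤ P d v l := by
  apply sum_le_sum_of_subset_of_nonneg
  · intro x; simp; omega
  · intro i _ _; split_ifs <;> simp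

lemma P_nonneg (d v k : ℕ) : 0 ≤ P d v k := by
  apply sum_nonneg
  intro i _; split_ifs <;> simp

lemma P_last {d r v : ℕ} (hd : 1 ≤ d) (hv : v ∈ VV d r) : P d v (d - 1) = r := by
  have := dec_mem hv
  rw [Finset.Nat.mem_antidiagonalTuple] at this
  rw [P, Nat.sub_add_cancel hd, ← this]
  push_cast
  rw [Finset.sum_fin_eq_sum_range]

lemma iComp_eq (d u v : ℕ) (k : Fin d) :
    iComp (fun l => (dec d u l : ℤ) - (dec d v l : ℤ)) k = P d u k - P d v k := by
  rw [P, P, ← sum_sub_distrib, iComp, sum_filter, Finset.sum_fin_eq_sum_range]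
  have : range (k + 1) ⊆ range d := by
    intro x; have := k.2; simp; omega
  symm
  rw [← sum_subset this]
  · apply sum_congr rfl
    intro l hl
    have := k.2
    have h1 : l < d := by simp at hl; omega
    have h2 : l ≤ k := by simp at hl; omega
    simp [h1, Fin.le_def, h2]
  · intro l hl hl'
    have h1 : l < d := by simpa using hl
    have h2 : ¬ l ≤ k := by simp at hl'; omega
    simp [h1, Fin.le_def, h2]

lemma RR_iff {d r u v : ℕ} (hd : 1 ≤ d) (hu : u ∈ VV d r) (hv : v ∈ VV d r) :
    RR d u v ↔ ∀ k < d, ∀ l < d, (P d u k - P d u l) - (P d v k - P d v l) ≤ 1 := by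
  simp only [RR, edgeOK, iComp_eq, Set.mem_insert_iff, Set.mem_singleton_iff]
  have hl : d - 1 < d := by omega
  have h1 := P_last hd hu
  have h2 := P_last hd hv
  constructor
  · rintro (h | h)
    · intro k hk l hl
      have := h ⟨k, hk⟩
      have := h ⟨l, hl⟩
      simp only at *
      omega
    · intro k hk l hl
      have := h ⟨k, hk⟩
      have := h ⟨l, hl⟩
      simp only at *
      omega
  · intro h
    by_cases hx : ∃ k < d, P d u k - P d v k = 1
    · obtain ⟨k, hk, hk'⟩ := hx
      left
      rintro ⟨l, hl'⟩
      have a1 := h k hk l hl'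
      have a2 := h l hl' (d - 1) hl
      simp only
      omega
    · push Not at hx
      right
      rintro ⟨l, hl'⟩
      have a1 := hx l hl'
      have a2 := h l hl' (d - 1) hl
      have a3 := h (d - 1) hl l hl'
      simp only
      omega

lemma P_ext {d r u v : ℕ} (hd : 1 ≤ d) (hu : u ∈ VV d r) (hv : v ∈ VV d r)
    (h : ∀ k < d, ∀ l < d, P d u k - P d u l = P d v k - P d v l) : u = v := by
  have h1 := P_last hd hu
  have h2 := P_last hd hv
  have h3 : ∀ k < d, P d u k = P d v k := by
    intro k hk
    have := h k hk (d - 1) (by omega)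
    omega
  rw [← enc_dec hu, ← enc_dec hv]
  congr 1
  ext ⟨k, hk⟩
  rcases k with _ | k
  · have := h3 0 hk
    rw [P_zero d u hk, P_zero d v hk] at this
    exact_mod_cast this
  · have a := h3 (k + 1) hk
    have b := h3 k (by omega)
    rw [P_succ d u k hk, P_succ d v k hk, b] at a
    simpa using a

lemma P_exists {d r : ℕ} (hd : 1 ≤ d) (p : ℕ → ℤ) (hp : ∀ k, k + 1 < d → p k ≤ p (k + 1))
    (hr : p (d - 1) - p 0 ≤ r) :
    ∃ v ∈ VV d r, ∀ k < d, ∀ l < d, P d v k - P d v l = p k - p l := by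
  let a : Fin d → ℕ := fun i =>
    if i.1 = 0 then (p 0 - p (d - 1) + r).toNat else (p i.1 - p (i.1 - 1)).toNat
  have key : ∀ k < d, P d (encTup a) k = p k - p (d - 1) + r := by
    intro k hk
    induction k with
    | zero =>
      rw [P_zero d _ hk, dec_enc]
      simp only [a, if_true]
      omega
    | succ k ih =>
      rw [P_succ d _ k hk, dec_enc, ih (by omega)]
      have := hp k hk
      simp only [a]
      rw [if_neg (by omega)]
      simp only [Nat.add_sub_cancel]
      omega
  refine ⟨encTup a, ?_, ?_⟩
  · apply mem_image_of_mem
    rw [Finset.Nat.mem_antidiagonalTuple]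
    have := key (d - 1) (by omega)
    rw [P, Nat.sub_add_cancel hd, dec_enc, ← Finset.sum_fin_eq_sum_range (fun i => (a i : ℤ))] at this
    have h2 : ((∑ i, a i : ℕ) : ℤ) = r := by push_cast; omega
    exact_mod_cast h2
  · intro k hk l hl
    rw [key k hk, key l hl]; ring

lemma card_VV (d r : ℕ) (hd : 1 ≤ d) : (VV d r).card = Nat.choose (r + d - 1) (d - 1) := by
  rw [VV, card_image_of_injective _ (encTup_inj d)]
  have h : (Finset.Nat.antidiagonalTuple d r).card =
      ((Finset.univ : Finset (Fin d)).finsuppAntidiag r).card := by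
    symm
    apply card_bij (fun (f : Fin d →₀ ℕ) _ => (f : Fin d → ℕ))
    · intro f hf
      rw [mem_finsuppAntidiag] at hf
      rw [Finset.Nat.mem_antidiagonalTuple]
      exact hf.1
    · intro f _ g _ h
      exact DFunLike.coe_injective h
    · intro a ha
      rw [Finset.Nat.mem_antidiagonalTuple] at ha
      refine ⟨Finsupp.equivFunOnFinite.symm a, ?_, by simp⟩
      rw [mem_finsuppAntidiag]
      exact ⟨by simpa using ha, subset_univ _⟩
  rw [h, card_finsuppAntidiag_nat_eq_choose, card_univ, Fintype.card_fin, add_comm d r]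
  rw [← Nat.choose_symm (by omega)]
  congr 1
  omega


lemma vanish_VV (K : Type*) [Field K] (d r : ℕ) (hd : 1 ≤ d) (hr : d ≤ r) :
    Vanish K (RR d) (VV d r) d := by
  let P' : ℕ → Fin d → ℤ := fun v k => P d v k
  let c0 : Fin d → Fin d → ℤ := fun k l => if k ≤ l then 0 else r
  have hV : Vc (VV d r) P' c0 = VV d r := by
    refine Subset.antisymm (Vc_sub _ _ _) ?_
    intro v hv
    simp only [Vc, mem_filter, hv, true_and]
    intro k l
    simp only [c0, P']
    split_ifs with h
    · have := P_mono d v (Fin.le_def.1 h); omega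
    · have h1 := P_last hd hv
      have h2 := P_mono d v (k := k) (l := d - 1) (by have := k.2; omega)
      have h3 := P_nonneg d v l
      omega
  have := vanish_main K (VV d r) P' c0 (RR d) ?_ ?_ ((∑ i, ∑ j, c0 i j).toNat) c0 ?_ ?_ ?_
    univ ?_ d (by simp)
  · rwa [hV] at this
  · intro u hu v hv
    rw [RR_iff hd hu hv]
    exact ⟨fun h k l => h k k.2 l l.2, fun h k hk l hl => h ⟨k, hk⟩ ⟨l, hl⟩⟩
  · intro p hp
    have hPe := P_exists (r := r) hd (fun k => if h : k < d then p ⟨k, h⟩ else 0) ?_ ?_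
    · obtain ⟨v, hv, h⟩ := hPe
      refine ⟨v, hv, fun k l => ?_⟩
      have := h k k.2 l l.2
      simpa using this
    · intro k hk
      have := hp ⟨k, by omega⟩ ⟨k + 1, hk⟩
      simp only [c0, Fin.mk_le_mk, Nat.le_succ, if_true] at this
      rw [dif_pos hk, dif_pos (by omega)]
      omega
    · have h1 : d - 1 < d := by omega
      have := hp ⟨d - 1, h1⟩ ⟨0, by omega⟩
      rw [dif_pos h1, dif_pos (by omega)]
      refine this.trans ?_
      simp only [c0]
      split_ifs <;> omega
  · constructor
    · intro i; simp [c0]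
    · intro i j k
      simp only [c0, Fin.le_def]
      split_ifs <;> omega
  · intro i j; exact le_rfl
  · exact Int.self_le_toNat _
  · intro i _ j _ hij
    simp only [c0]
    rcases lt_or_gt_of_ne hij with h | h
    · rw [if_pos h.le, if_neg (not_le.2 h)]; omega
    · rw [if_neg (not_le.2 h), if_pos h.le]; omega

end EW

end

noncomputable section
open Finset BigOperators
open scoped Classical
namespace EW

variable (K : Type*) [Field K]

lemma sd'_mem {R : ℕ → ℕ → Prop} (hr : ∀ a, R a a) (hs : ∀ a b, R a b → R b a)
    (w : Finset ℕ → ℕ) (A : Finset ℕ) (k : ℕ) : ∀ S : Finset ℕ, S.card = k →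
    (∀ T T', T ≠ ∅ → T ⊆ T' → T' ⊆ S → R (w T) (w T')) →
    (∀ T ⊆ S, T ≠ ∅ → ∀ a ∈ A, R a (w T)) → ∀ (n : ℤ) (x : Finset ℕ →₀ K),
    x ∈ facesSpan K (cl R A) n →
    sd' K w S x ∈ facesSpan K (cl R (A ∪ (S.powerset.erase ∅).image w)) (n + k) := by
  induction k with
  | zero =>
    intro S hS _ _ n x hx
    have : S = ∅ := by simpa using hS
    subst this
    rw [sd'_empty]
    simpa using hx
  | succ k ih =>
    intro S hS h1 h2 n x hx
    have hne : S ≠ ∅ := by rintro rfl; simp at hS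
    rw [sd'_ne K w hne, Module.End.mul_apply]
    have : (n + (k + 1 : ℕ) : ℤ) = (n + k) + 1 := by push_cast; ring
    rw [this]
    apply E_mem K (Δ := cl R (A ∪ (S.powerset.erase ∅).image w))
    · intro s hsm _
      rw [mem_cl] at hsm ⊢
      have hadj : ∀ a ∈ s, R a (w S) := by
        intro a ha
        rcases mem_union.1 (hsm.1 ha) with h | h
        · exact h2 S subset_rfl hne a h
        · obtain ⟨T, hT, rfl⟩ := mem_image.1 h
          rw [mem_erase, mem_powerset] at hT
          exact h1 T S hT.1 hT.2 subset_rfl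
      constructor
      · refine insert_subset (mem_union_right _ (mem_image_of_mem _ ?_)) hsm.1
        simp [hne]
      · intro a ha b hb
        rw [mem_insert] at ha hb
        rcases ha with ha | ha
        · rcases hb with hb | hb
          · rw [ha, hb]; exact hr _
          · rw [ha]; exact hs _ _ (hadj b hb)
        · rcases hb with hb | hb
          · rw [hb]; exact hadj a ha
          · exact hsm.2 a ha b hb
    · rw [sdA, LinearMap.sum_apply]
      apply Submodule.sum_mem
      intro s hs'
      rw [LinearMap.smul_apply]
      apply Submodule.smul_mem
      have := ih (S.erase s) (by rw [card_erase_of_mem hs', hS]; simp)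
        (fun T T' a b c => h1 T T' a b (c.trans (erase_subset _ _)))
        (fun T a b => h2 T (a.trans (erase_subset _ _)) b) n x hx
      refine facesSpan_mono K (cl_mono R ?_) _ this
      apply union_subset_union_right
      apply image_subset_image
      apply erase_subset_erase
      exact powerset_mono.2 (erase_subset _ _)

/-- link vertices of one block -/
def Lb (w : Finset ℕ → ℕ) (B : Finset ℕ) : Finset ℕ := ((B.powerset.erase ∅).erase B).image w

lemma sdA_mem {R : ℕ → ℕ → Prop} (hr : ∀ a, R a a) (hs : ∀ a b, R a b → R b a)
    (w : Finset ℕ → ℕ) (A : Finset ℕ) (B : Finset ℕ)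
    (h1 : ∀ T T', T ≠ ∅ → T ⊆ T' → T' ⊂ B → R (w T) (w T'))
    (h2 : ∀ T ⊂ B, T ≠ ∅ → ∀ a ∈ A, R a (w T)) (n : ℤ) (x : Finset ℕ →₀ K)
    (hx : x ∈ facesSpan K (cl R A) n) :
    sdA K w B x ∈ facesSpan K (cl R (A ∪ Lb w B)) (n + (B.card - 1)) := by
  rw [sdA, LinearMap.sum_apply]
  apply Submodule.sum_mem
  intro s hs'
  rw [LinearMap.smul_apply]
  apply Submodule.smul_mem
  have hss := erase_ssubset hs'
  have := sd'_mem K hr hs w A _ (B.erase s) rfl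
        (fun T T' a b c => h1 T T' a b (c.trans_ssubset hss))
        (fun T a b => h2 T (a.trans_ssubset hss) b) n x hx
  have hc := card_erase_add_one hs'
  have e : ((B.card : ℤ) - 1) = ((B.erase s).card : ℤ) := by omega
  rw [e]
  refine facesSpan_mono K (cl_mono R ?_) _ this
  apply union_subset_union_right
  apply image_subset_image
  intro T hT
  simp only [mem_erase, mem_powerset] at hT ⊢
  refine ⟨?_, hT.1, hT.2.trans (erase_subset _ _)⟩
  rintro rfl
  exact notMem_erase s T (hT.2 hs')

/-- all link vertices -/
def LL (w : ℕ → Finset ℕ → ℕ) (B : ℕ → Finset ℕ) (m : ℕ) : Finset ℕ :=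
  (range m).biUnion (fun t => Lb (w t) (B t))

lemma sig_mem {R : ℕ → ℕ → Prop} (hr : ∀ a, R a a) (hs : ∀ a b, R a b → R b a)
    (w : ℕ → Finset ℕ → ℕ) (B : ℕ → Finset ℕ) (m : ℕ)
    (h1 : ∀ t < m, ∀ T T', T ≠ ∅ → T ⊆ T' → T' ⊂ B t → R (w t T) (w t T'))
    (h2 : ∀ t < m, ∀ t' < t, ∀ T ⊂ B t, T ≠ ∅ → ∀ T' ⊂ B t', T' ≠ ∅ → R (w t' T') (w t T)) :
    sig K w B m ∈ facesSpan K (cl R (LL w B m)) (∑ t ∈ range m, ((B t).card - 1 : ℤ)) := by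
  induction m with
  | zero =>
    rw [sig]
    apply single_mem
    · rw [mem_cl]; simp
    · simp
  | succ m ih =>
    rw [sig, sum_range_succ]
    have e : LL w B (m + 1) = LL w B m ∪ Lb (w m) (B m) := by
      rw [LL, range_add_one, biUnion_insert, union_comm]; rfl
    rw [e]
    apply sdA_mem K hr hs
    · exact h1 m (by omega)
    · intro T hT hT' a ha
      simp only [LL, mem_biUnion, mem_range, Lb, mem_image, mem_erase, mem_powerset] at ha
      obtain ⟨t', ht', T', hT2, rfl⟩ := ha
      exact h2 m (by omega) t' ht' T hT hT' T' (hT2.2.2.ssubset_of_ne hT2.1) hT2.2.1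
    · exact ih (fun t ht => h1 t (by omega)) (fun t ht => h2 t (by omega))

lemma nonvan {R : ℕ → ℕ → Prop} (hr : ∀ a, R a a) (hs : ∀ a b, R a b → R b a)
    (w : ℕ → Finset ℕ → ℕ) (B : ℕ → Finset ℕ) (m j : ℕ)
    (h1 : ∀ t < m, ∀ T T', T ≠ ∅ → T ⊆ T' → T' ⊂ B t → R (w t T) (w t T'))
    (h2 : ∀ t < m, ∀ t' < t, ∀ T ⊂ B t, T ≠ ∅ → ∀ T' ⊂ B t', T' ≠ ∅ → R (w t' T') (w t T))
    (hj : ∑ t ∈ range m, (B t).card = j + m)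
    (hB : ∀ s < m, (B s).Nonempty)
    (hd : ∀ s < m, ∀ s' < m, s ≠ s' → Disjoint (B s) (B s'))
    (f : ℕ → ℕ) (hw : ∀ t < m, ∀ T ⊂ B t, T ≠ ∅ → f (w t T) ∈ T)
    (W : Finset ℕ) (hLW : LL w B m ⊆ W)
    (hf : ∀ s ∈ cl R W, s.card = j + 1 → ∃ u ∈ s, ∃ v ∈ s, u ≠ v ∧ f u = f v) :
    redHdim K (cl R W) j ≠ 0 := by
  have hj' : (∑ t ∈ range m, ((B t).card - 1 : ℤ)) = j := by
    rw [sum_sub_distrib]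
    have : (∑ t ∈ range m, ((B t).card : ℤ)) = j + m := by exact_mod_cast hj
    rw [this]; simp
  have hm := sig_mem K hr hs w B m h1 h2
  rw [hj'] at hm
  apply redH_ne K (facesSpan_mono K (cl_mono R hLW) _ hm) (bdry_sig K w B m)
  intro u hu hb
  have h0 : push K f u = 0 := by
    have : facesSpan K (cl R W) (j + 1) ≤ LinearMap.ker (push K f) := by
      apply facesSpan_le
      intro s hs' hc
      obtain ⟨a, ha, b, hb, hab, e⟩ := hf s hs' (by exact_mod_cast hc)
      exact push_noninj K f ha hb hab e
    exact this hu
  have h3 : push K f (sig K w B m) = 0 := by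
    rw [← hb, ← bdry_push, h0, map_zero]
  rw [push_sig] at h3
  exact sig_ne K _ B m hB hd (fun s hs T hT hne hT' => hw s hs T (hT.ssubset_of_ne hne) hT') h3

lemma card_LL (w : ℕ → Finset ℕ → ℕ) (B : ℕ → Finset ℕ) (m : ℕ) (hB : ∀ s < m, (B s).Nonempty) :
    (LL w B m).card ≤ ∑ t ∈ range m, (2 ^ (B t).card - 2) := by
  refine card_biUnion_le.trans (sum_le_sum fun t ht => ?_)
  refine card_image_le.trans ?_
  rw [card_erase_of_mem, card_erase_of_mem (by simp), card_powerset]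
  · omega
  · have := hB t (by simpa using ht)
    simp [this.ne_empty]

end EW

end

noncomputable section
open Finset BigOperators
open scoped Classical
namespace EW

variable (K : Type*) [Field K]

/-- combinatorial data for the cycle construction -/
structure Dat (d r m : ℕ) (β : ℕ → ℕ) (p0 : ℕ → ℤ) : Prop where
  hd : 1 ≤ d
  mono : Monotone β
  zero : β 0 = 0
  step : ∀ k, β (k + 1) ≤ β k + 1
  lt : ∀ k < d, β k < m
  surj : ∀ t < m, ∃ k < d, β k = t
  strict : ∀ k, k + 1 < d → β (k + 1) = β k → p0 k < p0 (k + 1)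
  flat : ∀ k, k + 1 < d → β (k + 1) ≠ β k → p0 k = p0 (k + 1)
  last : p0 (d - 1) - p0 0 = r - 1

/-- blocks -/
def Bl (d : ℕ) (β : ℕ → ℕ) (t : ℕ) : Finset ℕ := (range d).filter (fun k => β k = t)

lemma mem_Bl {d : ℕ} {β : ℕ → ℕ} {t k : ℕ} : k ∈ Bl d β t ↔ k < d ∧ β k = t := by
  simp [Bl]

/-- the face at infinity -/
def FF (d r : ℕ) (β : ℕ → ℕ) (p0 : ℕ → ℤ) : Finset ℕ :=
  (VV d r).filter (fun v => ∀ k < d, ∀ l < d, β k = β l → P d v k - p0 k = P d v l - p0 l)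

lemma mem_FF {d r : ℕ} {β : ℕ → ℕ} {p0 : ℕ → ℤ} {v : ℕ} : v ∈ FF d r β p0 ↔
    v ∈ VV d r ∧ ∀ k < d, ∀ l < d, β k = β l → P d v k - p0 k = P d v l - p0 l := by
  simp [FF]

lemma card_FF {d r m : ℕ} {β : ℕ → ℕ} {p0 : ℕ → ℤ} (D : Dat d r m β p0) :
    (FF d r β p0).card ≤ m := by
  have hd := D.hd
  have qmono : ∀ v ∈ FF d r β p0, ∀ k l, k ≤ l → l < d → P d v k - p0 k ≤ P d v l - p0 l := by
    intro v hv k l hkl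
    rw [mem_FF] at hv
    induction l, hkl using Nat.le_induction with
    | base => intro _; exact le_rfl
    | succ l hl ih =>
      intro hld
      refine (ih (by omega)).trans ?_
      by_cases hb : β (l + 1) = β l
      · exact (hv.2 l (by omega) (l + 1) hld hb.symm).le
      · have h1 := D.flat l hld hb
        have h2 := P_mono d v (Nat.le_succ l)
        rw [Nat.succ_eq_add_one] at h2
        omega
  let km : ℕ → ℕ := fun v => Nat.findGreatest (fun k => P d v k - p0 k = P d v 0 - p0 0) (d - 1)
  have hkm : ∀ v, km v < d := by
    intro v
    have : km v ≤ d - 1 := Nat.findGreatest_le _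
    omega
  have hkm2 : ∀ v, P d v (km v) - p0 (km v) = P d v 0 - p0 0 := by
    intro v
    exact Nat.findGreatest_spec (P := fun k => P d v k - p0 k = P d v 0 - p0 0)
      (Nat.zero_le (d - 1)) rfl
  have hval : ∀ v ∈ FF d r β p0, ∀ k < d,
      P d v k - p0 k = P d v 0 - p0 0 + if β k ≤ β (km v) then 0 else 1 := by
    intro v hv k hk
    have hv' := mem_FF.1 hv
    split_ifs with h
    · rw [add_zero]
      rcases eq_or_lt_of_le h with h | h
      · rw [hv'.2 k hk _ (hkm v) h, hkm2]
      · have : k ≤ km v := by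
          by_contra hc
          have := D.mono (le_of_not_ge hc)
          omega
        have h1 := qmono v hv k _ this (hkm v)
        have h2 := qmono v hv 0 k (by omega) hk
        have h3 := hkm2 v
        omega
    · have h1 : km v < k := by
        by_contra hc
        exact h (D.mono (le_of_not_gt hc))
      have h2 : ¬ (P d v k - p0 k = P d v 0 - p0 0) :=
        Nat.findGreatest_is_greatest (P := fun k => P d v k - p0 k = P d v 0 - p0 0) h1 (by omega)
      have h3 := qmono v hv 0 k (by omega) hk
      have h4 := qmono v hv k (d - 1) (by omega) (by omega)
      have h5 := P_last hd hv'.1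
      have h6 := P_nonneg d v 0
      have h7 := D.last
      omega
  have := card_le_card_of_injOn (s := FF d r β p0) (t := range m) (fun v => β (km v)) ?_ ?_
  · simpa using this
  · intro v _
    simpa using D.lt _ (hkm v)
  · intro u hu v hv huv
    simp only at huv
    apply P_ext hd (mem_FF.1 hu).1 (mem_FF.1 hv).1
    intro k hk l hl
    have a1 := hval u hu k hk
    have a2 := hval u hu l hl
    have a3 := hval v hv k hk
    have a4 := hval v hv l hl
    rw [huv] at a1 a2
    omega

/-- height function of a link vertex -/
def hgt (β : ℕ → ℕ) (t : ℕ) (S : Finset ℕ) (k : ℕ) : ℤ :=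
  (if t < β k then 1 else 0) + if k ∈ S then 1 else 0

lemma w_exists {d r m : ℕ} {β : ℕ → ℕ} {p0 : ℕ → ℤ} (D : Dat d r m β p0) (t : ℕ) (S : Finset ℕ)
    (hS : S ⊆ Bl d β t) : ∃ v ∈ VV d r, ∀ k < d, ∀ l < d, P d v k - P d v l =
      (p0 k + hgt β t S k) - (p0 l + hgt β t S l) := by
  have hS' : ∀ k ∈ S, β k = t := fun k hk => (mem_Bl.1 (hS hk)).2
  apply P_exists D.hd
  · intro k hk
    have h1 := D.mono (Nat.le_succ k)
    have h2 := D.step k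
    have h3 := D.strict k hk
    have h4 := D.flat k hk
    have h5 := hS' k
    have h6 := hS' (k + 1)
    simp only [hgt]
    by_cases hb : β (k + 1) = β k
    · have := h3 hb
      rw [hb]
      split_ifs <;> omega
    · have := h4 hb
      have : β (k + 1) = β k + 1 := by rw [Nat.succ_eq_add_one] at h1; omega
      split_ifs with a1 a2 a3 a4 a5 a6 <;> first | omega | (have := h5 (by assumption); omega)
  · have h1 := D.last
    have h2 := hS' (d - 1)
    have h3 := D.zero
    simp only [hgt]
    split_ifs with a1 a2 a3 a4 a5 a6 <;> first | omega | (have := h2 (by assumption); omega)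

/-- link vertices -/
def wv (d r : ℕ) (β : ℕ → ℕ) (p0 : ℕ → ℤ) (t : ℕ) (S : Finset ℕ) : ℕ :=
  if h : ∃ v ∈ VV d r, ∀ k < d, ∀ l < d, P d v k - P d v l =
      (p0 k + hgt β t S k) - (p0 l + hgt β t S l) then h.choose else 0

lemma wv_spec {d r m : ℕ} {β : ℕ → ℕ} {p0 : ℕ → ℤ} (D : Dat d r m β p0) {t : ℕ} {S : Finset ℕ}
    (hS : S ⊆ Bl d β t) : wv d r β p0 t S ∈ VV d r ∧ ∀ k < d, ∀ l < d,
    P d (wv d r β p0 t S) k - P d (wv d r β p0 t S) l =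
      (p0 k + hgt β t S k) - (p0 l + hgt β t S l) := by
  have h := w_exists D t S hS
  rw [wv, dif_pos h]
  exact h.choose_spec

/-- labels -/
def lab (d : ℕ) (β : ℕ → ℕ) (p0 : ℕ → ℤ) (v : ℕ) : ℕ :=
  if h : ∃ k < d, (∃ k' < d, β k' = β k ∧ P d v k' - p0 k' < P d v k - p0 k) ∧
    ∀ k' < d, β k' = β k → P d v k' - p0 k' ≤ P d v k - p0 k then h.choose else 0

lemma lab_spec {d r : ℕ} {β : ℕ → ℕ} {p0 : ℕ → ℤ} {v : ℕ} (hv : v ∈ VV d r)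
    (hF : v ∉ FF d r β p0) :
    lab d β p0 v < d ∧ (∃ k' < d, β k' = β (lab d β p0 v) ∧
      P d v k' - p0 k' < P d v (lab d β p0 v) - p0 (lab d β p0 v)) ∧
    ∀ k' < d, β k' = β (lab d β p0 v) →
      P d v k' - p0 k' ≤ P d v (lab d β p0 v) - p0 (lab d β p0 v) := by
  have h : ∃ k < d, (∃ k' < d, β k' = β k ∧ P d v k' - p0 k' < P d v k - p0 k) ∧
    ∀ k' < d, β k' = β k → P d v k' - p0 k' ≤ P d v k - p0 k := by
    rw [mem_FF] at hF
    push Not at hF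
    obtain ⟨k, hk, l, hl, hb, hne⟩ := hF hv
    obtain ⟨e, he, hmax⟩ := exists_max_image (Bl d β (β k)) (fun x => P d v x - p0 x)
      ⟨k, mem_Bl.2 ⟨hk, rfl⟩⟩
    rw [mem_Bl] at he
    have m1 := hmax k (mem_Bl.2 ⟨hk, rfl⟩)
    have m2 := hmax l (mem_Bl.2 ⟨hl, hb.symm⟩)
    refine ⟨e, he.1, ?_, fun x hx hxe => hmax x (mem_Bl.2 ⟨hx, hxe.trans he.2⟩)⟩
    by_cases hc : P d v k - p0 k < P d v e - p0 e
    · exact ⟨k, hk, he.2.symm, hc⟩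
    · exact ⟨l, hl, hb.symm.trans he.2.symm, by omega⟩
  rw [lab, dif_pos h]
  exact h.choose_spec

lemma wv_notF {d r m : ℕ} {β : ℕ → ℕ} {p0 : ℕ → ℤ} (D : Dat d r m β p0) {t : ℕ} {S : Finset ℕ}
    (hS : S ⊂ Bl d β t) (hne : S ≠ ∅) : wv d r β p0 t S ∉ FF d r β p0 := by
  obtain ⟨h1, h2⟩ := wv_spec D hS.subset
  intro hF
  obtain ⟨s, hs⟩ := nonempty_iff_ne_empty.2 hne
  obtain ⟨u, hu, hus⟩ := exists_of_ssubset hS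
  have hs' := mem_Bl.1 (hS.subset hs)
  have hu' := mem_Bl.1 hu
  have a := (mem_FF.1 hF).2 s hs'.1 u hu'.1 (by omega)
  have b := h2 s hs'.1 u hu'.1
  simp only [hgt, hs'.2, hu'.2, hs, hus, if_true, if_false, lt_irrefl] at b
  omega

lemma lab_wv {d r m : ℕ} {β : ℕ → ℕ} {p0 : ℕ → ℤ} (D : Dat d r m β p0) {t : ℕ} {S : Finset ℕ}
    (hS : S ⊂ Bl d β t) (hne : S ≠ ∅) : lab d β p0 (wv d r β p0 t S) ∈ S := by
  obtain ⟨h1, h2⟩ := wv_spec D hS.subset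
  obtain ⟨h3, ⟨x, hx, hxb, hxl⟩, h5⟩ := lab_spec h1 (wv_notF D hS hne)
  generalize lab d β p0 (wv d r β p0 t S) = y at *
  obtain ⟨s, hs⟩ := nonempty_iff_ne_empty.2 hne
  have hs' := mem_Bl.1 (hS.subset hs)
  by_contra hy
  have a := h2 x hx y h3
  have hxS : (x ∈ S → β y = t) := fun h => by rw [← hxb]; exact (mem_Bl.1 (hS.subset h)).2
  simp only [hgt, hxb, hy, if_false] at a
  split_ifs at a <;> omega

end EW

end

noncomputable section
open Finset BigOperators
open scoped Classical
namespace EW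

variable (K : Type*) [Field K]

lemma lab_noninj {d r m : ℕ} {β : ℕ → ℕ} {p0 : ℕ → ℤ} (D : Dat d r m β p0) (j : ℕ)
    (hj : d = j + m) (G : Finset ℕ) (hG : G ⊆ VV d r \ FF d r β p0)
    (hR : ∀ a ∈ G, ∀ b ∈ G, RR d a b) (hc : G.card = j + 1) :
    ∃ u ∈ G, ∃ v ∈ G, u ≠ v ∧ lab d β p0 u = lab d β p0 v := by
  have hd := D.hd
  have hex : ∀ t, t < m → ∃ e, (e < d ∧ β e = t) ∧ ∀ u ∈ G, lab d β p0 u ≠ e := by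
    intro t ht
    obtain ⟨k, hk, hkt⟩ := D.surj t ht
    obtain ⟨e, he, hmin⟩ := exists_min_image (Bl d β t) (fun x => ∑ u ∈ G, (P d u x - p0 x))
      ⟨k, mem_Bl.2 ⟨hk, hkt⟩⟩
    refine ⟨e, mem_Bl.1 he, ?_⟩
    rintro u hu rfl
    have hu' := mem_sdiff.1 (hG hu)
    obtain ⟨h3, ⟨x, hx, hxb, hxl⟩, -⟩ := lab_spec hu'.1 hu'.2
    generalize lab d β p0 u = y at *
    have h := hmin x (mem_Bl.2 ⟨hx, hxb.trans (mem_Bl.1 he).2⟩)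
    refine absurd h (not_le.2 ?_)
    apply sum_lt_sum
    · intro v hv
      have := (RR_iff hd hu'.1 (mem_sdiff.1 (hG hv)).1).1 (hR u hu v hv) y h3 x hx
      omega
    · exact ⟨u, hu, hxl⟩
  choose! e he1 he2 using hex
  have hinj : Set.InjOn e (range m : Finset ℕ) := by
    intro a ha b hb hab
    rw [coe_range, Set.mem_Iio] at ha hb
    rw [← (he1 a ha).2, ← (he1 b hb).2, hab]
  have hsub : (range m).image e ⊆ range d := by
    intro x hx
    obtain ⟨t, ht, rfl⟩ := mem_image.1 hx
    exact mem_range.2 (he1 t (mem_range.1 ht)).1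
  have hcard : (range d \ (range m).image e).card = j := by
    rw [card_sdiff_of_subset hsub, card_image_of_injOn hinj]; simp; omega
  have := exists_ne_map_eq_of_card_lt_of_maps_to (s := G) (t := range d \ (range m).image e)
    (f := lab d β p0) (by omega) ?_
  · obtain ⟨u, hu, v, hv, h1, h2⟩ := this
    exact ⟨u, hu, v, hv, h1, h2⟩
  · intro u hu
    have hu0 : u ∈ G := hu
    have hu' := mem_sdiff.1 (hG hu0)
    have h3 := (lab_spec hu'.1 hu'.2).1
    rw [mem_coe, mem_sdiff, mem_range, mem_image]
    refine ⟨h3, ?_⟩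
    rintro ⟨t, ht, h⟩
    exact he2 t (mem_range.1 ht) u hu0 h.symm

lemma LL_sub {d r m : ℕ} {β : ℕ → ℕ} {p0 : ℕ → ℤ} (D : Dat d r m β p0) :
    LL (wv d r β p0) (Bl d β) m ⊆ VV d r \ FF d r β p0 := by
  intro v hv
  simp only [LL, mem_biUnion, mem_range, Lb, mem_image, mem_erase, mem_powerset] at hv
  obtain ⟨t, ht, T, hT, rfl⟩ := hv
  have hT' : T ⊂ Bl d β t := hT.2.2.ssubset_of_ne hT.1
  rw [mem_sdiff]
  exact ⟨(wv_spec D hT'.subset).1, wv_notF D hT' hT.2.1⟩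

lemma nonvan_W {d r m : ℕ} {β : ℕ → ℕ} {p0 : ℕ → ℤ} (D : Dat d r m β p0) (j : ℕ)
    (hj : d = j + m) (W : Finset ℕ) (hL : LL (wv d r β p0) (Bl d β) m ⊆ W)
    (hW : W ⊆ VV d r \ FF d r β p0) : redHdim K (cl (RR d) W) j ≠ 0 := by
  have hd := D.hd
  apply nonvan K (RR_refl d) (RR_symm d) (wv d r β p0) (Bl d β) m j _ _ _ _ _ (lab d β p0) _ W hL
  · intro s hs hc
    rw [mem_cl] at hs
    exact lab_noninj D j hj s (hs.1.trans hW) hs.2 hc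
  · intro t ht T T' hne hTT hT'
    obtain ⟨a1, a2⟩ := wv_spec D (hTT.trans hT'.subset)
    obtain ⟨b1, b2⟩ := wv_spec D hT'.subset
    rw [RR_iff hd a1 b1]
    intro k hk l hl
    rw [a2 k hk l hl, b2 k hk l hl]
    have c1 : k ∈ T → k ∈ T' := fun h => hTT h
    have c2 : l ∈ T → l ∈ T' := fun h => hTT h
    simp only [hgt]
    by_cases e1 : k ∈ T <;> by_cases e2 : l ∈ T <;> by_cases e3 : k ∈ T' <;>
      by_cases e4 : l ∈ T' <;> simp_all <;> split_ifs <;> omega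
  · intro t ht t' ht' T hT hne T' hT' hne'
    obtain ⟨a1, a2⟩ := wv_spec D hT'.subset
    obtain ⟨b1, b2⟩ := wv_spec D hT.subset
    rw [RR_iff hd a1 b1]
    intro k hk l hl
    rw [a2 k hk l hl, b2 k hk l hl]
    have key : ∀ x, hgt β t' T' x - hgt β t T x = 0 ∨ hgt β t' T' x - hgt β t T x = 1 := by
      intro x
      have c1 : x ∈ T → β x = t := fun h => (mem_Bl.1 (hT.subset h)).2
      have c2 : x ∈ T' → β x = t' := fun h => (mem_Bl.1 (hT'.subset h)).2
      simp only [hgt]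
      by_cases e1 : x ∈ T <;> by_cases e3 : x ∈ T'
      · have := c1 e1; have := c2 e3; omega
      · have := c1 e1; simp only [e1, e3, if_true, if_false]; split_ifs <;> omega
      · have := c2 e3; simp only [e1, e3, if_true, if_false]; split_ifs <;> omega
      · simp only [e1, e3, if_false]; split_ifs <;> omega
    have k1 := key k
    have k2 := key l
    omega
  · have := card_eq_sum_card_fiberwise (s := range d) (t := range m) (f := β) (by
      intro k hk; simpa using D.lt k (by simpa using hk))
    rw [card_range, hj] at this
    rw [this, hj]; rfl
  · intro s hs
    obtain ⟨k, hk, h⟩ := D.surj s hs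
    exact ⟨k, mem_Bl.2 ⟨hk, h⟩⟩
  · intro s _ s' _ hss
    rw [disjoint_left]
    intro k hk hk'
    exact hss ((mem_Bl.1 hk).2.symm.trans (mem_Bl.1 hk').2)
  · intro t _ T hT hne
    exact lab_wv D hT hne

lemma betti_ne {d r m : ℕ} {β : ℕ → ℕ} {p0 : ℕ → ℤ} (D : Dat d r m β p0) (j : ℕ)
    (hj : d = j + m) (i : ℕ) (h1 : ∑ t ∈ range m, (2 ^ (Bl d β t).card - 2) ≤ i + j)
    (h2 : i + d ≤ (VV d r).card) :
    bettiSR K (edgewise d r (simplexC d)) i (i + j) ≠ 0 := by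
  have hL := LL_sub D
  have c1 := card_LL (wv d r β p0) (Bl d β) m (by
    intro s hs
    obtain ⟨k, hk, h⟩ := D.surj s hs
    exact ⟨k, mem_Bl.2 ⟨hk, h⟩⟩)
  have c2 := card_FF D
  have hFs : FF d r β p0 ⊆ VV d r := filter_subset _ _
  have c3 := card_sdiff_of_subset hFs
  obtain ⟨W, hW1, hW2, hW3⟩ := exists_subsuperset_card_eq hL (n := i + j) (by omega) (by omega)
  have := nonvan_W K D j hj W hW1 hW2
  rw [bettiSR, vertexSet_edgewise]
  intro h0
  rw [sum_eq_zero_iff] at h0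
  have hWV := hW2.trans sdiff_subset
  have h3 := h0 W (mem_filter.2 ⟨mem_powerset.2 hWV, hW3⟩)
  rw [induced_eq hWV] at h3
  apply this
  rw [← h3]
  congr 1
  push_cast; ring

lemma betti_zero_flag {d r : ℕ} (i j : ℕ) (h : i < j) :
    bettiSR K (edgewise d r (simplexC d)) i (i + j) = 0 := by
  rw [bettiSR, vertexSet_edgewise]
  apply sum_eq_zero
  intro W hW
  rw [mem_filter, mem_powerset] at hW
  rw [induced_eq hW.1]
  apply redH_zero
  have := acyc_flag K (RR_refl d) (RR_symm d) W.card W j le_rfl (by omega)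
  have e : ((i + j : ℕ) : ℤ) - i = j := by push_cast; ring
  rw [e]; exact this

lemma betti_zero_depth {d r : ℕ} (hd : 1 ≤ d) (hr : d ≤ r) (i jj : ℕ)
    (h : (VV d r).card < i + d) :
    bettiSR K (edgewise d r (simplexC d)) i jj = 0 := by
  rw [bettiSR, vertexSet_edgewise]
  apply sum_eq_zero
  intro W hW
  rw [mem_filter, mem_powerset] at hW
  rw [induced_eq hW.1]
  apply redH_zero
  have := vanish_VV K d r hd hr (VV d r \ W) ((jj : ℤ) - i) (by
    have := card_sdiff_of_subset hW.1
    have := card_le_card hW.1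
    omega)
  rwa [Finset.sdiff_sdiff_eq_self hW.1] at this

end EW

end

noncomputable section
open Finset BigOperators
open scoped Classical
namespace EW

variable (K : Type*) [Field K]

/-- block starts -/
def st (q c t : ℕ) : ℕ := t * q + min t c

/-- block index -/
def bt (q c k : ℕ) : ℕ := Nat.findGreatest (fun t => st q c t ≤ k) k

lemma st_succ (q c t : ℕ) : st q c (t + 1) = st q c t + (q + if t < c then 1 else 0) := by
  simp only [st, add_mul, one_mul]
  split_ifs <;> omega

lemma st_lt {q : ℕ} (hq : 1 ≤ q) (c t : ℕ) : st q c t < st q c (t + 1) := by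
  rw [st_succ]; omega

lemma st_smono {q : ℕ} (hq : 1 ≤ q) (c : ℕ) : StrictMono (st q c) :=
  strictMono_nat_of_lt_succ (st_lt hq c)

lemma le_bt {q : ℕ} (hq : 1 ≤ q) (c t k : ℕ) : t ≤ bt q c k ↔ st q c t ≤ k := by
  constructor
  · intro h
    have h1 : st q c (bt q c k) ≤ k :=
      Nat.findGreatest_spec (P := fun t => st q c t ≤ k) (Nat.zero_le k) (by simp [st])
    exact ((st_smono hq c).monotone h).trans h1
  · intro h
    exact Nat.le_findGreatest (((st_smono hq c).le_apply).trans h) h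

/-- base heights -/
def pz (q c e k : ℕ) : ℤ := k - bt q c k + if 1 ≤ k then e else 0

lemma st_m {d m : ℕ} (hm : 1 ≤ m) : st (d / m) (d % m) m = d := by
  have h1 : d % m < m := Nat.mod_lt _ hm
  have h2 := Nat.div_add_mod d m
  rw [st, min_eq_right h1.le]; exact h2

lemma two_le_st {d m : ℕ} (hm : 1 ≤ m) (hmd : m < d) : 2 ≤ st (d / m) (d % m) 1 := by
  have h2 := Nat.div_add_mod d m
  have hq : 1 ≤ d / m := Nat.div_pos hmd.le hm
  simp only [st, one_mul]
  rcases Nat.lt_or_ge 1 (d / m) with h | h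
  · omega
  · have : d / m = 1 := by omega
    rw [this] at h2 ⊢
    have : 1 ≤ d % m := by omega
    omega

lemma dat {d r m : ℕ} (hm : 1 ≤ m) (hmd : m < d) (hr : d ≤ r) :
    Dat d r m (bt (d / m) (d % m)) (pz (d / m) (d % m) (r - 1 - (d - m))) := by
  have hq : 1 ≤ d / m := Nat.div_pos hmd.le hm
  have hst := st_m (d := d) hm
  have h2 := two_le_st hm hmd
  generalize d / m = q at *
  generalize d % m = c at *
  have g := le_bt hq c
  have mono : Monotone (bt q c) := by
    intro k l hkl
    rw [g]
    exact ((g _ _).1 le_rfl).trans hkl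
  have zero : bt q c 0 = 0 := by simp [bt]
  have hone : bt q c 1 = 0 := by
    by_contra h
    have := (g 1 1).1 (by omega)
    omega
  have step : ∀ k, bt q c (k + 1) ≤ bt q c k + 1 := by
    intro k
    by_contra h
    have h1 := (g (bt q c k + 1 + 1) (k + 1)).1 (by omega)
    have h2 := st_lt hq c (bt q c k + 1)
    have h3 := (g (bt q c k + 1) k).2 (by omega)
    omega
  have hlt : ∀ k < d, bt q c k < m := by
    intro k hk
    by_contra h
    have := (g m k).1 (by omega)
    omega
  refine ⟨by omega, mono, zero, step, hlt, ?_, ?_, ?_, ?_⟩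
  · intro t ht
    refine ⟨st q c t, ?_, ?_⟩
    · have := st_smono hq c ht; omega
    · apply le_antisymm
      · by_contra h
        have h1 := (g (t + 1) (st q c t)).1 (by omega)
        have h2 := st_lt hq c t
        omega
      · rw [g]
  · intro k hk hb
    simp only [pz, hb]
    push_cast
    split_ifs <;> omega
  · intro k hk hb
    have h1 := step k
    have h3 := mono (Nat.le_succ k)
    rw [Nat.succ_eq_add_one] at h3
    have h4 : bt q c (k + 1) = bt q c k + 1 := by omega
    have h5 : 1 ≤ k := by
      rcases k with _ | k
      · simp only [zero_add] at hb; omega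
      · omega
    simp only [pz, h4]
    rw [if_pos h5, if_pos (by omega)]
    push_cast; ring
  · have h1 : bt q c (d - 1) = m - 1 := by
      apply le_antisymm
      · have := hlt (d - 1) (by omega); omega
      · rw [g]
        have := st_smono hq c (show m - 1 < m by omega)
        omega
    simp only [pz, h1, zero]
    rw [if_pos (by omega), if_neg (by omega)]
    push_cast [Nat.cast_sub hm]
    omega

lemma card_Bl {d m : ℕ} (hm : 1 ≤ m) (hmd : m < d) (t : ℕ) (ht : t < m) :
    (Bl d (bt (d / m) (d % m)) t).card = d / m + if t < d % m then 1 else 0 := by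
  have hq : 1 ≤ d / m := Nat.div_pos hmd.le hm
  have hst := st_m (d := d) hm
  generalize d / m = q at *
  generalize d % m = c at *
  have : Bl d (bt q c) t = Ico (st q c t) (st q c (t + 1)) := by
    ext k
    rw [mem_Bl, mem_Ico, ← le_bt hq]
    have h1 := le_bt hq c (t + 1) k
    have h2 := (st_smono hq c).monotone (show t + 1 ≤ m by omega)
    constructor
    · rintro ⟨h, h'⟩
      refine ⟨by omega, ?_⟩
      by_contra hc
      have := h1.2 (by omega)
      omega
    · rintro ⟨h, h'⟩
      refine ⟨by omega, ?_⟩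
      by_contra hc
      have := h1.1 (by omega)
      omega
  rw [this, Nat.card_Ico, st_succ]
  omega

lemma sum_Bl {d m : ℕ} (hm : 1 ≤ m) (hmd : m < d) :
    ∑ t ∈ range m, (2 ^ (Bl d (bt (d / m) (d % m)) t).card - 2) + 2 * m =
      2 ^ (d / m) * (d % m + m) := by
  have hq : 1 ≤ d / m := Nat.div_pos hmd.le hm
  have hc : d % m < m := Nat.mod_lt _ hm
  have h1 : ∀ t ∈ range m, (2 ^ (Bl d (bt (d / m) (d % m)) t).card - 2) + 2 =
      2 ^ (d / m) + if t < d % m then 2 ^ (d / m) else 0 := by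
    intro t ht
    rw [card_Bl hm hmd t (mem_range.1 ht)]
    have h2 : 2 ^ 1 ≤ 2 ^ (d / m) := Nat.pow_le_pow_right (by omega) hq
    split_ifs
    · rw [pow_add]; omega
    · rw [add_zero]; omega
  have h2 := sum_congr rfl h1
  rw [sum_add_distrib, sum_add_distrib, ← sum_filter] at h2
  have h3 : (range m).filter (fun t => t < d % m) = range (d % m) := by
    ext t; simp only [mem_filter, mem_range]; omega
  rw [h3] at h2
  simp only [sum_const, card_range, smul_eq_mul] at h2
  rw [mul_comm 2 m, h2]; ring

lemma betti_ne' {d r : ℕ} (hr : d ≤ r) (j : ℕ) (hj1 : 1 ≤ j) (hj2 : j < d) (i : ℕ)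
    (h1 : 2 ^ (d / (d - j)) * (d % (d - j) + (d - j)) ≤ i + j + 2 * (d - j))
    (h2 : i + d ≤ (VV d r).card) :
    bettiSR K (edgewise d r (simplexC d)) i (i + j) ≠ 0 := by
  have hm : 1 ≤ d - j := by omega
  have hmd : d - j < d := by omega
  have := sum_Bl hm hmd
  exact betti_ne K (dat hm hmd hr) j (by omega) i (by omega) h2

lemma betti_one {r : ℕ} : bettiSR K (edgewise 1 r (simplexC 1)) 0 (0 + 0) ≠ 0 := by
  rw [bettiSR, vertexSet_edgewise]
  intro h0
  rw [sum_eq_zero_iff] at h0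
  have h3 := h0 ∅ (by simp)
  rw [induced_eq (by simp)] at h3
  refine nonvan K (RR_refl 1) (RR_symm 1) (fun _ _ => 0) (fun _ => ∅) 0 0 (by simp) (by simp)
    (by simp) (by simp) (by simp) id (by simp) ∅ (by simp [LL]) ?_ h3
  intro s hs hc
  have : s = ∅ := by simpa using (mem_cl.1 hs).1
  subst this
  simp at hc

lemma case_i {d j i : ℕ} (hj1 : 1 ≤ j) (hj : 2 * j ≤ d) (hi : j ≤ i) :
    2 ^ (d / (d - j)) * (d % (d - j) + (d - j)) ≤ i + j + 2 * (d - j) := by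
  rcases Nat.lt_or_ge (2 * j) d with h | h
  · have h1 : d = j + (d - j) * 1 := by omega
    have h2 : d / (d - j) = 1 := Nat.div_eq_of_lt_le (by omega) (by omega)
    have h3 : d % (d - j) = j := by
      have := Nat.div_add_mod d (d - j)
      rw [h2] at this; omega
    rw [h2, h3]; omega
  · have hd : d = 2 * j := by omega
    have e : d - j = j := by omega
    rw [e, hd, Nat.mul_div_cancel _ (by omega), Nat.mul_mod_left]
    omega

lemma case_ii {d j i : ℕ} (hj1 : d < 2 * j) (hj : j < d) (hi : mj d j ≤ i) :
    2 ^ (d / (d - j)) * (d % (d - j) + (d - j)) ≤ i + j + 2 * (d - j) := by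
  have h1 : d = (2 * j - d) + 2 * (d - j) := by omega
  have h2 : d / (d - j) = (2 * j - d) / (d - j) + 2 := by
    conv_lhs => lhs; rw [h1]
    rw [Nat.add_mul_div_right _ _ (by omega)]
  have h3 : d % (d - j) = (2 * j - d) % (d - j) := by
    conv_lhs => lhs; rw [h1]
    rw [Nat.add_mul_mod_self_right]
  rw [mj, if_neg (by omega)] at hi
  rw [h2, h3]
  omega

lemma pdim_eq {d r : ℕ} (hd : 1 ≤ d) (hr : d ≤ r) (hN : d ≤ (VV d r).card)
    (hN2 : 2 ≤ d → d + 1 ≤ (VV d r).card) :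
    pdimSR K (edgewise d r (simplexC d)) = (VV d r).card - d := by
  have hnv : nverts (edgewise d r (simplexC d)) = (VV d r).card := by
    rw [nverts, vertexSet_edgewise]
  apply le_antisymm
  · apply Finset.sup_le
    intro i hi
    simp only [mem_filter] at hi
    obtain ⟨jj, _, h⟩ := hi.2
    by_contra hc
    simp only [id] at hc
    exact h (betti_zero_depth K hd hr i jj (by omega))
  · rcases Nat.lt_or_ge 1 d with h | h
    · apply Finset.le_sup (f := id)
      have := hN2 h
      simp only [mem_filter, hnv]
      rw [mem_range]
      refine ⟨by omega, (VV d r).card - d + 1, by rw [mem_range]; omega, ?_⟩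
      exact betti_ne' K hr 1 le_rfl h _ (case_i le_rfl h (by omega)) (by omega)
    · have : d = 1 := by omega
      subst this
      have := card_VV 1 r le_rfl
      simp at this
      omega

lemma N_bound {d r : ℕ} (hd : 2 ≤ d) (hr : d ≤ r) : d + 1 ≤ (VV d r).card := by
  rw [card_VV d r (by omega)]
  obtain ⟨e, rfl⟩ := Nat.exists_eq_add_of_le hd
  have h1 : Nat.choose (e + 3) (e + 1) ≤ Nat.choose (r + (2 + e) - 1) (2 + e - 1) := by
    have : 2 + e - 1 = e + 1 := by omega
    rw [this]
    exact Nat.choose_le_choose _ (by omega)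
  refine le_trans ?_ h1
  rw [← Nat.choose_symm (by omega), show e + 3 - (e + 1) = 2 by omega, Nat.choose_two_right,
    Nat.le_div_iff_mul_le (by norm_num)]
  rw [show e + 3 - 1 = e + 2 by omega]
  nlinarith

end EW

end

/-- Vanishing and nonvanishing of the Betti numbers of
`K[Δ_{d-1}^{⟨r⟩}]` for `r ≥ d`, together with
`pdim(K[Δ_{d-1}^{⟨r⟩}]) = C(r+d-1,d-1) - d`. -/
theorem statement_17 (K : Type*) [Field K] (d r : ℕ) (hd : 1 ≤ d) (hr : d ≤ r) :
    (∀ j : ℕ, 1 ≤ j → 2 * j ≤ d →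
      (∀ i : ℕ, i ≤ j - 1 → bettiSR K (edgewise d r (simplexC d)) i (i + j) = 0) ∧
      (∀ i : ℕ, j ≤ i → i ≤ pdimSR K (edgewise d r (simplexC d)) →
        bettiSR K (edgewise d r (simplexC d)) i (i + j) ≠ 0)) ∧
    (∀ j : ℕ, d < 2 * j → j ≤ d - 2 →
      (∀ i : ℕ, i ≤ j - 1 → bettiSR K (edgewise d r (simplexC d)) i (i + j) = 0) ∧
      (∀ i : ℕ, mj d j ≤ i → i ≤ pdimSR K (edgewise d r (simplexC d)) →
        bettiSR K (edgewise d r (simplexC d)) i (i + j) ≠ 0)) ∧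
    (∀ i : ℕ, 2 ^ d - 1 - d ≤ i → i ≤ pdimSR K (edgewise d r (simplexC d)) →
      bettiSR K (edgewise d r (simplexC d)) i (i + (d - 1)) ≠ 0) ∧
    pdimSR K (edgewise d r (simplexC d)) = Nat.choose (r + d - 1) (d - 1) - d := by
  have hN : d ≤ (EW.VV d r).card := by
    rcases Nat.lt_or_ge 1 d with h | h
    · have := EW.N_bound h hr; omega
    · have h1 : d = 1 := by omega
      subst h1
      rw [EW.card_VV 1 r le_rfl]; simp
  have hp := EW.pdim_eq K hd hr hN (fun h => EW.N_bound h hr)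
  refine ⟨?_, ?_, ?_, ?_⟩
  · intro j hj1 hj2
    refine ⟨fun i hi => EW.betti_zero_flag K i j (by omega), fun i hi1 hi2 => ?_⟩
    rw [hp] at hi2
    exact EW.betti_ne' K hr j hj1 (by omega) i (EW.case_i hj1 hj2 hi1) (by omega)
  · intro j hj1 hj2
    refine ⟨fun i hi => EW.betti_zero_flag K i j (by omega), fun i hi1 hi2 => ?_⟩
    rw [hp] at hi2
    exact EW.betti_ne' K hr j (by omega) (by omega) i (EW.case_ii hj1 (by omega) hi1) (by omega)
  · intro i hi1 hi2
    rw [hp] at hi2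
    rcases Nat.lt_or_ge 1 d with h | h
    · refine EW.betti_ne' K hr (d - 1) (by omega) (by omega) i ?_ (by omega)
      rw [show d - (d - 1) = 1 by omega, Nat.div_one, Nat.mod_one]
      omega
    · have h1 : d = 1 := by omega
      subst h1
      have := EW.card_VV 1 r le_rfl
      simp at this
      have h0 : i = 0 := by omega
      subst h0
      exact EW.betti_one K
  · rw [hp, EW.card_VV d r hd]
end

section
/- Let d ≥ 2, let Δ be a (d-1)-dimensional simplicial complex, and let r ≥ 2d. Then β_{i,i+j}(K[Δ^{⟨r⟩}]) ≠ 0 in each of the following cases, where B := C(2d-1, d-1) - d + pdim(K[Δ^{⟨r⟩}]) + depth(K[Δ]) - C(3d-1, d-1): (i) 1 ≤ j ≤ d/2 and j ≤ i ≤ B; (ii) d/2 ≤ j ≤ d-2 and m_j(d) ≤ i ≤ B; (iii) j = d-1 and 2^d - d - 1 ≤ i ≤ B. -/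
open Finset BigOperators

section HomPart
open scoped Classical
open Finset

variable {K : Type*} [Field K]

lemma mem_facesSpan (Γ : SC) (m : ℤ) (z : Finset ℕ →₀ K) :
    z ∈ facesSpan K Γ m ↔ ∀ s, z s ≠ 0 → s ∈ Γ ∧ (s.card : ℤ) = m := by
  unfold facesSpan
  rw [← Finsupp.supported_eq_span_single, Finsupp.mem_supported]
  constructor
  · intro h s hs
    exact h (by simpa using hs)
  · intro h s hs
    exact h s (by simpa using hs)

lemma bdry_single (s : Finset ℕ) (a : K) :
    bdry K (Finsupp.single s a) = a • bdryFace K s := by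
  simp [bdry]

lemma bdry_eq_sum (z : Finset ℕ →₀ K) :
    bdry K z = ∑ s ∈ z.support, z s • bdryFace K s := by
  conv_lhs => rw [← Finsupp.sum_single z]
  rw [Finsupp.sum, map_sum]
  simp [bdry_single]

lemma bdryFace_apply_ne (s t : Finset ℕ) (h : bdryFace K s t ≠ 0) :
    ∃ v ∈ s, t = s.erase v := by
  unfold bdryFace at h
  rw [Finsupp.finsetSum_apply] at h
  obtain ⟨v, hv, hne⟩ := Finset.exists_ne_zero_of_sum_ne_zero h
  refine ⟨v, hv, ?_⟩
  by_contra hc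
  apply hne
  rw [Finsupp.smul_apply, Finsupp.single_apply, if_neg (fun h => hc h.symm)]
  simp

lemma bdry_apply_ne (z : Finset ℕ →₀ K) (t : Finset ℕ) (h : bdry K z t ≠ 0) :
    ∃ s, z s ≠ 0 ∧ ∃ v ∈ s, t = s.erase v := by
  rw [bdry_eq_sum, Finsupp.finsetSum_apply] at h
  obtain ⟨s, hs, hne⟩ := Finset.exists_ne_zero_of_sum_ne_zero h
  refine ⟨s, by simpa using hs, bdryFace_apply_ne (K := K) s t ?_⟩
  intro h0
  apply hne
  simp [h0]

lemma bdry_bdryFace (s : Finset ℕ) : bdry K (bdryFace K s) = 0 := by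
  unfold bdryFace
  rw [map_sum]
  simp only [map_smul, bdry_single, one_smul]
  unfold bdryFace
  simp only [Finset.smul_sum, smul_smul]
  rw [Finset.sum_sigma']
  refine Finset.sum_involution (fun p _ => ⟨p.2, p.1⟩) ?_ ?_ ?_ ?_
  · rintro ⟨v, w⟩ h
    simp only [mem_sigma, mem_erase] at h
    obtain ⟨hv, hwv, hw⟩ := h
    have key : ∀ v w : ℕ, v ∈ s → w ∈ s → v < w →
        (-1 : K) ^ (#{u ∈ s | u < v}) * (-1 : K) ^ (#{u ∈ s.erase v | u < w}) =
        - ((-1 : K) ^ (#{u ∈ s | u < w}) * (-1 : K) ^ (#{u ∈ s.erase w | u < v})) := by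
      intro v w hv hw hvw
      have e1 : (s.erase w).filter (fun u => u < v) = s.filter (fun u => u < v) := by
        ext u; simp only [mem_filter, mem_erase]; constructor
        · rintro ⟨⟨_, h⟩, h'⟩; exact ⟨h, h'⟩
        · rintro ⟨h, h'⟩; exact ⟨⟨by omega, h⟩, h'⟩
      have e2 : (s.erase v).filter (fun u => u < w) = (s.filter (fun u => u < w)).erase v := by
        ext u; simp only [mem_filter, mem_erase]; tauto
      have e3 : #((s.filter (fun u => u < w)).erase v) + 1 = #(s.filter (fun u => u < w)) :=
        Finset.card_erase_add_one (by simp [hv, hvw])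
      rw [e1, e2, ← e3, pow_succ]
      ring
    have e : (s.erase v).erase w = (s.erase w).erase v := Finset.erase_right_comm
    simp only [e]
    rcases lt_or_gt_of_ne hwv with h | h
    · rw [← add_smul, key w v hw hv h]; simp
    · rw [← add_smul, key v w hv hw h]; simp
  · rintro ⟨v, w⟩ h _ heq
    simp only [mem_sigma, mem_erase] at h
    simp only [Sigma.mk.injEq] at heq
    exact h.2.1 heq.1
  · rintro ⟨v, w⟩ h
    simp only [mem_sigma, mem_erase] at h ⊢
    exact ⟨h.2.2, fun h' => h.2.1 h'.symm, h.1⟩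
  · rintro ⟨v, w⟩ h
    rfl

lemma bdry_bdry (z : Finset ℕ →₀ K) : bdry K (bdry K z) = 0 := by
  rw [bdry_eq_sum z, map_sum]
  simp [bdry_bdryFace]

lemma facesSpan_finite (Γ : SC) (m : ℤ) : FiniteDimensional K (facesSpan K Γ m) := by
  apply FiniteDimensional.span_of_finite
  apply Set.Finite.image
  exact (Γ.finite_toSet).subset (fun s hs => hs.1)

lemma redHdim_ne_zero_iff (Γ : SC) (m : ℤ) :
    redHdim K Γ m ≠ 0 ↔ ∃ z ∈ cyclesOn K Γ m, z ∉ boundariesOn K Γ m := by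
  have := facesSpan_finite (K := K) Γ m
  have fd : FiniteDimensional K (cyclesOn K Γ m) :=
    Submodule.finiteDimensional_of_le (inf_le_left : cyclesOn K Γ m ≤ facesSpan K Γ m)
  unfold redHdim
  constructor
  · intro h
    by_contra hc
    push Not at hc
    have : boundariesOn K Γ m ⊓ cyclesOn K Γ m = cyclesOn K Γ m :=
      inf_eq_right.mpr (fun z hz => hc z hz)
    rw [this] at h
    simp at h
  · rintro ⟨z, hz, hzn⟩
    have : boundariesOn K Γ m ⊓ cyclesOn K Γ m < cyclesOn K Γ m :=
      lt_of_le_of_ne inf_le_right (fun he => hzn ((inf_eq_right.mp he) hz))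
    have := Submodule.finrank_lt_finrank_of_lt this
    omega

/-- exactness modulo faces not containing `S`, in the complex with `T` deleted -/
def ExactMod (K : Type*) [Field K] (Δ : SC) (S T : Finset ℕ) (k : ℤ) : Prop :=
  ∀ z : Finset ℕ →₀ K, (∀ s, z s ≠ 0 → s ∈ Δ ∧ (s.card : ℤ) = k ∧ Disjoint s T) →
    (∀ s, bdry K z s ≠ 0 → ¬ S ⊆ s) →
    ∃ w : Finset ℕ →₀ K, (∀ s, w s ≠ 0 → s ∈ Δ ∧ (s.card : ℤ) = k + 1 ∧ Disjoint s T) ∧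
      ∀ s, (z - bdry K w) s ≠ 0 → ¬ S ⊆ s

lemma exactMod_step (Δ : SC) (hC : IsComplex Δ) (S T : Finset ℕ) (x : ℕ) (k : ℤ)
    (h1 : ExactMod K Δ S T (k + 1)) (h2 : ExactMod K Δ S (insert x T) k) :
    ExactMod K Δ (insert x S) T (k + 1) := by
  intro z hz hbz
  set y := (bdry K z).filter (fun s => S ⊆ s) with hy
  have hyne : ∀ s, y s ≠ 0 → S ⊆ s ∧ bdry K z s ≠ 0 := by
    intro s hs
    rw [hy, Finsupp.filter_apply] at hs
    split_ifs at hs with h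
    · exact ⟨h, hs⟩
    · exact absurd rfl hs
  have hyS : ∀ s, (bdry K z - y) s ≠ 0 → ¬ S ⊆ s := by
    intro s hs hSs
    apply hs
    rw [Finsupp.sub_apply, hy, Finsupp.filter_apply, if_pos hSs, sub_self]
  obtain ⟨w, hw, hwy⟩ := h2 y (by
      intro s hs
      obtain ⟨hSs, hbs⟩ := hyne s hs
      obtain ⟨u, hu, v, hv, rfl⟩ := bdry_apply_ne z s hbs
      obtain ⟨huΔ, huc, huT⟩ := hz u hu
      refine ⟨hC u huΔ _ (Finset.erase_subset _ _), ?_, ?_⟩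
      · rw [Finset.card_erase_of_mem hv]
        have : 0 < u.card := Finset.card_pos.mpr ⟨v, hv⟩
        omega
      · rw [Finset.disjoint_insert_right]
        refine ⟨?_, Finset.disjoint_of_subset_left (Finset.erase_subset _ _) huT⟩
        intro hx
        exact hbz _ hbs (Finset.insert_subset hx hSs)) (by
      intro s hs hSs
      have e : bdry K y = - bdry K (bdry K z - y) := by
        rw [map_sub, bdry_bdry]; simp
      rw [e] at hs
      obtain ⟨u, hu, v, hv, rfl⟩ := bdry_apply_ne (bdry K z - y) s (fun h => hs (by
        rw [Finsupp.neg_apply, h, neg_zero]))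
      exact hyS u hu (hSs.trans (Finset.erase_subset _ _)))
  obtain ⟨u, hu, huz⟩ := h1 (z - w) (by
      intro s hs
      by_cases hzs : z s = 0
      · have hws : w s ≠ 0 := by
          intro h; apply hs; simp [hzs, h]
        obtain ⟨a, b, c⟩ := hw s hws
        exact ⟨a, b, Finset.disjoint_of_subset_right (Finset.subset_insert _ _) c⟩
      · exact hz s hzs) (by
      intro s hs hSs
      have a1 : (bdry K z - y) s = 0 := by
        by_contra h; exact hyS s h hSs
      have a2 : (y - bdry K w) s = 0 := by
        by_contra h; exact hwy s h hSs
      apply hs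
      rw [map_sub]
      have : bdry K z - bdry K w = (bdry K z - y) + (y - bdry K w) := by abel
      rw [this, Finsupp.add_apply, a1, a2, add_zero])
  refine ⟨u, hu, ?_⟩
  intro s hs hxs
  have hxS : S ⊆ s := (Finset.subset_insert _ _).trans hxs
  have a1 : (z - w - bdry K u) s = 0 := by
    by_contra h; exact huz s h hxS
  have a2 : w s = 0 := by
    by_contra h
    have := (hw s h).2.2
    rw [Finset.disjoint_insert_right] at this
    exact this.1 (hxs (Finset.mem_insert_self _ _))
  apply hs
  have : z - bdry K u = (z - w - bdry K u) + w := by abel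
  rw [this, Finsupp.add_apply, a1, a2, add_zero]

lemma exactMod_all (Δ : SC) (hC : IsComplex Δ) (F : Finset ℕ)
    (h0 : ∀ T ⊆ F, ExactMod K Δ ∅ T ((F.card : ℤ) - T.card)) (S : Finset ℕ) :
    S ⊆ F → ∀ T ⊆ F, Disjoint S T → ExactMod K Δ S T ((F.card : ℤ) - T.card) := by
  induction S using Finset.induction_on with
  | empty => intro _ T hT _; exact h0 T hT
  | insert x S hx ih =>
    intro hS T hT hd
    rw [Finset.disjoint_insert_left] at hd
    have hSF := (Finset.subset_insert x S).trans hS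
    have hxF : x ∈ F := hS (Finset.mem_insert_self _ _)
    have e : (F.card : ℤ) - T.card = ((F.card : ℤ) - (insert x T).card) + 1 := by
      rw [Finset.card_insert_of_notMem hd.1]; push_cast; ring
    rw [e]
    apply exactMod_step Δ hC
    · rw [← e]; exact ih hSF T hT hd.2
    · apply ih hSF _ (Finset.insert_subset hxF hT)
      rw [Finset.disjoint_insert_right]
      exact ⟨hx, hd.2⟩

lemma exists_betti (Δ : SC) (hC : IsComplex Δ) (F : Finset ℕ) (hF : F ∈ Δ)
    (hmax : ∀ s ∈ Δ, s.card ≤ F.card) :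
    ∃ T ⊆ F, redHdim K (inducedSC Δ (vertexSet Δ \ T)) ((F.card : ℤ) - T.card) ≠ 0 := by
  by_contra hc
  push Not at hc
  have h0 : ∀ T ⊆ F, ExactMod K Δ ∅ T ((F.card : ℤ) - T.card) := by
    intro T hT z hz hbz
    have hcT : ¬ redHdim K (inducedSC Δ (vertexSet Δ \ T)) ((F.card : ℤ) - T.card) ≠ 0 := by
      simp [hc T hT]
    rw [redHdim_ne_zero_iff] at hcT
    push Not at hcT
    have hb : bdry K z = 0 := by
      ext s
      by_contra h
      exact hbz s h (Finset.empty_subset _)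
    have := hcT z ⟨(mem_facesSpan _ _ _).2 (fun s hs => by
      obtain ⟨a, b, c⟩ := hz s hs
      refine ⟨?_, b⟩
      unfold inducedSC
      rw [Finset.mem_filter]
      refine ⟨a, ?_⟩
      rw [Finset.subset_sdiff]
      exact ⟨Finset.le_sup (f := id) a, c⟩), hb⟩
    obtain ⟨w, hw, hwz⟩ := this
    refine ⟨w, ?_, ?_⟩
    · intro s hs
      obtain ⟨a, b⟩ := (mem_facesSpan _ _ _).1 hw s hs
      unfold inducedSC at a
      rw [Finset.mem_filter, Finset.subset_sdiff] at a
      exact ⟨a.1, b, a.2.2⟩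
    · intro s hs
      exfalso; apply hs
      simp [hwz]
  have := exactMod_all Δ hC F h0 F subset_rfl ∅ (Finset.empty_subset _) (Finset.disjoint_empty_right _)
  obtain ⟨w, hw, hwz⟩ := this (Finsupp.single F 1) (by
    intro s hs
    rw [Finsupp.single_apply] at hs
    split_ifs at hs with h
    · subst h; simp [hF]
    · exact absurd rfl hs) (by
    intro s hs hFs
    rw [bdry_single, one_smul] at hs
    obtain ⟨v, hv, rfl⟩ := bdryFace_apply_ne _ _ hs
    have := hFs hv
    simp at this)
  have hw0 : w = 0 := by
    ext s
    by_contra h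
    obtain ⟨a, b, _⟩ := hw s h
    have := hmax s a
    simp at b
    omega
  apply hwz F _ subset_rfl
  simp [hw0]

lemma betti_ne_zero (Γ : SC) (i j : ℕ) (W : Finset ℕ) (hW : W ⊆ vertexSet Γ) (hc : W.card = j)
    (h : redHdim K (inducedSC Γ W) ((j : ℤ) - i) ≠ 0) : bettiSR K Γ i j ≠ 0 := by
  unfold bettiSR
  intro h0
  rw [Finset.sum_eq_zero_iff] at h0
  exact h (h0 W (by simp [hW, hc]))

lemma depth_le (Δ : SC) (hC : IsComplex Δ) (F : Finset ℕ) (hF : F ∈ Δ)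
    (hmax : ∀ s ∈ Δ, s.card ≤ F.card) : depthSR K Δ ≤ F.card := by
  obtain ⟨T, hT, h⟩ := exists_betti (K := K) Δ hC F hF hmax
  have hFV : F ⊆ vertexSet Δ := Finset.le_sup (f := id) hF
  have h1 := Finset.card_le_card hFV
  have h2 := Finset.card_le_card hT
  have hc : (vertexSet Δ \ T).card = (vertexSet Δ).card - T.card :=
    Finset.card_sdiff_of_subset (hT.trans hFV)
  have hb : bettiSR K Δ ((vertexSet Δ).card - F.card) ((vertexSet Δ).card - T.card) ≠ 0 := by
    apply betti_ne_zero Δ _ _ (vertexSet Δ \ T) Finset.sdiff_subset hc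
    convert h using 2
    omega
  unfold depthSR
  have : (vertexSet Δ).card - F.card ≤ pdimSR K Δ := by
    unfold pdimSR
    refine Finset.le_sup (f := id) (b := (vertexSet Δ).card - F.card) ?_
    refine (@Finset.mem_filter _ _ (_) _ _).2 ⟨by rw [Finset.mem_range]; unfold nverts; omega, (vertexSet Δ).card - T.card, ?_, hb⟩
    rw [Finset.mem_range]; unfold nverts; omega
  unfold nverts
  omega

lemma pdim_lt (Γ : SC) (hC : IsComplex Γ) (hne : (vertexSet Γ).Nonempty) :
    pdimSR K Γ < nverts Γ := by
  unfold pdimSR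
  rw [Finset.sup_lt_iff (by unfold nverts; simpa using hne)]
  intro i hi
  replace hi := (@Finset.mem_filter _ _ (_) _ _).1 hi
  rw [Finset.mem_range] at hi
  obtain ⟨hi, j, _, hb⟩ := hi
  by_contra hlt
  have hin : i = nverts Γ := by simp at hlt; omega
  apply hb
  unfold bettiSR
  apply Finset.sum_eq_zero
  intro W hW
  rw [Finset.mem_filter, Finset.mem_powerset] at hW
  obtain ⟨hWV, hWc⟩ := hW
  by_contra hr
  rw [← ne_eq, redHdim_ne_zero_iff] at hr
  obtain ⟨z, hz, hzb⟩ := hr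
  have hz1 := (mem_facesSpan _ _ _).1 hz.1
  have hle := Finset.card_le_card hWV
  apply hzb
  by_cases hz0 : z = 0
  · rw [hz0]; exact Submodule.zero_mem _
  obtain ⟨s, hs⟩ := Finsupp.ne_iff.1 hz0
  obtain ⟨a, b⟩ := hz1 s (by simpa using hs)
  have hWV' : W = vertexSet Γ := by
    apply Finset.eq_of_subset_of_card_le hWV
    unfold nverts at hin; omega
  have hji : (j : ℤ) - i = 0 := by
    subst hWV'; unfold nverts at hin; omega
  obtain ⟨v, hv⟩ := hne
  have hv' := hv
  unfold vertexSet at hv'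
  rw [Finset.mem_sup] at hv'
  obtain ⟨t, ht, hvt⟩ := hv'
  have hvΓ : {v} ∈ Γ := hC t ht _ (by simpa using hvt)
  refine ⟨Finsupp.single {v} (z ∅), (mem_facesSpan _ _ _).2 ?_, ?_⟩
  · intro s hs
    rw [Finsupp.single_apply] at hs
    split_ifs at hs with h
    · subst h
      refine ⟨?_, by simp [hji]⟩
      unfold inducedSC
      rw [Finset.mem_filter]
      exact ⟨hvΓ, by rw [hWV']; simpa using hv⟩
    · exact absurd rfl hs
  · rw [bdry_single]
    unfold bdryFace
    ext s
    simp
    by_cases hse : s = ∅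
    · subst hse
      have : ({w ∈ ({v} : Finset ℕ) | w < v}) = ∅ := by
        ext w; simp; omega
      simp [this]
    · rw [Finsupp.single_apply, if_neg (fun h => hse h.symm)]
      by_contra hh
      have hzs : z s ≠ 0 := fun h => hh (by simp [h])
      have := (hz1 s hzs).2
      rw [hji] at this
      exact hse (by simpa using this)

/-- maximal face criterion -/
lemma redH_of_maximal (Γ : SC) (m : ℕ) (z : Finset ℕ →₀ K)
    (hz : ∀ s, z s ≠ 0 → s ∈ Γ ∧ s.card = m) (hb : bdry K z = 0)
    (g : Finset ℕ) (hg : z g ≠ 0) (hmax : ∀ h ∈ Γ, g ⊂ h → False) :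
    redHdim K Γ (m : ℤ) ≠ 0 := by
  rw [redHdim_ne_zero_iff]
  refine ⟨z, ⟨(mem_facesSpan _ _ _).2 (fun s hs => ⟨(hz s hs).1, by exact_mod_cast (hz s hs).2⟩), hb⟩, ?_⟩
  rintro ⟨w, hw, hwz⟩
  rw [← hwz] at hg
  obtain ⟨s, hs, v, hv, he⟩ := bdry_apply_ne w g hg
  exact hmax s ((mem_facesSpan _ _ _).1 hw s hs).1 (he ▸ Finset.erase_ssubset hv)

/-- inversions -/
def invs (L : Finset ℕ) (f : ℕ → ℕ) : ℕ :=
  #{p ∈ L ×ˢ L | p.1 < p.2 ∧ f p.2 < f p.1}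

noncomputable def orSimp (K : Type*) [Field K] (L : Finset ℕ) (f : ℕ → ℕ) : Finset ℕ →₀ K :=
  Finsupp.single (L.image f) ((-1 : K) ^ invs L f)

lemma invs_erase (L : Finset ℕ) (f : ℕ → ℕ) (l : ℕ) (hl : l ∈ L) :
    invs L f = invs (L.erase l) f + #{m ∈ L | m < l ∧ f l < f m} + #{m ∈ L | l < m ∧ f m < f l} := by
  unfold invs
  have e1 : #{m ∈ L | m < l ∧ f l < f m} = #(({m ∈ L | m < l ∧ f l < f m}).image (fun m => (m, l))) :=
    (Finset.card_image_of_injective _ (fun a b h => by simpa using h)).symm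
  have e2 : #{m ∈ L | l < m ∧ f m < f l} = #(({m ∈ L | l < m ∧ f m < f l}).image (fun m => (l, m))) :=
    (Finset.card_image_of_injective _ (fun a b h => by simpa using h)).symm
  rw [e1, e2, ← Finset.card_union_of_disjoint, ← Finset.card_union_of_disjoint]
  · congr 1
    ext ⟨a, b⟩
    simp only [mem_filter, mem_product, mem_union, mem_erase, mem_image, Prod.mk.injEq]
    constructor
    · rintro ⟨⟨ha, hb⟩, h1, h2⟩
      by_cases hbl : b = l
      · subst hbl; left; right; exact ⟨a, ⟨ha, h1, h2⟩, rfl, rfl⟩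
      · by_cases hal : a = l
        · subst hal; right; exact ⟨b, ⟨hb, h1, h2⟩, rfl, rfl⟩
        · left; left; exact ⟨⟨⟨hal, ha⟩, hbl, hb⟩, h1, h2⟩
    · rintro ((⟨⟨⟨_, ha⟩, _, hb⟩, h⟩ | ⟨m, ⟨hm, h⟩, rfl, rfl⟩) | ⟨m, ⟨hm, h⟩, rfl, rfl⟩)
      · exact ⟨⟨ha, hb⟩, h⟩
      · exact ⟨⟨hm, hl⟩, h⟩
      · exact ⟨⟨hl, hm⟩, h⟩
  · rw [Finset.disjoint_left]
    rintro ⟨a, b⟩ h1 h2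
    simp only [mem_filter, mem_product, mem_union, mem_erase, mem_image, Prod.mk.injEq] at h1 h2
    obtain ⟨m, ⟨_, h3, _⟩, rfl, rfl⟩ := h2
    rcases h1 with h1 | ⟨m', ⟨_, h4, _⟩, rfl, h5⟩
    · exact h1.1.1.1 rfl
    · omega
  · rw [Finset.disjoint_left]
    rintro ⟨a, b⟩ h1 h2
    simp only [mem_filter, mem_product, mem_erase, mem_image, Prod.mk.injEq] at h1 h2
    obtain ⟨m, _, rfl, rfl⟩ := h2
    exact h1.1.2.1 rfl

lemma bdry_orSimp (L : Finset ℕ) (f : ℕ → ℕ) (hf : Set.InjOn f L) :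
    bdry K (orSimp K L f) =
      ∑ l ∈ L, (-1 : K) ^ #{m ∈ L | m < l} • orSimp K (L.erase l) f := by
  unfold orSimp
  rw [bdry_single]
  unfold bdryFace
  rw [Finset.sum_image hf, Finset.smul_sum]
  apply Finset.sum_congr rfl
  intro l hl
  have e0 : (L.image f).erase (f l) = (L.erase l).image f := by
    ext x
    simp only [mem_erase, mem_image]
    constructor
    · rintro ⟨hx, a, ha, rfl⟩
      exact ⟨a, ⟨fun h => hx (by rw [h]), ha⟩, rfl⟩
    · rintro ⟨a, ⟨hal, ha⟩, rfl⟩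
      exact ⟨fun h => hal (hf ha hl h), a, ha, rfl⟩
  rw [e0]
  simp only [Finsupp.smul_single, smul_eq_mul, mul_one]
  congr 1
  have e1 : #{w ∈ L.image f | w < f l} = #{m ∈ L | m < l ∧ f m < f l} + #{m ∈ L | l < m ∧ f m < f l} := by
    rw [Finset.filter_image, Finset.card_image_of_injOn (hf.mono (fun m hm => (Finset.mem_filter.1 hm).1)),
      ← Finset.card_union_of_disjoint]
    · congr 1
      ext m
      simp only [mem_filter, mem_union]
      constructor
      · rintro ⟨hm, h⟩
        rcases lt_trichotomy m l with h' | h' | h'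
        · exact Or.inl ⟨hm, h', h⟩
        · subst h'; omega
        · exact Or.inr ⟨hm, h', h⟩
      · tauto
    · rw [Finset.disjoint_left]
      intro m h1 h2
      simp only [mem_filter] at h1 h2
      omega
  have e2 : #{m ∈ L | m < l} = #{m ∈ L | m < l ∧ f m < f l} + #{m ∈ L | m < l ∧ f l < f m} := by
    rw [← Finset.card_union_of_disjoint]
    · congr 1
      ext m
      simp only [mem_filter, mem_union]
      constructor
      · rintro ⟨hm, h⟩
        rcases lt_trichotomy (f m) (f l) with h' | h' | h'
        · exact Or.inl ⟨hm, h, h'⟩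
        · have := hf hm hl h'; omega
        · exact Or.inr ⟨hm, h, h'⟩
      · tauto
    · rw [Finset.disjoint_left]
      intro m h1 h2
      simp only [mem_filter] at h1 h2
      omega
  rw [e1, e2, invs_erase L f l hl]
  simp only [pow_add]
  have : ∀ k : ℕ, (-1 : K) ^ k * (-1 : K) ^ k = 1 := by
    intro k; rw [← mul_pow]; simp
  linear_combination ((-1 : K) ^ (invs (L.erase l) f) * (-1 : K) ^ #{m ∈ L | m < l ∧ f l < f m} *
    (-1 : K) ^ #{m ∈ L | m < l ∧ f m < f l}) * (this (#{m ∈ L | l < m ∧ f m < f l}))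

lemma orSimp_congr (L : Finset ℕ) (f f' : ℕ → ℕ) (h : ∀ l ∈ L, f l = f' l) :
    orSimp K L f = orSimp K L f' := by
  unfold orSimp
  have e1 : L.image f = L.image f' := Finset.image_congr (fun l hl => h l hl)
  have e2 : invs L f = invs L f' := by
    unfold invs
    congr 1
    apply Finset.filter_congr
    rintro ⟨a, b⟩ hab
    rw [Finset.mem_product] at hab
    simp only [h a hab.1, h b hab.2]
  rw [e1, e2]

end HomPart
section PermPart
open scoped Classical
open Finset

/-- prefix sets of a permutation -/
def pre {d : ℕ} (π : Equiv.Perm (Fin d)) (l : ℕ) : Finset ℕ :=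
  (univ.filter (fun i : Fin d => (i : ℕ) < l)).image (fun i => ((π i : Fin d) : ℕ))

lemma mem_pre {d : ℕ} (π : Equiv.Perm (Fin d)) (l x : ℕ) :
    x ∈ pre π l ↔ ∃ i : Fin d, (i : ℕ) < l ∧ ((π i : Fin d) : ℕ) = x := by
  simp [pre]

lemma pre_subset {d : ℕ} (π : Equiv.Perm (Fin d)) (l : ℕ) : pre π l ⊆ range d := by
  intro x hx
  obtain ⟨i, _, rfl⟩ := (mem_pre π l x).1 hx
  simp

lemma pre_mono {d : ℕ} (π : Equiv.Perm (Fin d)) {l m : ℕ} (h : l ≤ m) : pre π l ⊆ pre π m := by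
  intro x hx
  obtain ⟨i, hi, rfl⟩ := (mem_pre π l x).1 hx
  exact (mem_pre π m _).2 ⟨i, by omega, rfl⟩

lemma card_pre {d : ℕ} (π : Equiv.Perm (Fin d)) {l : ℕ} (h : l ≤ d) : (pre π l).card = l := by
  unfold pre
  rw [Finset.card_image_of_injective]
  · have : (univ.filter (fun i : Fin d => (i : ℕ) < l)) = (univ : Finset (Fin l)).map (Fin.castLEEmb h) := by
      ext i
      simp only [mem_filter, mem_univ, true_and, mem_map]
      constructor
      · intro hi; exact ⟨⟨i, hi⟩, rfl⟩
      · rintro ⟨a, rfl⟩; simp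
    rw [this]; simp
  · intro a b hab
    exact π.injective (Fin.ext hab)

lemma pre_one {d l : ℕ} (h : l ≤ d) : pre (1 : Equiv.Perm (Fin d)) l = range l := by
  ext x
  rw [mem_pre, mem_range]
  constructor
  · rintro ⟨i, hi, rfl⟩; simpa using hi
  · intro hx; exact ⟨⟨x, by omega⟩, hx, rfl⟩

lemma pre_swap {d : ℕ} (π : Equiv.Perm (Fin d)) (a b : Fin d) (hab : (a : ℕ) + 1 = b) (m : ℕ)
    (hm : m ≠ b) : pre (π * Equiv.swap a b) m = pre π m := by
  have key : ∀ i : Fin d, (i : ℕ) < m → ((Equiv.swap a b i : Fin d) : ℕ) < m := by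
    intro i hi
    by_cases h1 : i = a
    · subst h1; rw [Equiv.swap_apply_left]; omega
    · by_cases h2 : i = b
      · subst h2; rw [Equiv.swap_apply_right]; omega
      · rw [Equiv.swap_apply_of_ne_of_ne h1 h2]; exact hi
  ext x
  rw [mem_pre, mem_pre]
  constructor
  · rintro ⟨i, hi, rfl⟩
    exact ⟨Equiv.swap a b i, key i hi, rfl⟩
  · rintro ⟨i, hi, rfl⟩
    exact ⟨Equiv.swap a b i, key i hi, by simp⟩

lemma eq_one_of_pre {d : ℕ} (π : Equiv.Perm (Fin d)) (h : ∀ l ≤ d, pre π l = range l) : π = 1 := by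
  ext i
  have h1 : ((π i : Fin d) : ℕ) ∈ pre π (i + 1) := (mem_pre _ _ _).2 ⟨i, by omega, rfl⟩
  rw [h _ (by omega), mem_range] at h1
  have h2 : ((π i : Fin d) : ℕ) ∉ pre π i := by
    rw [mem_pre]
    rintro ⟨k, hk, hke⟩
    have := π.injective (Fin.ext hke)
    subst this
    omega
  rw [h _ (by omega), mem_range] at h2
  simp
  omega

noncomputable def youngSet (d : ℕ) (E : Finset ℕ) : Finset (Equiv.Perm (Fin d)) :=
  univ.filter (fun π => ∀ m ∈ E, pre π m = range m)

noncomputable def zcyc (K : Type*) [Field K] (d : ℕ) (E L : Finset ℕ) (φ : Finset ℕ → ℕ) : Finset ℕ →₀ K :=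
  ∑ π ∈ youngSet d E, (((Equiv.Perm.sign π : ℤˣ) : ℤ) : K) • orSimp K L (fun l => φ (pre π l))

variable {K : Type*} [Field K]

lemma zcyc_bdry (d : ℕ) (E L : Finset ℕ) (φ : Finset ℕ → ℕ)
    (hL : ∀ l ∈ L, 0 < l ∧ l < d ∧ l ∉ E)
    (hφ : ∀ U ∈ Ioo ∅ (range d), ∀ U' ∈ Ioo ∅ (range d), φ U = φ U' → U = U') :
    bdry K (zcyc K d E L φ) = 0 := by
  have hpre : ∀ (π : Equiv.Perm (Fin d)), ∀ l ∈ L, pre π l ∈ Ioo ∅ (range d) := by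
    intro π l hl
    obtain ⟨h1, h2, _⟩ := hL l hl
    have hc := card_pre π h2.le
    rw [mem_Ioo]
    constructor
    · exact Finset.empty_ssubset.2 (Finset.card_pos.1 (by omega))
    · refine lt_of_le_of_ne (pre_subset π l) ?_
      intro h; rw [h, card_range] at hc; omega
  have hinj : ∀ π : Equiv.Perm (Fin d), Set.InjOn (fun l => φ (pre π l)) L := by
    intro π l hl m hm h
    have := hφ _ (hpre π l hl) _ (hpre π m hm) h
    rw [← card_pre π (hL l hl).2.1.le, this, card_pre π (hL m hm).2.1.le]
  unfold zcyc
  rw [map_sum]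
  simp only [map_smul]
  have : ∀ π ∈ youngSet d E, (((Equiv.Perm.sign π : ℤˣ) : ℤ) : K) • bdry K (orSimp K L (fun l => φ (pre π l)))
      = ∑ l ∈ L, (-1 : K) ^ #{m ∈ L | m < l} • ((((Equiv.Perm.sign π : ℤˣ) : ℤ) : K) •
          orSimp K (L.erase l) (fun l => φ (pre π l))) := by
    intro π _
    rw [bdry_orSimp L _ (hinj π), Finset.smul_sum]
    apply Finset.sum_congr rfl
    intro l _
    rw [smul_comm]
  rw [Finset.sum_congr rfl this, Finset.sum_comm]
  apply Finset.sum_eq_zero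
  intro l hl
  rw [← Finset.smul_sum]
  obtain ⟨h1, h2, h3⟩ := hL l hl
  set a : Fin d := ⟨l - 1, by omega⟩ with ha
  set b : Fin d := ⟨l, h2⟩ with hb
  have hab : (a : ℕ) + 1 = b := by simp [ha, hb]; omega
  have hne : a ≠ b := by intro h; rw [h] at hab; omega
  have hz : ∑ π ∈ youngSet d E, ((((Equiv.Perm.sign π : ℤˣ) : ℤ) : K) •
          orSimp K (L.erase l) (fun l => φ (pre π l))) = 0 := by
    refine Finset.sum_involution (fun π _ => π * Equiv.swap a b) ?_ ?_ ?_ ?_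
    · intro π _
      have : orSimp K (L.erase l) (fun l => φ (pre (π * Equiv.swap a b) l)) =
          orSimp K (L.erase l) (fun l => φ (pre π l)) := by
        apply orSimp_congr
        intro m hm
        rw [mem_erase] at hm
        rw [pre_swap π a b hab m (by simpa [hb] using hm.1)]
      rw [this, ← add_smul, Equiv.Perm.sign_mul, Equiv.Perm.sign_swap hne]
      simp
    · intro π _ _ h
      have : Equiv.swap a b = 1 := by simpa using h
      rw [Equiv.swap_eq_one_iff] at this
      exact hne this
    · intro π hπ
      unfold youngSet at hπ ⊢
      rw [mem_filter] at hπ ⊢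
      refine ⟨mem_univ _, fun m hm => ?_⟩
      rw [pre_swap π a b hab m (by rintro rfl; exact h3 hm)]
      exact hπ.2 m hm
    · intro π _
      simp [mul_assoc]
  rw [hz, smul_zero]

lemma zcyc_supp (d : ℕ) (E L : Finset ℕ) (φ : Finset ℕ → ℕ) (s : Finset ℕ)
    (hs : zcyc K d E L φ s ≠ 0) : ∃ π ∈ youngSet d E, s = L.image (fun l => φ (pre π l)) := by
  unfold zcyc at hs
  rw [Finsupp.finsetSum_apply] at hs
  obtain ⟨π, hπ, hne⟩ := Finset.exists_ne_zero_of_sum_ne_zero hs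
  refine ⟨π, hπ, ?_⟩
  by_contra hc
  apply hne
  unfold orSimp
  rw [Finsupp.smul_apply, Finsupp.single_apply, if_neg (fun h => hc h.symm), smul_zero]

lemma zcyc_top (d : ℕ) (E L : Finset ℕ) (φ : Finset ℕ → ℕ)
    (hL : ∀ l ∈ L, 0 < l ∧ l < d) (hE : ∀ e ∈ E, e ≤ d)
    (hcov : ∀ l, 0 < l → l < d → l ∈ L ∨ l ∈ E)
    (hφ : ∀ U ∈ Ioo ∅ (range d), ∀ U' ∈ Ioo ∅ (range d), φ U = φ U' → U = U') :
    zcyc K d E L φ (L.image (fun l => φ (range l))) ≠ 0 := by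
  have hpre : ∀ (π : Equiv.Perm (Fin d)), ∀ l ∈ L, pre π l ∈ Ioo ∅ (range d) := by
    intro π l hl
    obtain ⟨h1, h2⟩ := hL l hl
    have hc := card_pre π h2.le
    rw [mem_Ioo]
    constructor
    · exact Finset.empty_ssubset.2 (Finset.card_pos.1 (by omega))
    · refine lt_of_le_of_ne (pre_subset π l) ?_
      intro h; rw [h, card_range] at hc; omega
  unfold zcyc
  rw [Finsupp.finsetSum_apply, Finset.sum_eq_single 1]
  · have : L.image (fun l => φ (pre (1 : Equiv.Perm (Fin d)) l)) = L.image (fun l => φ (range l)) := by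
      apply Finset.image_congr
      intro l hl
      simp only [pre_one (hL l hl).2.le]
    unfold orSimp
    rw [this]
    simp
  · intro π hπ hne
    unfold orSimp
    rw [Finsupp.smul_apply, Finsupp.single_apply, if_neg, smul_zero]
    intro heq
    apply hne
    apply eq_one_of_pre
    intro l hl
    unfold youngSet at hπ
    rw [mem_filter] at hπ
    rcases Nat.eq_zero_or_pos l with rfl | h0
    · ext x; simp [mem_pre]
    rcases hl.eq_or_lt with rfl | hlt
    · apply Finset.eq_of_subset_of_card_le (pre_subset π _)
      rw [card_pre π le_rfl, card_range]
    rcases hcov l h0 hlt with h | h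
    · have : φ (pre π l) ∈ L.image (fun l => φ (range l)) := by
        rw [← heq]; exact Finset.mem_image_of_mem _ h
      obtain ⟨l', hl', he⟩ := Finset.mem_image.1 this
      have h1 := hpre 1 l' hl'
      rw [pre_one (hL l' hl').2.le] at h1
      have := hφ _ h1 _ (hpre π l h) he
      have hc := card_pre π hl
      rw [← this, card_range] at hc
      rw [← this, hc]
    · exact hπ.2 l h
  · intro h
    exfalso; apply h
    unfold youngSet
    rw [mem_filter]
    exact ⟨mem_univ _, fun m hm => pre_one (hE m hm)⟩

end PermPart
section GeoPart
open scoped Classical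
open Finset

def cnt (σ : Finset ℕ) (k : ℕ) : ℕ := #{s ∈ σ | s < k}

lemma cnt_zero (σ : Finset ℕ) : cnt σ 0 = 0 := by simp [cnt]

lemma cnt_succ (σ : Finset ℕ) (k : ℕ) : cnt σ (k + 1) = cnt σ k + (if k ∈ σ then 1 else 0) := by
  unfold cnt
  have : ({s ∈ σ | s < k + 1}) = {s ∈ σ | s < k} ∪ {s ∈ σ | s = k} := by
    ext s; simp only [mem_filter, mem_union]; constructor
    · rintro ⟨h, h'⟩
      rcases Nat.lt_succ_iff_lt_or_eq.1 h' with h' | h'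
      · exact Or.inl ⟨h, h'⟩
      · exact Or.inr ⟨h, h'⟩
    · rintro (⟨h, h'⟩ | ⟨h, h'⟩) <;> exact ⟨h, by omega⟩
  rw [this, Finset.card_union_of_disjoint]
  · congr 1
    split_ifs with h
    · rw [Finset.filter_eq' σ k, if_pos h]; simp
    · rw [Finset.filter_eq' σ k, if_neg h]; simp
  · rw [Finset.disjoint_left]
    intro s h1 h2
    simp only [mem_filter] at h1 h2
    omega

lemma cnt_le (σ : Finset ℕ) (k : ℕ) : cnt σ k ≤ σ.card := Finset.card_filter_le _ _

lemma cnt_top (σ : Finset ℕ) (n : ℕ) (h : σ ⊆ range n) : cnt σ n = σ.card := by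
  unfold cnt
  rw [Finset.filter_true_of_mem]
  intro s hs
  simpa using h hs

lemma exists_cnt (σ : Finset ℕ) (n : ℕ) (h : σ ⊆ range n) (t : ℕ) (ht : t < σ.card) :
    ∃ k : Fin n, cnt σ ((k : ℕ) + 1) = t + 1 := by
  have hex : ∃ m, t + 1 ≤ cnt σ m := ⟨n, by rw [cnt_top σ n h]; omega⟩
  have h1 := Nat.find_spec hex
  have h2 : Nat.find hex ≤ n := Nat.find_min' hex (by rw [cnt_top σ n h]; omega)
  have h3 : Nat.find hex ≠ 0 := by
    intro h0; rw [h0, cnt_zero] at h1; omega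
  have h4 := Nat.find_min hex (m := Nat.find hex - 1) (by omega)
  have h5 := cnt_succ σ (Nat.find hex - 1)
  rw [Nat.sub_add_cancel (by omega)] at h5
  refine ⟨⟨Nat.find hex - 1, by omega⟩, ?_⟩
  simp only
  rw [Nat.sub_add_cancel (by omega)]
  split_ifs at h5 <;> omega

def ind (U : Finset ℕ) (t : ℕ) : ℤ := if t ∈ U then 1 else 0

lemma ind_cases (U : Finset ℕ) (t : ℕ) : (t ∈ U ∧ ind U t = 1) ∨ (t ∉ U ∧ ind U t = 0) := by
  unfold ind; by_cases h : t ∈ U <;> simp [h]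

def Sv (d r : ℕ) (U : Finset ℕ) (c : ℕ) : ℤ :=
  if c = 0 then 0 else
    2 * (c : ℤ) + (if c = d then (r : ℤ) - 2 * d else 0) + ind U (c - 1) - ind U (d - 1)

lemma Sv_step (d r : ℕ) (hr : 2 * d ≤ r) (U : Finset ℕ) (c : ℕ) (hc : c < d) :
    1 ≤ Sv d r U (c + 1) - Sv d r U c := by
  unfold Sv
  have h1 := ind_cases U (c - 1)
  have h2 := ind_cases U (d - 1)
  have h3 := ind_cases U c
  simp only [Nat.add_sub_cancel]
  push_cast
  split_ifs <;> omega

lemma Sv_top (d r : ℕ) (hd : 0 < d) (U : Finset ℕ) : Sv d r U d = r := by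
  unfold Sv
  rw [if_neg (by omega), if_pos rfl]; ring

def xv (n r : ℕ) (σ U : Finset ℕ) : Fin n → ℕ := fun l =>
  (Sv σ.card r U (cnt σ ((l : ℕ) + 1)) - Sv σ.card r U (cnt σ l)).toNat

lemma xv_cast (n r : ℕ) (σ U : Finset ℕ) (hr : 2 * σ.card ≤ r) (l : Fin n) :
    (xv n r σ U l : ℤ) = Sv σ.card r U (cnt σ ((l : ℕ) + 1)) - Sv σ.card r U (cnt σ l) := by
  unfold xv
  rw [Int.toNat_of_nonneg]
  rw [cnt_succ]
  split_ifs with h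
  · have h1 := cnt_le σ ((l : ℕ) + 1)
    rw [cnt_succ, if_pos h] at h1
    have := Sv_step σ.card r hr U (cnt σ l) (by omega)
    omega
  · simp

lemma xv_ne_zero (n r : ℕ) (σ U : Finset ℕ) (hr : 2 * σ.card ≤ r) (l : Fin n) :
    xv n r σ U l ≠ 0 ↔ (l : ℕ) ∈ σ := by
  have h0 := xv_cast n r σ U hr l
  rw [cnt_succ] at h0
  split_ifs at h0 with h
  · have h1 := cnt_le σ ((l : ℕ) + 1)
    rw [cnt_succ, if_pos h] at h1
    have := Sv_step σ.card r hr U (cnt σ l) (by omega)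
    simp only [h, iff_true]
    omega
  · simp at h0
    simp [h, h0]

lemma tupSupp_xv (n r : ℕ) (σ U : Finset ℕ) (hσ : σ ⊆ range n) (hr : 2 * σ.card ≤ r) :
    tupSupp (xv n r σ U) = σ := by
  ext x
  unfold tupSupp
  simp only [mem_image, mem_filter, mem_univ, true_and, xv_ne_zero n r σ U hr]
  constructor
  · rintro ⟨l, hl, rfl⟩; exact hl
  · intro hx
    exact ⟨⟨x, by simpa using hσ hx⟩, hx, rfl⟩

lemma sum_fin_le {n : ℕ} (f : ℕ → ℤ) (k : Fin n) :
    ∑ l ∈ univ.filter (fun l : Fin n => l ≤ k), f l = ∑ m ∈ range ((k : ℕ) + 1), f m := by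
  refine Finset.sum_bij (fun l _ => (l : ℕ)) ?_ ?_ ?_ ?_
  · intro l hl
    simp only [mem_filter, mem_univ, true_and] at hl
    rw [mem_range]
    have : (l : ℕ) ≤ k := hl
    omega
  · intro a _ b _ h; exact Fin.ext h
  · intro m hm
    rw [mem_range] at hm
    refine ⟨⟨m, by omega⟩, ?_, rfl⟩
    simp only [mem_filter, mem_univ, true_and]
    exact Fin.le_def.2 (by simp; omega)
  · intro l _; rfl

lemma xv_partial (n r : ℕ) (σ U : Finset ℕ) (hr : 2 * σ.card ≤ r) (k : Fin n) :
    ∑ l ∈ univ.filter (fun l : Fin n => l ≤ k), (xv n r σ U l : ℤ)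
      = Sv σ.card r U (cnt σ ((k : ℕ) + 1)) := by
  simp only [xv_cast n r σ U hr]
  rw [sum_fin_le (fun l => Sv σ.card r U (cnt σ (l + 1)) - Sv σ.card r U (cnt σ l)) k,
    Finset.sum_range_sub (fun l => Sv σ.card r U (cnt σ l)), cnt_zero]
  simp [Sv]

lemma xv_sum (n r : ℕ) (σ U : Finset ℕ) (hσ : σ ⊆ range n) (hr : 2 * σ.card ≤ r)
    (hd : 0 < σ.card) : ∑ l, xv n r σ U l = r := by
  have : (∑ l, (xv n r σ U l : ℤ)) = r := by
    simp only [xv_cast n r σ U hr]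
    rw [Fin.sum_univ_eq_sum_range (fun l => Sv σ.card r U (cnt σ (l + 1)) - Sv σ.card r U (cnt σ l)),
      Finset.sum_range_sub (fun l => Sv σ.card r U (cnt σ l)), cnt_zero, cnt_top σ n hσ,
      Sv_top _ _ hd]
    simp [Sv]
  exact_mod_cast this

lemma xv_iComp (n r : ℕ) (σ U U' : Finset ℕ) (hr : 2 * σ.card ≤ r) (k : Fin n) :
    iComp (fun l => (xv n r σ U l : ℤ) - (xv n r σ U' l : ℤ)) k =
      Sv σ.card r U (cnt σ ((k : ℕ) + 1)) - Sv σ.card r U' (cnt σ ((k : ℕ) + 1)) := by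
  unfold iComp
  rw [Finset.sum_sub_distrib, xv_partial n r σ U hr, xv_partial n r σ U' hr]

lemma Sv_sub (d r : ℕ) (U U' : Finset ℕ) (t : ℕ) :
    Sv d r U (t + 1) - Sv d r U' (t + 1) =
      (ind U t - ind U' t) - (ind U (d - 1) - ind U' (d - 1)) := by
  unfold Sv
  simp
  ring

lemma edgeOK_symm {n : ℕ} (a b : Fin n → ℕ) (h : edgeOK a b) : edgeOK b a := by
  unfold edgeOK at *; tauto

lemma edgeOK_of_subset (n r : ℕ) (σ U U' : Finset ℕ) (hr : 2 * σ.card ≤ r) (h : U ⊆ U') :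
    edgeOK (xv n r σ U) (xv n r σ U') := by
  unfold edgeOK
  simp only [xv_iComp n r σ _ _ hr]
  have h1 := ind_cases U (σ.card - 1)
  have h2 := ind_cases U' (σ.card - 1)
  have h3 := @h (σ.card - 1)
  by_cases hc : ind U' (σ.card - 1) - ind U (σ.card - 1) = 0
  · right
    intro k
    rcases Nat.eq_zero_or_pos (cnt σ ((k : ℕ) + 1)) with h0 | h0
    · rw [h0]; simp [Sv]
    · obtain ⟨t, ht⟩ : ∃ t, cnt σ ((k : ℕ) + 1) = t + 1 := ⟨cnt σ ((k : ℕ) + 1) - 1, by omega⟩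
      rw [ht, Sv_sub, hc]
      have h4 := ind_cases U t
      have h5 := ind_cases U' t
      have h6 := @h t
      simp only [Set.mem_insert_iff, Set.mem_singleton_iff]
      rcases h4 with ⟨a, b⟩ | ⟨a, b⟩ <;> rcases h5 with ⟨c, e⟩ | ⟨c, e⟩ <;> simp_all
  · left
    have hc' : ind U (σ.card - 1) - ind U' (σ.card - 1) = -1 := by
      rcases h1 with ⟨a, b⟩ | ⟨a, b⟩ <;> rcases h2 with ⟨c, e⟩ | ⟨c, e⟩ <;> simp_all
    intro k
    rcases Nat.eq_zero_or_pos (cnt σ ((k : ℕ) + 1)) with h0 | h0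
    · rw [h0]; simp [Sv]
    · obtain ⟨t, ht⟩ : ∃ t, cnt σ ((k : ℕ) + 1) = t + 1 := ⟨cnt σ ((k : ℕ) + 1) - 1, by omega⟩
      rw [ht, Sv_sub, hc']
      have h4 := ind_cases U t
      have h5 := ind_cases U' t
      have h6 := @h t
      simp only [Set.mem_insert_iff, Set.mem_singleton_iff]
      rcases h4 with ⟨a, b⟩ | ⟨a, b⟩ <;> rcases h5 with ⟨c, e⟩ | ⟨c, e⟩ <;> simp [b, e] <;> tauto

lemma subset_of_diff (d : ℕ) (U U' : Finset ℕ) (hU : U ⊆ range d) (hU' : U' ⊆ range d)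
    (h : ∀ t < d, (ind U t - ind U' t) - (ind U (d - 1) - ind U' (d - 1)) ∈ ({0, 1} : Set ℤ)) :
    U ⊆ U' ∨ U' ⊆ U := by
  simp only [Set.mem_insert_iff, Set.mem_singleton_iff] at h
  have h1 := ind_cases U (d - 1)
  have h2 := ind_cases U' (d - 1)
  by_cases hc : ind U (d - 1) - ind U' (d - 1) < 0
  · left
    intro t ht
    have h3 := h t (by simpa using hU ht)
    by_contra hn
    have h4 := ind_cases U t
    have h5 := ind_cases U' t
    simp only [ht, hn, not_true_eq_false, not_false_eq_true, true_and, false_and, or_false, false_or] at h4 h5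
    omega
  · right
    intro t ht
    have h3 := h t (by simpa using hU' ht)
    by_contra hn
    have h4 := ind_cases U t
    have h5 := ind_cases U' t
    simp only [ht, hn, not_true_eq_false, not_false_eq_true, true_and, false_and, or_false, false_or] at h4 h5
    omega

lemma subset_of_edgeOK (n r : ℕ) (σ U U' : Finset ℕ) (hσ : σ ⊆ range n) (hr : 2 * σ.card ≤ r)
    (hU : U ⊆ range σ.card) (hU' : U' ⊆ range σ.card)
    (h : edgeOK (xv n r σ U) (xv n r σ U')) : U ⊆ U' ∨ U' ⊆ U := by
  unfold edgeOK at h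
  simp only [xv_iComp n r σ _ _ hr] at h
  rcases h with h | h
  · apply subset_of_diff σ.card U U' hU hU'
    intro t ht
    obtain ⟨k, hk⟩ := exists_cnt σ n hσ t ht
    have := h k
    rwa [hk, Sv_sub] at this
  · rw [or_comm]
    apply subset_of_diff σ.card U' U hU' hU
    intro t ht
    obtain ⟨k, hk⟩ := exists_cnt σ n hσ t ht
    have := h k
    rwa [hk, Sv_sub] at this

lemma xv_inj (n r : ℕ) (σ U U' : Finset ℕ) (hσ : σ ⊆ range n) (hr : 2 * σ.card ≤ r)
    (hU : U ∈ Ioo ∅ (range σ.card)) (hU' : U' ∈ Ioo ∅ (range σ.card))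
    (h : xv n r σ U = xv n r σ U') : U = U' := by
  have key : ∀ t < σ.card, ind U t - ind U' t = ind U (σ.card - 1) - ind U' (σ.card - 1) := by
    intro t ht
    obtain ⟨k, hk⟩ := exists_cnt σ n hσ t ht
    have := xv_iComp n r σ U U' hr k
    rw [hk, Sv_sub, h] at this
    simp only [sub_self, iComp, Finset.sum_const_zero] at this
    omega
  have one : ∀ U U' : Finset ℕ, U ∈ Ioo ∅ (range σ.card) → U' ∈ Ioo ∅ (range σ.card) →
      (∀ t < σ.card, ind U t - ind U' t = ind U (σ.card - 1) - ind U' (σ.card - 1)) → U ⊆ U' := by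
    intro U U' hU hU' key t ht
    rw [mem_Ioo] at hU hU'
    by_contra hn
    have ht' : t < σ.card := by simpa using hU.2.le ht
    have h4 := ind_cases U t
    have h5 := ind_cases U' t
    simp only [ht, hn, not_true_eq_false, not_false_eq_true, true_and, false_and, or_false, false_or] at h4 h5
    have hk := key t ht'
    apply hU.2.not_ge
    intro s hs
    have h6 := key s (by simpa using hs)
    have h7 := ind_cases U s
    have h8 := ind_cases U' s
    rcases h7 with h7 | h7
    · exact h7.1
    · omega
  apply Finset.Subset.antisymm
  · exact one U U' hU hU' key
  · apply one U' U hU' hU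
    intro t ht
    have := key t ht
    omega

lemma encTup_inj {n : ℕ} : Function.Injective (encTup (n := n)) := by
  intro a b h
  unfold encTup at h
  exact List.ofFn_injective (Encodable.encode_injective h)

/-- counting -/
lemma e_zero {n : ℕ} (σ : Finset ℕ) (M : ℕ) (hM : ∀ s ∈ σ, s ≤ M) (e : Fin n → ℤ)
    (hs : ∑ l, e l = 0) (hsupp : ∀ l : Fin n, (l : ℕ) ∉ σ → e l = 0)
    (hi : ∀ l : Fin n, (l : ℕ) ∈ σ.erase M → iComp e l = 0) : e = 0 := by
  by_contra hne
  obtain ⟨l0, hl0⟩ := Function.ne_iff.1 hne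
  obtain ⟨l, hl, hmin⟩ := Finset.exists_minimal (s := univ.filter (fun l : Fin n => e l ≠ 0))
    ⟨l0, by simpa using hl0⟩
  simp only [mem_filter, mem_univ, true_and] at hl hmin
  have hlt : ∀ l' : Fin n, l' < l → e l' = 0 := by
    intro l' h
    by_contra hc
    exact absurd (hmin hc h.le) (not_le.2 h)
  have hlσ : (l : ℕ) ∈ σ := by
    by_contra hc; exact hl (hsupp l hc)
  by_cases hlM : (l : ℕ) = M
  · apply hl
    rw [← hs]
    symm
    apply Finset.sum_eq_single l
    · intro b _ hb
      rcases lt_or_gt_of_ne hb with h | h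
      · exact hlt b h
      · apply hsupp
        intro hc
        have := hM _ hc
        have : (l : ℕ) < b := h
        omega
    · simp
  · apply hl
    rw [← hi l (by simp [hlσ, hlM])]
    unfold iComp
    symm
    apply Finset.sum_eq_single l
    · intro b hb hbl
      simp only [mem_filter, mem_univ, true_and] at hb
      exact hlt b (lt_of_le_of_ne hb hbl)
    · simp

lemma iComp_sub {n : ℕ} (e e' : Fin n → ℤ) (k : Fin n) :
    iComp (e - e') k = iComp e k - iComp e' k := by
  unfold iComp
  simp

lemma count_e {n : ℕ} (σ : Finset ℕ) (hσn : σ.Nonempty) (A : Finset (Fin n → ℤ))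
    (hA : ∀ e ∈ A, e ≠ 0 ∧ ∑ l, e l = 0 ∧ (∀ l : Fin n, (l : ℕ) ∉ σ → e l = 0) ∧
      ∀ k, iComp e k ∈ ({0, 1} : Set ℤ)) : A.card + 1 ≤ 2 ^ (σ.card - 1) := by
  set M := σ.max' hσn with hMdef
  have hM : ∀ s ∈ σ, s ≤ M := fun s hs => Finset.le_max' _ _ hs
  have hMσ : M ∈ σ := Finset.max'_mem _ _
  set Φ : (Fin n → ℤ) → Finset ℕ :=
    fun e => (σ.erase M).filter (fun k => ∃ l : Fin n, (l : ℕ) = k ∧ iComp e l = 1) with hΦ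
  have memΦ : ∀ e, ∀ l : Fin n, (l : ℕ) ∈ Φ e ↔ (l : ℕ) ∈ σ.erase M ∧ iComp e l = 1 := by
    intro e l
    rw [hΦ]
    simp only [mem_filter]
    constructor
    · rintro ⟨h, l', hl', h'⟩
      have := Fin.ext hl'
      subst this
      exact ⟨h, h'⟩
    · rintro ⟨h, h'⟩
      exact ⟨h, l, rfl, h'⟩
  have hle : A.card ≤ ((σ.erase M).powerset.erase ∅).card := by
    apply Finset.card_le_card_of_injOn Φ
    · intro e he
      obtain ⟨h1, h2, h3, h4⟩ := hA e he
      simp only [coe_erase, Set.mem_sdiff, mem_coe, mem_powerset, Set.mem_singleton_iff]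
      refine ⟨Finset.filter_subset _ _, ?_⟩
      intro h0
      apply h1
      apply e_zero σ M hM e h2 h3
      intro l hl
      have h5 : ¬ (l : ℕ) ∈ Φ e := by rw [h0]; simp
      rw [memΦ] at h5
      rcases h4 l with h | h
      · exact h
      · exact absurd ⟨hl, h⟩ h5
    · intro e he e' he' heq
      obtain ⟨h1, h2, h3, h4⟩ := hA e he
      obtain ⟨h1', h2', h3', h4'⟩ := hA e' he'
      have : e - e' = 0 := by
        apply e_zero σ M hM
        · simp [h2, h2']
        · intro l hl
          simp [h3 l hl, h3' l hl]
        · intro l hl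
          rw [iComp_sub]
          have h5 := memΦ e l
          have h6 := memΦ e' l
          rw [heq] at h5
          have h7 : iComp e l = 1 ↔ iComp e' l = 1 := by tauto
          have h8 := h4 l
          have h9 := h4' l
          simp only [Set.mem_insert_iff, Set.mem_singleton_iff] at h8 h9
          rcases h8 with h8 | h8 <;> rcases h9 with h9 | h9 <;> simp_all
      exact sub_eq_zero.1 this
  rw [Finset.card_erase_of_mem (by simp), Finset.card_powerset, Finset.card_erase_of_mem hMσ] at hle
  have : 0 < 2 ^ (σ.card - 1) := by positivity
  omega

lemma count_nb {n r : ℕ} (σ : Finset ℕ) (hσn : σ.Nonempty) (u : Fin n → ℕ)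
    (hu : ∑ l, u l = r) (hus : tupSupp u ⊆ σ) (A : Finset (Fin n → ℕ))
    (hA : ∀ b ∈ A, b ≠ u ∧ ∑ l, b l = r ∧ tupSupp b ⊆ σ ∧ edgeOK u b) :
    A.card + 2 ≤ 2 ^ σ.card := by
  have hz : ∀ b : Fin n → ℕ, tupSupp b ⊆ σ → ∀ l : Fin n, (l : ℕ) ∉ σ → b l = 0 := by
    intro b hb l hl
    by_contra h
    apply hl
    apply hb
    unfold tupSupp
    simp only [mem_image, mem_filter, mem_univ, true_and]
    exact ⟨l, h, rfl⟩
  set P : Finset (Fin n → ℤ) := (A.filter (fun b => ∀ k, iComp (fun l => (u l : ℤ) - (b l : ℤ)) k ∈ ({0, 1} : Set ℤ))).image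
    (fun b l => (u l : ℤ) - (b l : ℤ)) with hP
  set Q : Finset (Fin n → ℤ) := (A.filter (fun b => ∀ k, iComp (fun l => (b l : ℤ) - (u l : ℤ)) k ∈ ({0, 1} : Set ℤ))).image
    (fun b l => (b l : ℤ) - (u l : ℤ)) with hQ
  have hPc : P.card + 1 ≤ 2 ^ (σ.card - 1) := by
    apply count_e σ hσn
    intro e he
    rw [hP, mem_image] at he
    obtain ⟨b, hb, rfl⟩ := he
    rw [mem_filter] at hb
    obtain ⟨h1, h2, h3, h4⟩ := hA b hb.1
    refine ⟨?_, ?_, ?_, hb.2⟩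
    · intro h0
      apply h1
      funext l
      have := congrFun h0 l
      simp at this
      omega
    · rw [Finset.sum_sub_distrib]
      have e1 : (∑ l, (u l : ℤ)) = r := by exact_mod_cast hu
      have e2 : (∑ l, (b l : ℤ)) = r := by exact_mod_cast h2
      rw [e1, e2, sub_self]
    · intro l hl
      simp [hz u hus l hl, hz b h3 l hl]
  have hQc : Q.card + 1 ≤ 2 ^ (σ.card - 1) := by
    apply count_e σ hσn
    intro e he
    rw [hQ, mem_image] at he
    obtain ⟨b, hb, rfl⟩ := he
    rw [mem_filter] at hb
    obtain ⟨h1, h2, h3, h4⟩ := hA b hb.1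
    refine ⟨?_, ?_, ?_, hb.2⟩
    · intro h0
      apply h1
      funext l
      have := congrFun h0 l
      simp at this
      omega
    · rw [Finset.sum_sub_distrib]
      have e1 : (∑ l, (u l : ℤ)) = r := by exact_mod_cast hu
      have e2 : (∑ l, (b l : ℤ)) = r := by exact_mod_cast h2
      rw [e1, e2, sub_self]
    · intro l hl
      simp [hz u hus l hl, hz b h3 l hl]
  rw [hP, Finset.card_image_of_injective _ (by
    intro b b' h
    funext l
    have := congrFun h l
    simp at this
    omega)] at hPc
  rw [hQ, Finset.card_image_of_injective _ (by
    intro b b' h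
    funext l
    have := congrFun h l
    simp at this
    omega)] at hQc
  have hle : A.card ≤ _ := Finset.card_le_card (t := (A.filter (fun b => ∀ k, iComp (fun l => (u l : ℤ) - (b l : ℤ)) k ∈ ({0, 1} : Set ℤ))) ∪ (A.filter (fun b => ∀ k, iComp (fun l => (b l : ℤ) - (u l : ℤ)) k ∈ ({0, 1} : Set ℤ)))) (by
    intro b hb
    rw [mem_union, mem_filter, mem_filter]
    rcases (hA b hb).2.2.2 with h | h
    · exact Or.inl ⟨hb, h⟩
    · exact Or.inr ⟨hb, h⟩)
  have hun := Finset.card_union_le (A.filter (fun b => ∀ k, iComp (fun l => (u l : ℤ) - (b l : ℤ)) k ∈ ({0, 1} : Set ℤ))) (A.filter (fun b => ∀ k, iComp (fun l => (b l : ℤ) - (u l : ℤ)) k ∈ ({0, 1} : Set ℤ)))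
  have hpos : 0 < σ.card := Finset.card_pos.2 hσn
  have : 2 ^ σ.card = 2 * 2 ^ (σ.card - 1) := by
    conv_lhs => rw [← Nat.sub_add_cancel hpos, pow_succ]
    ring
  omega

end GeoPart
section MainPart
open scoped Classical
open Finset

def eb (d p s : ℕ) : ℕ := s * (d / p) + min s (d % p)

lemma eb_succ (d p s : ℕ) : eb d p (s + 1) = eb d p s + d / p + (if s < d % p then 1 else 0) := by
  unfold eb
  rw [add_mul]
  split_ifs with h <;> omega

lemma eb_zero (d p : ℕ) : eb d p 0 = 0 := by simp [eb]

lemma eb_top (d p : ℕ) (hp : 0 < p) : eb d p p = d := by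
  unfold eb
  have h1 := Nat.mod_lt d hp
  have h2 := Nat.div_add_mod d p
  rw [min_eq_right h1.le]
  exact h2

lemma eb_strictMono (d p : ℕ) (hp : 0 < p) (hpd : p ≤ d) : StrictMono (eb d p) := by
  apply strictMono_nat_of_lt_succ
  intro s
  rw [eb_succ]
  have := Nat.div_pos hpd hp
  omega

def EE (d p : ℕ) : Finset ℕ := (range (p + 1)).image (eb d p)
def LL (d p : ℕ) : Finset ℕ := range (d + 1) \ EE d p
def TT (d p : ℕ) : Finset (Finset ℕ) :=
  (range p).biUnion (fun s => Ioo (range (eb d p s)) (range (eb d p (s + 1))))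

lemma EE_le (d p : ℕ) (hp : 0 < p) (hpd : p ≤ d) : ∀ e ∈ EE d p, e ≤ d := by
  intro e he
  unfold EE at he
  obtain ⟨s, hs, rfl⟩ := mem_image.1 he
  rw [mem_range] at hs
  rw [← eb_top d p hp]
  conv_lhs => rw [eb_top d p hp]
  exact (eb_strictMono d p hp hpd).monotone (by omega)

lemma LL_card (d p : ℕ) (hp : 0 < p) (hpd : p ≤ d) : (LL d p).card = d - p := by
  unfold LL
  rw [Finset.card_sdiff_of_subset]
  · unfold EE
    rw [Finset.card_image_of_injective _ (eb_strictMono d p hp hpd).injective]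
    simp
  · intro e he
    have := EE_le d p hp hpd e he
    rw [mem_range]; omega

lemma LL_mem (d p : ℕ) (hp : 0 < p) (l : ℕ) (hl : l ∈ LL d p) :
    0 < l ∧ l < d ∧ l ∉ EE d p := by
  unfold LL at hl
  rw [mem_sdiff, mem_range] at hl
  have h0 : 0 ∈ EE d p := mem_image.2 ⟨0, by simp, eb_zero d p⟩
  have h1 : d ∈ EE d p := mem_image.2 ⟨p, by simp, eb_top d p hp⟩
  refine ⟨?_, ?_, hl.2⟩
  · rcases Nat.eq_zero_or_pos l with rfl | h
    · exact absurd h0 hl.2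
    · exact h
  · rcases Nat.lt_or_ge l d with h | h
    · exact h
    · have : l = d := by omega
      subst this; exact absurd h1 hl.2

lemma LL_block (d p : ℕ) (hp : 0 < p) (l : ℕ) (hl : l ∈ LL d p) :
    ∃ s < p, eb d p s < l ∧ l < eb d p (s + 1) := by
  obtain ⟨h0, h1, h2⟩ := LL_mem d p hp l hl
  have hex : ∃ s, l ≤ eb d p s := ⟨p, by rw [eb_top d p hp]; omega⟩
  have a1 := Nat.find_spec hex
  have a2 : Nat.find hex ≤ p := Nat.find_min' hex (by rw [eb_top d p hp]; omega)
  have a3 : Nat.find hex ≠ 0 := by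
    intro h; rw [h, eb_zero] at a1; omega
  have a4 := Nat.find_min hex (m := Nat.find hex - 1) (by omega)
  refine ⟨Nat.find hex - 1, by omega, by omega, ?_⟩
  rw [Nat.sub_add_cancel (by omega)]
  rcases a1.lt_or_eq with h | h
  · exact h
  · exfalso; apply h2
    exact mem_image.2 ⟨Nat.find hex, by rw [mem_range]; omega, h.symm⟩

lemma pre_mem_TT (d p : ℕ) (hp : 0 < p) (hpd : p ≤ d) (π : Equiv.Perm (Fin d))
    (hπ : π ∈ youngSet d (EE d p)) (l : ℕ) (hl : l ∈ LL d p) : pre π l ∈ TT d p := by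
  obtain ⟨s, hs, h1, h2⟩ := LL_block d p hp l hl
  obtain ⟨_, hld, _⟩ := LL_mem d p hp l hl
  unfold youngSet at hπ
  rw [mem_filter] at hπ
  have e1 := hπ.2 (eb d p s) (mem_image.2 ⟨s, by rw [mem_range]; omega, rfl⟩)
  have e2 := hπ.2 (eb d p (s + 1)) (mem_image.2 ⟨s + 1, by rw [mem_range]; omega, rfl⟩)
  have hc := card_pre π hld.le
  unfold TT
  rw [mem_biUnion]
  refine ⟨s, by simpa using hs, ?_⟩
  rw [mem_Ioo]
  constructor
  · refine lt_of_le_of_ne ?_ ?_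
    · rw [← e1]; exact pre_mono π h1.le
    · intro h; rw [← h, card_range] at hc; omega
  · refine lt_of_le_of_ne ?_ ?_
    · rw [← e2]; exact pre_mono π h2.le
    · intro h; rw [h, card_range] at hc; omega

lemma TT_mem (d p : ℕ) (hp : 0 < p) (hpd : p ≤ d) (U : Finset ℕ) (hU : U ∈ TT d p) :
    U ∈ Ioo ∅ (range d) ∧ U.card ∈ LL d p := by
  unfold TT at hU
  rw [mem_biUnion] at hU
  obtain ⟨s, hs, hU⟩ := hU
  rw [mem_range] at hs
  rw [mem_Ioo] at hU
  have hm := eb_strictMono d p hp hpd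
  have hle : eb d p (s + 1) ≤ d := by
    conv_rhs => rw [← eb_top d p hp]
    exact hm.monotone (by omega)
  have c1 := Finset.card_lt_card hU.1
  have c2 := Finset.card_lt_card hU.2
  rw [card_range] at c1 c2
  constructor
  · rw [mem_Ioo]
    constructor
    · exact lt_of_le_of_lt (Finset.empty_subset _) hU.1
    · exact lt_of_lt_of_le hU.2 (Finset.range_subset_range.2 hle)
  · unfold LL
    rw [mem_sdiff, mem_range]
    refine ⟨by omega, ?_⟩
    intro h
    obtain ⟨s', _, hs'⟩ := mem_image.1 h
    rw [← hs'] at c1 c2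
    have := hm.lt_iff_lt.1 c1
    have := hm.lt_iff_lt.1 c2
    omega

lemma TT_card (d p : ℕ) (hp : 0 < p) (hpd : p ≤ d) :
    (TT d p).card + 2 * p ≤ 2 ^ (d / p) * (p + d % p) := by
  have hq := Nat.div_pos hpd hp
  have h1 : (TT d p).card ≤ ∑ s ∈ range p, (2 ^ (eb d p (s + 1) - eb d p s) - 2) := by
    unfold TT
    refine Finset.card_biUnion_le.trans (Finset.sum_le_sum ?_)
    intro s _
    rw [Finset.card_Ioo_finset (Finset.range_subset_range.2 ((eb_strictMono d p hp hpd).monotone (by omega)))]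
    simp
  have h2 : ∑ s ∈ range p, (2 ^ (eb d p (s + 1) - eb d p s) - 2) + 2 * p
      = 2 ^ (d / p) * (p + d % p) := by
    have : 2 * p = ∑ s ∈ range p, 2 := by simp [mul_comm]
    rw [this, ← Finset.sum_add_distrib]
    have : ∀ s ∈ range p, (2 ^ (eb d p (s + 1) - eb d p s) - 2) + 2 =
        2 ^ (d / p) * (1 + if s < d % p then 1 else 0) := by
      intro s _
      have e : eb d p (s + 1) - eb d p s = d / p + (if s < d % p then 1 else 0) := by
        rw [eb_succ]; omega
      have e2 : 2 ^ 1 ≤ 2 ^ (eb d p (s + 1) - eb d p s) :=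
        Nat.pow_le_pow_right (by norm_num) (by omega)
      rw [Nat.sub_add_cancel (by simpa using e2), e, pow_add]
      split_ifs <;> simp
    rw [Finset.sum_congr rfl this, ← Finset.mul_sum, Finset.sum_add_distrib]
    congr 2
    · simp
    · rw [← Finset.sum_filter]
      have : (range p).filter (fun s => s < d % p) = range (d % p) := by
        ext s
        have := Nat.mod_lt d hp
        simp only [mem_filter, mem_range]; omega
      rw [this]; simp
  omega

lemma edgewise_complex (n r : ℕ) (Δ : SC) (hC : IsComplex Δ) : IsComplex (edgewise n r Δ) := by
  intro s hs t ht
  unfold edgewise at *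
  obtain ⟨F, hF, rfl⟩ := mem_image.1 hs
  obtain ⟨F', hF', rfl⟩ := Finset.subset_image_iff.1 ht
  refine mem_image.2 ⟨F', ?_, rfl⟩
  unfold edgewiseT at *
  rw [mem_filter, mem_powerset] at *
  have hsub : F' ⊆ F := by simpa using hF'
  exact ⟨hsub.trans hF.1, hC _ hF.2.1 _ (Finset.sup_mono hsub),
    fun a ha b hb => hF.2.2 a (hsub ha) b (hsub hb)⟩

noncomputable def phi (n r : ℕ) (σ U : Finset ℕ) : ℕ := encTup (xv n r σ U)

lemma chain_face (n r : ℕ) (Δ : SC) (hC : IsComplex Δ) (σ : Finset ℕ) (hσΔ : σ ∈ Δ)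
    (hσ : σ ⊆ range n) (hr : 2 * σ.card ≤ r) (hd : 0 < σ.card) (C : Finset (Finset ℕ))
    (hch : ∀ U ∈ C, ∀ U' ∈ C, U ⊆ U' ∨ U' ⊆ U) : C.image (phi n r σ) ∈ edgewise n r Δ := by
  unfold edgewise
  refine mem_image.2 ⟨C.image (xv n r σ), ?_, ?_⟩
  · unfold edgewiseT
    rw [mem_filter, mem_powerset]
    refine ⟨?_, ?_, ?_⟩
    · intro a ha
      obtain ⟨U, _, rfl⟩ := mem_image.1 ha
      rw [Finset.Nat.mem_antidiagonalTuple]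
      exact xv_sum n r σ U hσ hr hd
    · apply hC σ hσΔ
      apply Finset.sup_le
      intro a ha
      obtain ⟨U, _, rfl⟩ := mem_image.1 ha
      rw [tupSupp_xv n r σ U hσ hr]
    · intro a ha b hb
      obtain ⟨U, hU, rfl⟩ := mem_image.1 ha
      obtain ⟨U', hU', rfl⟩ := mem_image.1 hb
      rcases hch U hU U' hU' with h | h
      · exact edgeOK_of_subset n r σ U U' hr h
      · exact edgeOK_symm _ _ (edgeOK_of_subset n r σ U' U hr h)
  · rw [Finset.image_image]
    rfl

lemma star_mem (n r : ℕ) (Δ : SC) (σ : Finset ℕ)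
    (hmax : ∀ s ∈ Δ, s.card ≤ σ.card)
    (hσ : σ ⊆ range n) (hr : 2 * σ.card ≤ r) (h : Finset ℕ)
    (hh : h ∈ edgewise n r Δ) (U : Finset ℕ) (hU : phi n r σ U ∈ h) (y : ℕ) (hy : y ∈ h) :
    ∃ b : Fin n → ℕ, y = encTup b ∧ ∑ l, b l = r ∧ tupSupp b ⊆ σ ∧ edgeOK (xv n r σ U) b := by
  unfold edgewise at hh
  obtain ⟨F, hF, rfl⟩ := mem_image.1 hh
  obtain ⟨b, hb, rfl⟩ := mem_image.1 hy
  obtain ⟨a, ha, hae⟩ := mem_image.1 hU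
  have haU : a = xv n r σ U := encTup_inj hae
  subst haU
  unfold edgewiseT at hF
  rw [mem_filter, mem_powerset] at hF
  refine ⟨b, rfl, Finset.Nat.mem_antidiagonalTuple.1 (hF.1 hb), ?_, hF.2.2 _ ha b hb⟩
  have h1 : σ ⊆ F.sup tupSupp := by
    have := Finset.le_sup (f := tupSupp) ha
    rwa [tupSupp_xv n r σ U hσ hr] at this
  have h2 : σ = F.sup tupSupp := Finset.eq_of_subset_of_card_le h1 (hmax _ hF.2.1)
  rw [h2]
  exact Finset.le_sup (f := tupSupp) hb

lemma core (K : Type*) [Field K] (n r : ℕ) (Δ : SC) (hC : IsComplex Δ) (σ : Finset ℕ) (hσΔ : σ ∈ Δ)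
    (hmax : ∀ s ∈ Δ, s.card ≤ σ.card) (hσ : σ ⊆ range n) (hr : 2 * σ.card ≤ r)
    (j i : ℕ) (hj : 1 ≤ j) (hjd : j + 1 ≤ σ.card)
    (hlow : 2 ^ (σ.card / (σ.card - j)) * ((σ.card - j) + σ.card % (σ.card - j)) ≤
      i + j + 2 * (σ.card - j))
    (hup : i + 2 ^ σ.card ≤ nverts (edgewise n r Δ) + 1) :
    bettiSR K (edgewise n r Δ) i (i + j) ≠ 0 := by
  set d := σ.card with hd
  set p := d - j with hpdef
  have hp : 0 < p := by omega
  have hpd : p ≤ d := by omega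
  have hd0 : 0 < σ.card := by omega
  set Γ := edgewise n r Δ with hΓ
  have hΓC : IsComplex Γ := edgewise_complex n r Δ hC
  set φ := phi n r σ with hφdef
  have hφ : ∀ U ∈ Ioo ∅ (range d), ∀ U' ∈ Ioo ∅ (range d), φ U = φ U' → U = U' := by
    intro U hU U' hU' h
    exact xv_inj n r σ U U' hσ hr hU hU' (encTup_inj h)
  set L := LL d p with hL
  set E := EE d p with hE
  have hLm := LL_mem d p hp
  have hLc : L.card = j := by rw [hL, LL_card d p hp hpd]; omega
  set g := L.image (fun l => φ (range l)) with hg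
  have hrng : ∀ l ∈ L, range l ∈ Ioo ∅ (range d) := by
    intro l hl
    obtain ⟨h1, h2, _⟩ := hLm l hl
    rw [mem_Ioo]
    constructor
    · exact Finset.empty_ssubset.2 ⟨0, by simpa using h1⟩
    · refine lt_of_le_of_ne (Finset.range_subset_range.2 h2.le) ?_
      intro h
      have := congrArg Finset.card h
      simp at this; omega
  have hgc : g.card = j := by
    rw [hg, Finset.card_image_of_injOn, hLc]
    intro l hl m hm h
    have := congrArg Finset.card (hφ _ (hrng l hl) _ (hrng m hm) h)
    simpa using this
  obtain ⟨l0, hl0⟩ : L.Nonempty := Finset.card_pos.1 (by omega)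
  have hu0g : φ (range l0) ∈ g := Finset.mem_image_of_mem _ hl0
  have hgΓ : g ∈ Γ := by
    have := chain_face n r Δ hC σ hσΔ hσ hr hd0 (L.image range) (by
      intro U hU U' hU'
      obtain ⟨l, _, rfl⟩ := mem_image.1 hU
      obtain ⟨m, _, rfl⟩ := mem_image.1 hU'
      rcases le_total l m with h | h
      · exact Or.inl (Finset.range_subset_range.2 h)
      · exact Or.inr (Finset.range_subset_range.2 h))
    rw [Finset.image_image] at this
    exact this
  set V := vertexSet Γ with hV
  set R := (V \ g).filter (fun y => insert y g ∈ Γ) with hR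
  -- bound on R
  set A := (Finset.Nat.antidiagonalTuple n r).filter
    (fun b => b ≠ xv n r σ (range l0) ∧ tupSupp b ⊆ σ ∧ edgeOK (xv n r σ (range l0)) b) with hA
  have hAc : A.card + 2 ≤ 2 ^ σ.card := by
    apply count_nb σ (Finset.card_pos.1 hd0) (xv n r σ (range l0)) (xv_sum n r σ _ hσ hr hd0)
      (tupSupp_xv n r σ _ hσ hr).le
    intro b hb
    rw [hA, mem_filter, Finset.Nat.mem_antidiagonalTuple] at hb
    exact ⟨hb.2.1, hb.1, hb.2.2.1, hb.2.2.2⟩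
  have hRA : R ∪ g.erase (φ (range l0)) ⊆ A.image encTup := by
    intro y hy
    have hy' : insert y g ∈ Γ ∧ y ≠ φ (range l0) := by
      rcases mem_union.1 hy with h | h
      · rw [hR, mem_filter, mem_sdiff] at h
        exact ⟨h.2, fun he => h.1.2 (he ▸ hu0g)⟩
      · rw [mem_erase] at h
        rw [Finset.insert_eq_of_mem h.2]
        exact ⟨hgΓ, h.1⟩
    obtain ⟨b, rfl, hb1, hb2, hb3⟩ := star_mem n r Δ σ hmax hσ hr _ hy'.1 (range l0)
      (Finset.mem_insert_of_mem hu0g) y (Finset.mem_insert_self _ _)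
    refine mem_image.2 ⟨b, ?_, rfl⟩
    rw [hA, mem_filter, Finset.Nat.mem_antidiagonalTuple]
    refine ⟨hb1, ?_, hb2, hb3⟩
    intro hbe
    apply hy'.2
    rw [hbe]; rfl
  have hRc : R.card + (j - 1) + 2 ≤ 2 ^ d := by
    have h1 := (Finset.card_le_card hRA).trans Finset.card_image_le
    rw [Finset.card_union_of_disjoint, Finset.card_erase_of_mem hu0g, hgc] at h1
    · rw [← hd] at hAc
      omega
    · rw [Finset.disjoint_left]
      intro y h1 h2
      rw [hR, mem_filter, mem_sdiff] at h1
      exact h1.1.2 (Finset.mem_of_mem_erase h2)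
  have hRV : R ⊆ V := (Finset.filter_subset _ _).trans Finset.sdiff_subset
  -- T
  have hTsub : (TT d p).image φ ⊆ V \ R := by
    intro y hy
    obtain ⟨U, hU, rfl⟩ := mem_image.1 hy
    obtain ⟨hU1, hU2⟩ := TT_mem d p hp hpd U hU
    rw [mem_sdiff]
    constructor
    · have h1 : {φ U} ∈ Γ := by
        have := chain_face n r Δ hC σ hσΔ hσ hr hd0 {U} (by simp)
        simpa using this
      rw [hV]
      exact (Finset.le_sup (f := id) h1) (Finset.mem_singleton_self _)
    · intro hUR
      rw [hR, mem_filter, mem_sdiff] at hUR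
      have hcg : φ (range U.card) ∈ g := Finset.mem_image_of_mem _ hU2
      obtain ⟨b, hbe, hb1, hb2, hb3⟩ := star_mem n r Δ σ hmax hσ hr _ hUR.2 (range U.card)
        (Finset.mem_insert_of_mem hcg) (φ U) (Finset.mem_insert_self _ _)
      have hb : xv n r σ U = b := encTup_inj hbe
      subst hb
      have hUd : U ⊆ range σ.card := (mem_Ioo.1 hU1).2.le
      have hcd : range U.card ⊆ range σ.card := (mem_Ioo.1 (hrng _ hU2)).2.le
      have hUe : range U.card = U := by
        rcases subset_of_edgeOK n r σ _ _ hσ hr hcd hUd hb3 with h | h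
        · exact Finset.eq_of_subset_of_card_le h (by simp)
        · exact (Finset.eq_of_subset_of_card_le h (by simp)).symm
      rw [hUe] at hcg
      exact hUR.1.2 hcg
  have hTc := TT_card d p hp hpd
  obtain ⟨W, hW1, hW2, hWc⟩ := Finset.exists_subsuperset_card_eq (n := i + j) hTsub
    (Finset.card_image_le.trans (by omega)) (by
      rw [Finset.card_sdiff_of_subset hRV]
      have : nverts Γ = V.card := rfl
      omega)
  apply betti_ne_zero Γ i (i + j) W (hW2.trans Finset.sdiff_subset) hWc
  have hji : ((i + j : ℕ) : ℤ) - (i : ℤ) = ((j : ℕ) : ℤ) := by push_cast; ring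
  rw [hji]
  refine redH_of_maximal (inducedSC Γ W) j (zcyc K d E L φ) ?_
    (zcyc_bdry d E L φ hLm hφ) g
    (zcyc_top d E L φ (fun l hl => ⟨(hLm l hl).1, (hLm l hl).2.1⟩) (EE_le d p hp hpd) ?_ hφ) ?_
  · intro s hs
    obtain ⟨π, hπ, rfl⟩ := zcyc_supp d E L φ s hs
    have hpT : ∀ l ∈ L, pre π l ∈ TT d p := fun l hl => pre_mem_TT d p hp hpd π hπ l hl
    constructor
    · unfold inducedSC
      rw [mem_filter]
      constructor
      · have := chain_face n r Δ hC σ hσΔ hσ hr hd0 (L.image (pre π)) (by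
          intro U hU U' hU'
          obtain ⟨l, _, rfl⟩ := mem_image.1 hU
          obtain ⟨m, _, rfl⟩ := mem_image.1 hU'
          rcases le_total l m with h | h
          · exact Or.inl (pre_mono π h)
          · exact Or.inr (pre_mono π h))
        rw [Finset.image_image] at this
        exact this
      · intro y hy
        obtain ⟨l, hl, rfl⟩ := mem_image.1 hy
        exact hW1 (Finset.mem_image_of_mem _ (hpT l hl))
    · rw [Finset.card_image_of_injOn, hLc]
      intro l hl m hm h
      have := congrArg Finset.card
        (hφ _ (TT_mem d p hp hpd _ (hpT l hl)).1 _ (TT_mem d p hp hpd _ (hpT m hm)).1 h)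
      rwa [card_pre π (hLm l hl).2.1.le, card_pre π (hLm m hm).2.1.le] at this
  · intro l h1 h2
    by_cases hlE : l ∈ E
    · exact Or.inr hlE
    · left
      rw [hL]; unfold LL
      rw [mem_sdiff, mem_range]
      exact ⟨by omega, hlE⟩
  · intro h hh hgh
    unfold inducedSC at hh
    rw [mem_filter] at hh
    obtain ⟨y, hy, hyg⟩ := Finset.exists_of_ssubset hgh
    have hyR : y ∉ R := (mem_sdiff.1 (hW2 (hh.2 hy))).2
    apply hyR
    rw [hR, mem_filter, mem_sdiff]
    refine ⟨⟨(mem_sdiff.1 (hW2 (hh.2 hy))).1, hyg⟩, ?_⟩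
    exact hΓC h hh.1 _ (Finset.insert_subset hy hgh.1)

lemma choose_bound (d : ℕ) (hd : 2 ≤ d) :
    Nat.choose (2 * d - 1) (d - 1) + 2 ^ d ≤ Nat.choose (3 * d - 1) (d - 1) + 2 := by
  obtain ⟨e, rfl⟩ : ∃ e, d = e + 1 := ⟨d - 1, by omega⟩
  have h1 : 3 * (e + 1) - 1 = (e + 1) + (2 * (e + 1) - 1) := by omega
  rw [h1, Nat.add_sub_cancel, Nat.add_choose_eq, Finset.Nat.sum_antidiagonal_eq_sum_range_succ
    (fun a b => (e + 1).choose a * (2 * (e + 1) - 1).choose b), Finset.sum_range_succ']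
  have h2 : ∑ k ∈ range e, (e + 1).choose (k + 1) ≤
      ∑ k ∈ range e, (e + 1).choose (k + 1) * (2 * (e + 1) - 1).choose (e - (k + 1)) := by
    apply Finset.sum_le_sum
    intro k _
    exact Nat.le_mul_of_pos_right _ (Nat.choose_pos (by omega))
  have h3 := Nat.sum_range_choose (e + 1)
  rw [Finset.sum_range_succ, Finset.sum_range_succ'] at h3
  simp at h3 ⊢
  omega

end MainPart

/-- Nonvanishing ranges for the Betti numbers of the edgewise
subdivision `Δ^{⟨r⟩}`, `r ≥ 2d`, of a `(d-1)`-dimensional complex `Δ`, with bound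
`B = C(2d-1,d-1) - d + pdim(K[Δ^{⟨r⟩}]) + depth(K[Δ]) - C(3d-1,d-1)`. -/
theorem statement_18 (K : Type*) [Field K] (d n : ℕ) (hd : 2 ≤ d) (Δ : SC)
    (hC : IsComplex Δ) (hdim : Δ.sup Finset.card = d)
    (hvert : vertexSet Δ = Finset.range n) (r : ℕ) (hr : 2 * d ≤ r) :
    (∀ j i : ℕ, 1 ≤ j → 2 * j ≤ d → j ≤ i →
      (i : ℤ) ≤ (Nat.choose (2 * d - 1) (d - 1) : ℤ) - d +
        (pdimSR K (edgewise n r Δ) : ℤ) + (depthSR K Δ : ℤ) -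
        (Nat.choose (3 * d - 1) (d - 1) : ℤ) →
      bettiSR K (edgewise n r Δ) i (i + j) ≠ 0) ∧
    (∀ j i : ℕ, d ≤ 2 * j → j ≤ d - 2 → mj d j ≤ i →
      (i : ℤ) ≤ (Nat.choose (2 * d - 1) (d - 1) : ℤ) - d +
        (pdimSR K (edgewise n r Δ) : ℤ) + (depthSR K Δ : ℤ) -
        (Nat.choose (3 * d - 1) (d - 1) : ℤ) →
      bettiSR K (edgewise n r Δ) i (i + j) ≠ 0) ∧
    (∀ i : ℕ, 2 ^ d - d - 1 ≤ i →
      (i : ℤ) ≤ (Nat.choose (2 * d - 1) (d - 1) : ℤ) - d +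
        (pdimSR K (edgewise n r Δ) : ℤ) + (depthSR K Δ : ℤ) -
        (Nat.choose (3 * d - 1) (d - 1) : ℤ) →
      bettiSR K (edgewise n r Δ) i (i + (d - 1)) ≠ 0) := by
  have hmax0 : ∀ s ∈ Δ, s.card ≤ d := fun s hs => hdim ▸ Finset.le_sup (f := Finset.card) hs
  have hne : Δ.Nonempty := by
    rw [Finset.nonempty_iff_ne_empty]
    rintro rfl
    simp at hdim
    omega
  obtain ⟨σ, hσΔ, hσc⟩ := Finset.exists_mem_eq_sup Δ hne Finset.card
  rw [hdim] at hσc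
  subst hσc
  have hσ : σ ⊆ Finset.range n := hvert ▸ Finset.le_sup (f := id) hσΔ
  have hdep : depthSR K Δ ≤ σ.card := depth_le Δ hC σ hσΔ hmax0
  have hVne : (vertexSet (edgewise n r Δ)).Nonempty := by
    have h1 := chain_face n r Δ hC σ hσΔ hσ hr (by omega) {∅} (by simp)
    exact ⟨phi n r σ ∅, (Finset.le_sup (f := id) h1) (by simp)⟩
  have hpd := pdim_lt (K := K) (edgewise n r Δ) (edgewise_complex n r Δ hC) hVne
  have hch := choose_bound σ.card hd
  have hpow : 2 ^ 2 ≤ 2 ^ σ.card := Nat.pow_le_pow_right (by norm_num) hd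
  have main := core K n r Δ hC σ hσΔ hmax0 hσ hr
  have hup : ∀ i : ℕ, (i : ℤ) ≤ (Nat.choose (2 * σ.card - 1) (σ.card - 1) : ℤ) - σ.card +
        (pdimSR K (edgewise n r Δ) : ℤ) + (depthSR K Δ : ℤ) -
        (Nat.choose (3 * σ.card - 1) (σ.card - 1) : ℤ) →
      i + 2 ^ σ.card ≤ nverts (edgewise n r Δ) + 1 := by
    intro i hi
    omega
  generalize σ.card = d at *
  have hsmall : ∀ j i : ℕ, 1 ≤ j → 2 * j ≤ d → j ≤ i →
      2 ^ (d / (d - j)) * ((d - j) + d % (d - j)) ≤ i + j + 2 * (d - j) := by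
    intro j i hj h2 hi
    rcases h2.lt_or_eq with h | h
    · have e1 : d / (d - j) = 1 := by
        rw [Nat.div_eq_iff (by omega)]; omega
      have e2 : d % (d - j) = j := by
        rw [Nat.mod_eq_sub_mod (by omega), Nat.mod_eq_of_lt (by omega)]; omega
      rw [e1, e2]; omega
    · have e0 : d - j = j := by omega
      have e1 : d / j = 2 := by rw [← h]; exact Nat.mul_div_cancel _ hj
      have e2 : d % j = 0 := by rw [← h]; simp
      rw [e0, e1, e2]; omega
  refine ⟨?_, ?_, ?_⟩
  · intro j i h1 h2 h3 h4
    exact main j i h1 (by omega) (hsmall j i h1 h2 h3) (hup i h4)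
  · intro j i h1 h2 h3 h4
    refine main j i (by omega) (by omega) ?_ (hup i h4)
    unfold mj at h3
    split_ifs at h3 with h
    · exact hsmall j i (by omega) h h3
    · have e0 : d = (2 * j - d) + (d - j) * 2 := by omega
      have e1 : d / (d - j) = (2 * j - d) / (d - j) + 2 := by
        conv_lhs => rw [e0]
        have : ((2 * j - d) + (d - j) * 2) - j = d - j := by omega
        rw [this, Nat.add_mul_div_left _ _ (by omega)]
      have e2 : d % (d - j) = (2 * j - d) % (d - j) := by
        conv_lhs => rw [e0]
        have : ((2 * j - d) + (d - j) * 2) - j = d - j := by omega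
        rw [this, Nat.add_mul_mod_self_left]
      rw [e1, e2, add_comm (d - j)]
      generalize 2 ^ ((2 * j - d) / (d - j) + 2) * ((2 * j - d) % (d - j) + (d - j)) = X at *
      omega
  · intro i h1 h2
    refine main (d - 1) i (by omega) (by omega) ?_ (hup i h2)
    have e : d - (d - 1) = 1 := by omega
    rw [e, Nat.div_one, Nat.mod_one, add_zero, mul_one]
    have hpw : d + 1 ≤ 2 ^ d := Nat.lt_two_pow_self
    omega
end
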